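/- arXiv:1607.00579 — 7 statements merged into one kernel-verified Lean document; each statement's English description precedes it below -/
import Mathlib

section
/- If α_1, …, α_t ∈ ℂ are algebraic numbers that are linearly independent over ℚ, then e^{α_1}, …, e^{α_t} are algebraically independent over ℚ. -/
theorem LW_intPoly {K : Type*} [Field K] [NumberField K] (B : Finset K) (h0 : (0 : K) ∉ B) :
    ∃ f : Polynomial ℤ, f.eval 0 ≠ 0 ∧ ∀ b ∈ B, Polynomial.aeval b f = 0 := by
  classical
  have key : ∀ b : K, b ≠ 0 → ∃ f : Polynomial ℤ, f.eval 0 ≠ 0 ∧ Polynomial.aeval b f = 0 := by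
    intro b hb
    have halg : IsAlgebraic ℤ b :=
      (IsFractionRing.isAlgebraic_iff ℤ ℚ K).2 (Algebra.IsAlgebraic.isAlgebraic b)
    obtain ⟨f, hf, h⟩ := halg.exists_nonzero_coeff_and_aeval_eq_zero
      (mem_nonZeroDivisors_of_ne_zero hb)
    exact ⟨f, by rwa [← Polynomial.coeff_zero_eq_eval_zero], h⟩
  choose! F hF using key
  refine ⟨∏ b ∈ B, F b, ?_, ?_⟩
  · rw [Polynomial.eval_prod, Finset.prod_ne_zero_iff]
    intro b hb
    exact (hF b (fun h => h0 (h ▸ hb))).1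
  · intro b hb
    rw [map_prod]
    exact Finset.prod_eq_zero hb (hF b (fun h => h0 (h ▸ hb))).2

theorem LW_integral {K : Type*} [Field K] (k : ℤ) (b : K) (hk : IsIntegral ℤ (k • b))
    (g : Polynomial ℤ) (D : ℕ) (hD : g.natDegree ≤ D) :
    IsIntegral ℤ ((k : K) ^ D * Polynomial.aeval b g) := by
  rw [Polynomial.aeval_eq_sum_range, Finset.mul_sum]
  refine IsIntegral.sum _ fun i hi => ?_
  have hi' : i ≤ D := by
    have := Finset.mem_range.1 hi
    omega
  have : (k : K) ^ D * (g.coeff i • b ^ i)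
      = algebraMap ℤ K (k ^ (D - i) * g.coeff i) * (k • b) ^ i := by
    obtain ⟨j, rfl⟩ := Nat.exists_eq_add_of_le hi'
    simp only [zsmul_eq_mul, Nat.add_sub_cancel_left, eq_intCast]
    push_cast
    ring
  rw [this]
  exact isIntegral_algebraMap.mul (hk.pow i)

open Filter Topology in
theorem LW_core {K : Type*} [Field K] [NumberField K] [IsGalois ℚ K] (φ : K →+* ℂ)
    (B : Finset K) (h0 : (0 : K) ∉ B)
    (hB : ∀ (σ : K ≃ₐ[ℚ] K), ∀ b ∈ B, σ b ∈ B) (W : K → ℤ)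
    (hW : ∀ (σ : K ≃ₐ[ℚ] K) b, W (σ b) = W b) (w0 : ℤ) (hw0 : w0 ≠ 0)
    (hsum : (w0 : ℂ) + ∑ b ∈ B, (W b : ℂ) * Complex.exp (φ b) = 0) : False := by
  classical
  obtain ⟨f, hf0, hfB⟩ := LW_intPoly B h0
  obtain ⟨k, hk0, hk⟩ := exists_integral_multiples ℤ ℚ B
  obtain ⟨c, hc⟩ := LindemannWeierstrass.exp_polynomial_approx f hf0
  set M : ℝ := ∑ b ∈ B, |(W b : ℝ)| with hM
  set A : ℝ := |(k : ℝ)| ^ f.natDegree * c with hA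
  have hlim : Tendsto (fun n : ℕ => M * A * (A ^ n / (n.factorial : ℝ))) atTop (𝓝 0) := by
    simpa using (FloorSemiring.tendsto_pow_div_factorial_atTop A).const_mul (M * A)
  obtain ⟨n0, hn0⟩ := eventually_atTop.1 (hlim.eventually (gt_mem_nhds (zero_lt_one (α := ℝ))))
  obtain ⟨p, hpge, hp⟩ := Nat.exists_infinite_primes
    (n0 + 1 + (f.eval 0).natAbs + 1 + k.natAbs + 1 + w0.natAbs + 1)
  obtain ⟨n, hpn, g, hgdeg, hg⟩ := hc p (by omega) hp
  set D := p * f.natDegree with hD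
  -- the integer
  have hfix : ∀ σ : K ≃ₐ[ℚ] K, σ ((k : K) ^ D * ∑ b ∈ B, (W b : K) * Polynomial.aeval b g)
      = (k : K) ^ D * ∑ b ∈ B, (W b : K) * Polynomial.aeval b g := by
    intro σ
    rw [map_mul, map_pow, map_intCast, map_sum]
    congr 1
    refine Finset.sum_bij (fun b _ => σ b) (fun b hb => hB σ b hb)
      (fun a _ b _ h => σ.injective h)
      (fun b hb => ⟨σ.symm b, hB σ.symm b hb, by simp⟩) ?_
    intro b hb
    rw [map_mul, map_intCast, hW]
    congr 1
    exact (Polynomial.aeval_algHom_apply (σ.toAlgHom.restrictScalars ℤ) b g).symm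
  obtain ⟨q, hq⟩ := (IsGalois.mem_range_algebraMap_iff_fixed _).2 hfix
  have hint : IsIntegral ℤ ((k : K) ^ D * ∑ b ∈ B, (W b : K) * Polynomial.aeval b g) := by
    rw [Finset.mul_sum]
    refine IsIntegral.sum _ fun b hb => ?_
    rw [mul_left_comm]
    exact (isIntegral_algebraMap (R := ℤ) (x := W b)).mul
      (LW_integral k b (hk b hb) g D (hgdeg.trans (Nat.sub_le _ _)))
  rw [← hq, isIntegral_algebraMap_iff (algebraMap ℚ K).injective,
    IsIntegrallyClosed.isIntegral_iff] at hint
  obtain ⟨z, rfl⟩ := hint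
  have hz : (z : ℂ) = (k : ℂ) ^ D * ∑ b ∈ B, (W b : ℂ) * Polynomial.aeval (φ b) g := by
    have := congrArg φ hq
    simp only [eq_intCast, map_intCast, map_mul, map_pow, map_sum] at this
    rw [this]
    congr 1
    refine Finset.sum_congr rfl fun b hb => ?_
    congr 1
    exact (Polynomial.aeval_algHom_apply φ.toIntAlgHom b g).symm
  set N : ℤ := k ^ D * n * w0 + p * z with hN
  have hN0 : N ≠ 0 := by
    intro h
    have hdvd : (p : ℤ) ∣ k ^ D * n * w0 := by
      refine ⟨-z, ?_⟩
      linarith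
    have hpp := Nat.prime_iff_prime_int.1 hp
    rcases hpp.dvd_or_dvd hdvd with h1 | h1
    · rcases hpp.dvd_or_dvd h1 with h2 | h2
      · have := hpp.dvd_of_dvd_pow h2
        have := Nat.le_of_dvd (Int.natAbs_pos.2 hk0) (Int.natCast_dvd.1 this)
        omega
      · exact hpn h2
    · have := Nat.le_of_dvd (Int.natAbs_pos.2 hw0) (Int.natCast_dvd.1 h1)
      omega
  have hNC : (N : ℂ) = -((k : ℂ) ^ D * ∑ b ∈ B, (W b : ℂ) *
      (n • Complex.exp (φ b) - p • Polynomial.aeval (φ b) g)) := by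
    have e1 : ∑ b ∈ B, (W b : ℂ) * (n • Complex.exp (φ b) - p • Polynomial.aeval (φ b) g)
        = n * (∑ b ∈ B, (W b : ℂ) * Complex.exp (φ b))
          - p * ∑ b ∈ B, (W b : ℂ) * Polynomial.aeval (φ b) g := by
      rw [Finset.mul_sum, Finset.mul_sum, ← Finset.sum_sub_distrib]
      refine Finset.sum_congr rfl fun b hb => ?_
      simp only [zsmul_eq_mul, nsmul_eq_mul]
      ring
    rw [e1, hN]
    push_cast
    rw [hz]
    linear_combination ((k : ℂ) ^ D * n) * hsum
  have hroot : ∀ b ∈ B, φ b ∈ f.aroots ℂ := by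
    intro b hb
    rw [Polynomial.mem_aroots]
    refine ⟨fun h => hf0 (by simp [h]), ?_⟩
    have := Polynomial.aeval_algHom_apply φ.toIntAlgHom b f
    rw [hfB b hb, map_zero] at this
    exact this
  have hbound : ‖(N : ℂ)‖ ≤ M * A * (A ^ (p - 1) / ((p - 1).factorial : ℝ)) := by
    rw [hNC, norm_neg, norm_mul, norm_pow, Complex.norm_intCast]
    have e2 : ‖∑ b ∈ B, (W b : ℂ) * (n • Complex.exp (φ b) - p • Polynomial.aeval (φ b) g)‖
        ≤ M * (c ^ p / ((p - 1).factorial : ℝ)) := by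
      rw [hM, Finset.sum_mul]
      refine norm_sum_le_of_le _ fun b hb => ?_
      rw [norm_mul, Complex.norm_intCast]
      exact mul_le_mul_of_nonneg_left (hg (hroot b hb)) (abs_nonneg _)
    refine (mul_le_mul_of_nonneg_left e2 (by positivity)).trans (le_of_eq ?_)
    have e3 : |(k : ℝ)| ^ D * c ^ p = A * A ^ (p - 1) := by
      rw [← pow_succ', Nat.sub_add_cancel hp.one_le, hA, mul_pow, ← pow_mul, hD,
        mul_comm p]
    calc _ = M * (|(k : ℝ)| ^ D * c ^ p) / ((p - 1).factorial : ℝ) := by ring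
      _ = _ := by rw [e3]; ring
  have h1 : (1 : ℝ) ≤ ‖(N : ℂ)‖ := by
    rw [Complex.norm_intCast]
    exact_mod_cast Int.one_le_abs hN0
  have := hn0 (p - 1) (by omega)
  linarith

/-- Evaluation of a formal rational combination of exponentials. -/
noncomputable def LW_E {K : Type*} [Field K] (φ : K →+* ℂ) : AddMonoidAlgebra ℚ K →ₐ[ℚ] ℂ :=
  AddMonoidAlgebra.lift ℚ ℂ K
    { toFun := fun a => Complex.exp (φ a.toAdd)
      map_one' := by simp
      map_mul' := fun a b => by simp [Complex.exp_add] }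

theorem LW_E_single {K : Type*} [Field K] (φ : K →+* ℂ) (a : K) (r : ℚ) :
    LW_E φ (AddMonoidAlgebra.single a r) = r * Complex.exp (φ a) := by
  simp [LW_E, AddMonoidAlgebra.lift_single, Algebra.smul_def]

theorem LW_E_apply {K : Type*} [Field K] (φ : K →+* ℂ) (F : AddMonoidAlgebra ℚ K) :
    LW_E φ F = ∑ a ∈ F.coeff.support, (F.coeff a : ℂ) * Complex.exp (φ a) := by
  simp [LW_E, AddMonoidAlgebra.lift_apply, Finsupp.sum, Algebra.smul_def]

/-- An invariant element with nonzero constant coefficient does not evaluate to zero. -/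
theorem LW_inv {K : Type*} [Field K] [NumberField K] [IsGalois ℚ K] (φ : K →+* ℂ)
    (F : AddMonoidAlgebra ℚ K) (hinv : ∀ (σ : K ≃ₐ[ℚ] K) b, F.coeff (σ b) = F.coeff b)
    (h0 : F.coeff 0 ≠ 0) (hE : LW_E φ F = 0) : False := by
  classical
  obtain ⟨d, hd⟩ := IsLocalization.exist_integer_multiples_of_finset (nonZeroDivisors ℤ)
    (F.coeff.support.image F.coeff)
  have hd0 : (d : ℤ) ≠ 0 := nonZeroDivisors.coe_ne_zero d
  have hd' : ∀ a : K, ∃ z : ℤ, (z : ℚ) = (d : ℤ) * F.coeff a := by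
    intro a
    by_cases ha : F.coeff a = 0
    · exact ⟨0, by simp [ha]⟩
    · obtain ⟨z, hz⟩ := hd (F.coeff a) (Finset.mem_image_of_mem _ (by simpa using ha))
      exact ⟨z, by simpa [Algebra.smul_def] using hz⟩
  choose W hW using hd'
  have hmem : (0 : K) ∈ F.coeff.support := by simpa using h0
  refine LW_core φ (F.coeff.support.erase 0) (by simp) ?_ W ?_ (W 0) ?_ ?_
  · intro σ b hb
    simp only [Finset.mem_erase, Finsupp.mem_support_iff] at hb ⊢
    rw [hinv]
    exact ⟨by simpa using hb.1, hb.2⟩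
  · intro σ b
    have : (W (σ b) : ℚ) = W b := by rw [hW, hW, hinv]
    exact_mod_cast this
  · intro h
    have := hW 0
    rw [h] at this
    have h2 : ((d : ℤ) : ℚ) ≠ 0 := by exact_mod_cast hd0
    simp [h2, h0] at this
  · have hWC : ∀ a, (W a : ℂ) = (d : ℤ) * (F.coeff a : ℂ) := by
      intro a
      exact_mod_cast congrArg (fun x : ℚ => (x : ℂ)) (hW a)
    have e : (W 0 : ℂ) = W 0 * Complex.exp (φ 0) := by simp
    rw [e, Finset.add_sum_erase _ (fun b => (W b : ℂ) * Complex.exp (φ b)) hmem]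
    rw [LW_E_apply] at hE
    simp_rw [hWC, mul_assoc]
    rw [← Finset.mul_sum, hE, mul_zero]

/-- Galois action on exponents. -/
noncomputable def LW_act {K : Type*} [Field K] [Algebra ℚ K] (σ : K ≃ₐ[ℚ] K) :
    AddMonoidAlgebra ℚ K ≃ₐ[ℚ] AddMonoidAlgebra ℚ K :=
  AddMonoidAlgebra.domCongr ℚ ℚ σ.toAddEquiv

theorem LW_act_coeff {K : Type*} [Field K] [Algebra ℚ K] (σ : K ≃ₐ[ℚ] K)
    (F : AddMonoidAlgebra ℚ K) (b : K) : (LW_act σ F).coeff b = F.coeff (σ.symm b) :=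
  AddMonoidAlgebra.coeff_domCongr _ _ _

theorem LW_act_mul {K : Type*} [Field K] [Algebra ℚ K] (σ τ : K ≃ₐ[ℚ] K)
    (F : AddMonoidAlgebra ℚ K) : LW_act σ (LW_act τ F) = LW_act (σ * τ) F := by
  ext b
  simp only [LW_act_coeff]
  rfl

theorem LW_ne_zero {K : Type*} [Field K] [NumberField K] [IsGalois ℚ K] (φ : K →+* ℂ)
    (F : AddMonoidAlgebra ℚ K) (hF : F ≠ 0) : LW_E φ F ≠ 0 := by
  classical
  intro hE
  set P : AddMonoidAlgebra ℚ K := ∏ σ : K ≃ₐ[ℚ] K, LW_act σ F with hP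
  have hP0 : P ≠ 0 := by
    rw [hP, Finset.prod_ne_zero_iff]
    intro σ _
    exact (map_ne_zero_iff _ (LW_act σ).injective).2 hF
  have hPinv : ∀ τ : K ≃ₐ[ℚ] K, LW_act τ P = P := by
    intro τ
    rw [hP, map_prod]
    simp_rw [LW_act_mul]
    exact Fintype.prod_equiv (Equiv.mulLeft τ) _ _ (fun σ => rfl)
  have hEP : LW_E φ P = 0 := by
    rw [hP, map_prod]
    refine Finset.prod_eq_zero (Finset.mem_univ 1) ?_
    have : LW_act (1 : K ≃ₐ[ℚ] K) F = F := by
      ext b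
      rw [LW_act_coeff]
      rfl
    rw [this, hE]
  have hPc : ∀ (τ : K ≃ₐ[ℚ] K) b, P.coeff (τ b) = P.coeff b := by
    intro τ b
    conv_lhs => rw [← hPinv τ]
    rw [LW_act_coeff, AlgEquiv.symm_apply_apply]
  obtain ⟨a, ha⟩ : ∃ a, P.coeff a ≠ 0 := by
    by_contra! h
    exact hP0 (by ext b; simpa using h b)
  set Q : AddMonoidAlgebra ℚ K :=
    ∑ σ : K ≃ₐ[ℚ] K, P * AddMonoidAlgebra.single (-(σ a)) 1 with hQ
  have hQc : ∀ b, Q.coeff b = ∑ σ : K ≃ₐ[ℚ] K, P.coeff (b + σ a) := by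
    intro b
    rw [hQ, AddMonoidAlgebra.coeff_sum, Finsupp.finsetSum_apply]
    refine Finset.sum_congr rfl fun σ _ => ?_
    simp [AddMonoidAlgebra.coeff_mul_single_apply]
  refine LW_inv φ Q ?_ ?_ ?_
  · intro τ b
    rw [hQc, hQc]
    symm
    refine Fintype.sum_equiv (Equiv.mulLeft τ) _ _ fun σ => ?_
    rw [← hPc τ]
    simp
  · rw [hQc]
    simp [hPc, ha]
  · rw [hQ, map_sum]
    exact Finset.sum_eq_zero fun σ _ => by rw [map_mul, hEP, zero_mul]

/-- **Lindemann–Weierstrass theorem**, algebraic-independence form: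
if `α₁, …, α_t` are algebraic numbers, linearly independent over `ℚ`, then
`e^{α₁}, …, e^{α_t}` are algebraically independent over `ℚ`. -/
theorem lindemann_weierstrass_algebraic_independence
    {t : ℕ} (α : Fin t → ℂ)
    (halg : ∀ i, IsAlgebraic ℚ (α i))
    (hlin : LinearIndependent ℚ α) :
    AlgebraicIndependent ℚ (fun i => Complex.exp (α i)) := by
  classical
  set f : Polynomial ℚ := ∏ i, minpoly ℚ (α i) with hf
  have hf0 : f ≠ 0 := Finset.prod_ne_zero_iff.2 fun i _ => minpoly.ne_zero (halg i).isIntegral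
  set K := IntermediateField.adjoin ℚ (f.rootSet ℂ) with hK
  have hsplit : f.IsSplittingField ℚ K :=
    IntermediateField.adjoin_rootSet_isSplittingField (IsAlgClosed.splits _)
  have : FiniteDimensional ℚ K := Polynomial.IsSplittingField.finiteDimensional K f
  have : NumberField K := { }
  have : Normal ℚ K := Normal.of_isSplittingField f
  have : IsGalois ℚ K := { }
  have hmem : ∀ i, α i ∈ K := fun i => by
    refine IntermediateField.subset_adjoin _ _ ?_
    rw [Polynomial.mem_rootSet]
    refine ⟨hf0, ?_⟩
    rw [hf, map_prod]
    exact Finset.prod_eq_zero (Finset.mem_univ i) (minpoly.aeval _ _)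
  let β : Fin t → K := fun i => ⟨α i, hmem i⟩
  let ψ : (Fin t →₀ ℕ) →+ K :=
    { toFun := fun m => ∑ i, (m i : K) * β i
      map_zero' := by simp
      map_add' := fun m n => by simp [add_mul, Finset.sum_add_distrib] }
  have hψ : Function.Injective ψ := by
    intro m n h
    have h' : ∑ i, ((m i : ℚ) - n i) • α i = 0 := by
      have := congrArg (algebraMap K ℂ) h
      simp only [ψ, AddMonoidHom.coe_mk, ZeroHom.coe_mk, map_sum, map_mul, map_natCast] at this
      have hβ : ∀ i, algebraMap K ℂ (β i) = α i := fun i => rfl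
      simp only [hβ] at this
      simp only [Algebra.smul_def, map_sub, map_natCast, sub_mul, Finset.sum_sub_distrib]
      rw [this, sub_self]
    have := Fintype.linearIndependent_iff.1 hlin _ h'
    ext i
    have hi := sub_eq_zero.1 (this i)
    exact_mod_cast hi
  let Φ : MvPolynomial (Fin t) ℚ →ₐ[ℚ] AddMonoidAlgebra ℚ K :=
    AddMonoidAlgebra.mapDomainAlgHom ℚ ℚ ψ
  have hΦ : Function.Injective Φ := AddMonoidAlgebra.mapDomain_injective hψ
  have hcomp : MvPolynomial.aeval (fun i => Complex.exp (α i))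
      = (LW_E (algebraMap K ℂ)).comp Φ := by
    refine MvPolynomial.algHom_ext fun i => ?_
    have h1 : Φ (MvPolynomial.X i) = AddMonoidAlgebra.single (ψ (Finsupp.single i 1)) 1 :=
      AddMonoidAlgebra.mapDomain_single
    have h2 : ψ (Finsupp.single i 1) = β i := by
      simp [ψ, Finsupp.single_apply]
    rw [AlgHom.comp_apply, h1, h2, LW_E_single, MvPolynomial.aeval_X]
    simp [β]
  rw [algebraicIndependent_iff]
  intro p hp
  by_contra hne
  rw [hcomp, AlgHom.comp_apply] at hp
  exact LW_ne_zero _ _ ((map_ne_zero_iff _ hΦ).2 hne) hp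
end

section
/- If β_1, …, β_N ∈ ℂ are pairwise distinct algebraic numbers, then e^{β_1}, …, e^{β_N} are linearly independent over ℚ. -/
open Polynomial in
lemma lw_int_poly (S : Finset ℂ) (hS : ∀ k ∈ S, IsAlgebraic ℤ k) (h0 : (0:ℂ) ∉ S) :
    ∃ f : ℤ[X], f.eval 0 ≠ 0 ∧ ∀ k ∈ S, aeval k f = 0 := by
  classical
  have h : ∀ k : ℂ, ∃ f : ℤ[X], f.eval 0 ≠ 0 ∧ (k ∈ S → aeval k f = 0) := by
    intro k
    by_cases hk : k ∈ S
    · have hk0 : k ≠ 0 := fun h => h0 (h ▸ hk)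
      obtain ⟨q, hq0, hq⟩ := (hS k hk).exists_nonzero_coeff_and_aeval_eq_zero
        (mem_nonZeroDivisors_of_ne_zero hk0)
      exact ⟨q, by rwa [← coeff_zero_eq_eval_zero], fun _ => hq⟩
    · exact ⟨1, by simp, fun h => absurd h hk⟩
  choose g hg1 hg2 using h
  refine ⟨∏ k ∈ S, g k, ?_, fun k hk => ?_⟩
  · rw [eval_prod]
    exact Finset.prod_ne_zero_iff.mpr fun k _ => hg1 k
  · rw [map_prod]
    exact Finset.prod_eq_zero hk (hg2 k hk)

open Polynomial in
lemma lw_integral {K : Type*} [Field K] (a : ℤ) (k : K) (h : IsIntegral ℤ (a • k))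
    (g : ℤ[X]) (N : ℕ) (hN : g.natDegree ≤ N) : IsIntegral ℤ ((a:K) ^ N * aeval k g) := by
  rw [aeval_eq_sum_range, Finset.mul_sum]
  refine IsIntegral.sum _ fun i hi => ?_
  have hi' : i ≤ N := by
    have := Finset.mem_range.mp hi
    omega
  have : (a:K) ^ N * (g.coeff i • k ^ i) = ((g.coeff i * a ^ (N - i) : ℤ) : K) * (a • k) ^ i := by
    conv_lhs => rw [← Nat.sub_add_cancel hi', pow_add]
    simp only [zsmul_eq_mul]
    push_cast
    ring
  rw [this]
  exact (isIntegral_algebraMap (R := ℤ) (A := K) (x := (g.coeff i * a ^ (N - i) : ℤ))).mul (h.pow i)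

open Polynomial Filter in
lemma lw_core (K : IntermediateField ℚ ℂ) [FiniteDimensional ℚ K] [IsGalois ℚ K]
    (w : K → ℤ) (S : Finset K) (h0 : (0:K) ∉ S) (w0 : ℤ) (hw0 : w0 ≠ 0)
    (hS : ∀ σ : K ≃ₐ[ℚ] K, ∀ k ∈ S, σ k ∈ S) (hw : ∀ σ : K ≃ₐ[ℚ] K, ∀ k, w (σ k) = w k)
    (hsum : (w0 : ℂ) + ∑ k ∈ S, (w k : ℂ) * Complex.exp k = 0) : False := by
  classical
  obtain ⟨f, hf0, hf⟩ := lw_int_poly (S.image (fun k : K => (k:ℂ))) (by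
      intro k hk
      obtain ⟨k, -, rfl⟩ := Finset.mem_image.mp hk
      have h1 : IsAlgebraic ℚ k := Algebra.IsAlgebraic.isAlgebraic k
      have h2 : IsAlgebraic ℚ (k:ℂ) := h1.algebraMap (A := ℂ)
      exact (IsFractionRing.isAlgebraic_iff ℤ ℚ ℂ).mpr h2) (by
      intro h
      obtain ⟨k, hk, h⟩ := Finset.mem_image.mp h
      have : k = 0 := by exact_mod_cast h
      exact h0 (this ▸ hk))
  have hfne : f ≠ 0 := by rintro rfl; simp at hf0
  obtain ⟨c, hc⟩ := LindemannWeierstrass.exp_polynomial_approx f hf0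
  obtain ⟨a, ha0, ha⟩ := exists_integral_multiples ℤ ℚ S
  set d := f.natDegree with hd
  set C : ℝ := ∑ k ∈ S, |(w k : ℝ)| with hC
  set B : ℝ := |(a:ℝ)| ^ d * c with hB
  have ht : Tendsto (fun n : ℕ => C * B * (B ^ n / (n.factorial : ℝ))) atTop (nhds 0) := by
    simpa using (FloorSemiring.tendsto_pow_div_factorial_atTop B).const_mul (C * B)
  have ht2 := (ht.eventually (gt_mem_nhds (zero_lt_one (α := ℝ))))
  obtain ⟨n0, hn0⟩ := eventually_atTop.mp ht2
  obtain ⟨p, hp, hprime⟩ := Nat.exists_infinite_primes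
    (n0 + (eval 0 f).natAbs + a.natAbs + w0.natAbs + 1)
  obtain ⟨n, hpn, g, hgdeg, hg⟩ := hc p (by omega) hprime
  set M : K := ∑ k ∈ S, (w k : K) * aeval k g with hM
  have hMint : IsIntegral ℤ ((a:K) ^ (p * d) * M) := by
    rw [hM, Finset.mul_sum]
    refine IsIntegral.sum _ fun k hk => ?_
    rw [mul_left_comm]
    exact (isIntegral_algebraMap (R := ℤ) (A := K) (x := w k)).mul
      (lw_integral a k (ha k hk) g _ (by omega))
  have hMfix : ∀ σ : K ≃ₐ[ℚ] K, σ M = M := by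
    intro σ
    rw [hM, map_sum]
    refine Finset.sum_bij (fun k _ => σ k) (fun k hk => hS σ k hk)
      (fun _ _ _ _ h => σ.injective h)
      (fun k hk => ⟨σ.symm k, hS _ k hk, by simp⟩) (fun k hk => ?_)
    rw [hw, map_mul, map_intCast]
    congr 1
    exact (aeval_algHom_apply (σ.toAlgHom.restrictScalars ℤ) k g).symm
  obtain ⟨q, hq⟩ := IntermediateField.mem_bot.mp ((IsGalois.mem_bot_iff_fixed M).mpr hMfix)
  have hqint : IsIntegral ℤ ((a:ℚ) ^ (p * d) * q) := by
    rw [← isIntegral_algebraMap_iff (algebraMap ℚ K).injective]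
    rw [map_mul, map_pow, hq]
    simpa using hMint
  obtain ⟨m, hm⟩ := IsIntegrallyClosed.isIntegral_iff.mp hqint
  have hmM : (m : ℂ) = (a:ℂ) ^ (p*d) * ∑ k ∈ S, (w k : ℂ) * aeval (k:ℂ) g := by
    have h1 : (m : K) = (a:K) ^ (p*d) * M := by
      have := congrArg (algebraMap ℚ K) hm
      rw [map_mul, map_pow, hq] at this
      simpa using this
    have h2 := congrArg (algebraMap K ℂ) h1
    rw [map_mul, map_pow, hM, map_sum] at h2
    simp only [map_mul, map_intCast, ← aeval_algebraMap_apply] at h2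
    exact h2
  have hJ : a ^ (p * d) * n * w0 + p * m ≠ 0 := by
    intro h
    have hpp : Prime (p:ℤ) := Nat.prime_iff_prime_int.mp hprime
    have hdvd : (p:ℤ) ∣ a ^ (p * d) * n * w0 := ⟨-m, by linarith⟩
    have small : ∀ x : ℤ, x ≠ 0 → x.natAbs < p → ¬ (p:ℤ) ∣ x := by
      intro x hx hlt hdv
      have := Nat.le_of_dvd (Int.natAbs_pos.mpr hx) (Int.natCast_dvd.mp hdv)
      omega
    rcases hpp.dvd_or_dvd hdvd with h | h
    · rcases hpp.dvd_or_dvd h with h | h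
      · exact small a ha0 (by omega) (hpp.dvd_of_dvd_pow h)
      · exact hpn h
    · exact small w0 hw0 (by omega) h
  have hJ1 : (1:ℝ) ≤ ‖((a ^ (p * d) * n * w0 + p * m : ℤ) : ℂ)‖ := by
    rw [Complex.norm_intCast]
    exact_mod_cast Int.one_le_abs hJ
  have hJeq : ((a ^ (p * d) * n * w0 + p * m : ℤ) : ℂ) =
      -((a:ℂ) ^ (p*d) * ∑ k ∈ S, (w k : ℂ) * (n • Complex.exp k - p • aeval (k:ℂ) g)) := by
    push_cast
    rw [hmM]
    have : (w0:ℂ) = - ∑ k ∈ S, (w k : ℂ) * Complex.exp k := by linear_combination hsum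
    rw [this]
    simp only [zsmul_eq_mul, nsmul_eq_mul, mul_sub, Finset.sum_sub_distrib, mul_left_comm (w _ : ℂ),
      ← Finset.mul_sum]
    ring
  have hbound : ‖((a ^ (p * d) * n * w0 + p * m : ℤ) : ℂ)‖ ≤
      |(a:ℝ)| ^ (p*d) * (C * (c ^ p / ((p - 1).factorial : ℝ))) := by
    rw [hJeq, norm_neg, norm_mul, norm_pow, Complex.norm_intCast]
    gcongr
    refine (norm_sum_le _ _).trans ?_
    rw [hC, Finset.sum_mul]
    refine Finset.sum_le_sum fun k hk => ?_
    rw [norm_mul, Complex.norm_intCast]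
    gcongr
    apply hg
    rw [mem_aroots]
    exact ⟨hfne, hf _ (Finset.mem_image_of_mem _ hk)⟩
  have hlt := hn0 (p - 1) (by omega)
  have hfin : |(a:ℝ)| ^ (p*d) * (C * (c ^ p / ((p - 1).factorial : ℝ))) =
      C * B * (B ^ (p-1) / ((p - 1).factorial : ℝ)) := by
    have : B ^ p = B * B ^ (p-1) := by
      rw [← pow_succ', Nat.sub_add_cancel hprime.one_le]
    have h2 : B ^ p = |(a:ℝ)| ^ (p*d) * c ^ p := by
      rw [hB, mul_pow, ← pow_mul, mul_comm d p]
    calc _ = C * (|(a:ℝ)| ^ (p*d) * c ^ p) / ((p - 1).factorial : ℝ) := by ring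
      _ = _ := by rw [← h2, this]; ring
  linarith

lemma lw_coeff_domCongr {K : Type*} [Field K] [Algebra ℚ K] (σ : K ≃+ K)
    (y : AddMonoidAlgebra ℚ K) (k : K) :
    (AddMonoidAlgebra.domCongr ℚ ℚ σ y).coeff (σ k) = y.coeff k := by
  simp 

lemma lw_galois (K : IntermediateField ℚ ℂ) [FiniteDimensional ℚ K] [IsGalois ℚ K]
    (x : AddMonoidAlgebra ℚ K) (hx : x ≠ 0)
    (hsum : x.coeff.sum (fun k r => (r:ℂ) * Complex.exp k) = 0) : False := by
  classical
  let T : (K ≃ₐ[ℚ] K) → AddMonoidAlgebra ℚ K ≃ₐ[ℚ] AddMonoidAlgebra ℚ K :=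
    fun σ => AddMonoidAlgebra.domCongr ℚ ℚ (σ : K ≃+ K)
  have hTs : ∀ σ k r, T σ (AddMonoidAlgebra.single k r) = AddMonoidAlgebra.single (σ k) r :=
    fun σ k r => AddMonoidAlgebra.domCongr_single _ _ _
  have hTc : ∀ σ y k, (T σ y).coeff (σ k) = y.coeff k :=
    fun σ y k => lw_coeff_domCongr (σ : K ≃+ K) y k
  have hTm : ∀ σ τ y, T σ (T τ y) = T (σ * τ) y := by
    intro σ τ y
    ext k
    obtain ⟨k, rfl⟩ := (σ * τ).surjective k
    rw [hTc, AlgEquiv.mul_apply, hTc, hTc]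
  let F : Multiplicative K →* ℂ :=
    { toFun := fun k => Complex.exp ((k.toAdd : K) : ℂ)
      map_one' := by simp
      map_mul' := fun a b => by simp [Complex.exp_add] }
  let E := AddMonoidAlgebra.lift ℚ ℂ K F
  have hE : ∀ y, E y = y.coeff.sum (fun k r => (r:ℂ) * Complex.exp k) := by
    intro y
    simp only [E, AddMonoidAlgebra.lift_apply, F, Rat.smul_def]
    rfl
  let y := ∏ σ, T σ x
  have hT1 : T 1 x = x := by
    ext k
    exact hTc 1 x k
  have hy : y ≠ 0 := Finset.prod_ne_zero_iff.mpr fun σ _ => by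
    simpa using hx
  have hyE : E y = 0 := by
    simp only [y, map_prod]
    refine Finset.prod_eq_zero (Finset.mem_univ 1) ?_
    rw [hT1, hE, hsum]
  have hyT : ∀ σ, T σ y = y := by
    intro σ
    simp only [y, map_prod, hTm]
    exact Fintype.prod_equiv (Equiv.mulLeft σ) _ _ (fun _ => rfl)
  have hyc : ∀ σ : K ≃ₐ[ℚ] K, ∀ k, y.coeff (σ k) = y.coeff k := by
    intro σ k
    conv_lhs => rw [← hyT σ]
    exact hTc σ y k
  obtain ⟨b, hb⟩ : ∃ b, y.coeff b ≠ 0 := by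
    by_contra! h
    exact hy (by ext k; simpa using h k)
  let u : AddMonoidAlgebra ℚ K := ∑ σ : K ≃ₐ[ℚ] K, AddMonoidAlgebra.single (-(σ b)) 1
  have huT : ∀ σ, T σ u = u := by
    intro σ
    simp only [u, map_sum, hTs, map_neg]
    exact Fintype.sum_equiv (Equiv.mulLeft σ) _ _ (fun _ => rfl)
  let z := y * u
  have hzE : E z = 0 := by simp only [z, map_mul, hyE, zero_mul]
  have hzT : ∀ σ, T σ z = z := fun σ => by simp only [z, map_mul, hyT, huT]
  have hzc : ∀ σ : K ≃ₐ[ℚ] K, ∀ k, z.coeff (σ k) = z.coeff k := by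
    intro σ k
    conv_lhs => rw [← hzT σ]
    exact hTc σ z k
  have hz0 : z.coeff 0 ≠ 0 := by
    have h1 : ∀ σ : K ≃ₐ[ℚ] K,
        (y * AddMonoidAlgebra.single (-(σ b)) (1:ℚ)).coeff 0 = y.coeff b := by
      intro σ
      rw [← hyc σ b]
      simp
    have : z.coeff 0 = (Fintype.card (K ≃ₐ[ℚ] K) : ℚ) * y.coeff b := by
      simp only [z, u, Finset.mul_sum, AddMonoidAlgebra.coeff_sum, Finsupp.finsetSum_apply, h1]
      simp
    rw [this]
    exact mul_ne_zero (by exact_mod_cast Fintype.card_ne_zero) hb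
  obtain ⟨m, hm⟩ := IsLocalization.exist_integer_multiples_of_finset (nonZeroDivisors ℤ)
    (z.coeff.support.image z.coeff)
  have hm0 : ((m:ℤ):ℚ) ≠ 0 := by exact_mod_cast nonZeroDivisors.ne_zero m.2
  have hw : ∀ k, ∃ t : ℤ, (t:ℚ) = (m:ℤ) * z.coeff k := by
    intro k
    by_cases hk : k ∈ z.coeff.support
    · obtain ⟨t, ht⟩ := hm _ (Finset.mem_image_of_mem _ hk)
      exact ⟨t, by simpa using ht⟩
    · exact ⟨0, by simp [Finsupp.notMem_support_iff.mp hk]⟩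
  choose w hw using hw
  refine lw_core K w (z.coeff.support.erase 0) (by simp) (w 0) ?_ ?_ ?_ ?_
  · intro h
    have := hw 0
    rw [h] at this
    exact mul_ne_zero hm0 hz0 (by simpa using this.symm)
  · intro σ k hk
    simpa [hzc] using hk
  · intro σ k
    have : (w (σ k) : ℚ) = w k := by rw [hw, hw, hzc]
    exact_mod_cast this
  · have h1 : ∀ k, (w k : ℂ) = (m:ℤ) * (z.coeff k : ℂ) := by
      intro k
      exact_mod_cast congrArg (fun q : ℚ => (q:ℂ)) (hw k)
    have h2 : (w 0 : ℂ) = w 0 * Complex.exp ((0:K):ℂ) := by simp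
    rw [h2, Finset.add_sum_erase _ (fun k : K => (w k : ℂ) * Complex.exp k)
      (Finsupp.mem_support_iff.mpr hz0)]
    rw [hE, Finsupp.sum] at hzE
    simp only [h1, mul_assoc, ← Finset.mul_sum, hzE, mul_zero]

theorem lindemann_weierstrass_linear_independence
    {N : ℕ} (β : Fin N → ℂ)
    (halg : ∀ i, IsAlgebraic ℚ (β i))
    (hdist : Function.Injective β) :
    LinearIndependent ℚ (fun i => Complex.exp (β i)) := by
  classical
  let P : Polynomial ℚ := ∏ i, minpoly ℚ (β i)
  have hP : P ≠ 0 := Finset.prod_ne_zero_iff.mpr fun i _ =>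
    minpoly.ne_zero (halg i).isIntegral
  let K : IntermediateField ℚ ℂ := IntermediateField.adjoin ℚ (P.rootSet ℂ)
  have hsp : P.IsSplittingField ℚ K :=
    IntermediateField.adjoin_rootSet_isSplittingField (IsAlgClosed.splits _)
  have hfd : FiniteDimensional ℚ K := Polynomial.IsSplittingField.finiteDimensional K P
  have hn : Normal ℚ K := Normal.of_isSplittingField P
  have hg : IsGalois ℚ K := ⟨⟩
  have hmem : ∀ i, β i ∈ K := by
    intro i
    apply IntermediateField.subset_adjoin
    rw [Polynomial.mem_rootSet]
    refine ⟨hP, ?_⟩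
    simp only [P, map_prod]
    exact Finset.prod_eq_zero (Finset.mem_univ i) (minpoly.aeval ℚ (β i))
  let b : Fin N → K := fun i => ⟨β i, hmem i⟩
  have hb : Function.Injective b := fun i j h => hdist (congrArg Subtype.val h)
  rw [Fintype.linearIndependent_iff]
  intro g hgs
  by_contra! hne
  obtain ⟨i, hi⟩ := hne
  let x : K →₀ ℚ := Finsupp.embDomain ⟨b, hb⟩ (Finsupp.equivFunOnFinite.symm g)
  have hx : x (b i) = g i := Finsupp.embDomain_apply_self ⟨b, hb⟩ _ i
  refine lw_galois K (AddMonoidAlgebra.ofCoeff x) ?_ ?_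
  · intro h
    apply hi
    rw [← hx]
    have := congrArg (fun y => AddMonoidAlgebra.coeff y (b i)) h
    simpa using this
  · change x.sum _ = 0
    simp only [x, Finsupp.sum_embDomain]
    rw [Finsupp.sum_fintype _ _ (by simp)]
    simpa [Rat.smul_def] using hgs
end

section
/- Let t ≥ 1 and let α_1, …, α_t ∈ ℂ be algebraic numbers that are linearly independent over ℚ; for m = (m_1,…,m_t) ∈ ℤ^t write m·α = m_1α_1 + ⋯ + m_tα_t and |m| = |m_1| + ⋯ + |m_t|. Fix integers S, T ≥ 1, set Σ(S) = {m ∈ ℕ^t : |m| < S} and N = |Σ(S)|, and let φ be the map defined below on entire functions. Then for every entire function f(x) = Σ_{k=0}^∞ c_k x^k one has φ(f) = Σ_{k=NT}^∞ c_k φ(x^k) = Σ_{k=NT}^∞ c_k ( x^k − Σ_{m∈Σ(S), 0≤j<T} k^{(j)} (m·α)^{k−j} A_{m,j}(x) ), the series on the right converging uniformly on every compact subset of ℂ. -/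
open scoped BigOperators
open Filter

/-- `Σ(S)`: the (finite) set of tuples `m ∈ ℕ^t` with `|m| = m₁ + ⋯ + m_t < S`.
(Note that `∑ i, m i < S` forces `m i < S` for each `i`.) -/
def Sig (t S : ℕ) : Finset (Fin t → ℕ) :=
  (Fintype.piFinset fun _ => Finset.range S).filter fun m => ∑ i, m i < S

/-- `m·α = m₁α₁ + ⋯ + m_tα_t`. -/
noncomputable def dotN {t : ℕ} (α : Fin t → ℂ) (m : Fin t → ℕ) : ℂ :=
  ∑ i, (m i : ℂ) * α i

/-- The linear map `φ(f) = f − ∑_{m ∈ Σ(S), 0 ≤ j < T} f^{(j)}(m·α) A_{m,j}`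
on entire functions. -/
noncomputable def phi (t S T : ℕ) (α : Fin t → ℂ)
    (A : (Fin t → ℕ) → ℕ → Polynomial ℂ) (f : ℂ → ℂ) : ℂ → ℂ :=
  fun x => f x - ∑ m ∈ Sig t S, ∑ j ∈ Finset.range T,
    iteratedDeriv j f (dotN α m) * (A m j).eval x

open Polynomial in
theorem aux_poly_zero {ι : Type*} (s : Finset ι) (a : ι → ℂ) (ha : Set.InjOn a s) (T : ℕ)
    (P : Polynomial ℂ) (hdeg : P.degree < (s.card * T : ℕ))
    (hP : ∀ i ∈ s, ∀ l < T, (Polynomial.derivative^[l] P).eval (a i) = 0) : P = 0 := by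
  by_contra h0
  have hdvd : ∀ i ∈ s, (X - C (a i)) ^ T ∣ P := by
    intro i hi
    rw [← Polynomial.le_rootMultiplicity_iff h0]
    rcases T with _ | T
    · simp
    · exact (Polynomial.lt_rootMultiplicity_iff_isRoot_iterate_derivative h0).2
        (fun l hl => hP i hi l (by omega))
  have hprod : (∏ i ∈ s, (X - C (a i)) ^ T) ∣ P := by
    apply Finset.prod_dvd_of_coprime _ hdvd
    intro i hi j hj hij
    apply IsCoprime.pow
    apply Polynomial.isCoprime_X_sub_C_of_isUnit_sub
    exact (sub_ne_zero.2 fun h => hij (ha hi hj h)).isUnit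
  have h1 := Polynomial.degree_le_of_dvd hprod h0
  have h2 : (∏ i ∈ s, (X - C (a i)) ^ T).degree = ((s.card * T : ℕ) : WithBot ℕ) := by
    rw [Polynomial.degree_prod]
    simp [Polynomial.degree_pow]
  rw [h2] at h1
  exact absurd hdeg (not_lt.2 h1)

theorem aux_iter {F : ℕ → ℂ → ℂ} {f : ℂ → ℂ}
    (h : TendstoLocallyUniformlyOn F f atTop Set.univ)
    (hF : ∀ n, Differentiable ℂ (F n)) (j : ℕ) :
    (∀ n, Differentiable ℂ (iteratedDeriv j (F n))) ∧
    TendstoLocallyUniformlyOn (fun n => iteratedDeriv j (F n)) (iteratedDeriv j f)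
      atTop Set.univ := by
  induction j with
  | zero => simpa using ⟨hF, h⟩
  | succ j ih =>
    obtain ⟨h1, h2⟩ := ih
    constructor
    · intro n
      rw [iteratedDeriv_succ, ← differentiableOn_univ]
      exact (h1 n).differentiableOn.deriv isOpen_univ
    · have := h2.deriv (Eventually.of_forall fun n => (h1 n).differentiableOn) isOpen_univ
      simp only [iteratedDeriv_succ]
      exact this

theorem aux_sum {ι : Type*} (s : Finset ι) (F : ι → ℕ → ℂ → ℂ) (f : ι → ℂ → ℂ)
    (h : ∀ i ∈ s, TendstoLocallyUniformlyOn (F i) (f i) atTop Set.univ) :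
    TendstoLocallyUniformlyOn (fun n x => ∑ i ∈ s, F i n x) (fun x => ∑ i ∈ s, f i x)
      atTop Set.univ := by
  classical
  induction s using Finset.induction_on with
  | empty =>
    simp only [Finset.sum_empty]
    exact (tendsto_const_nhds.tendstoUniformlyOn_const _).tendstoLocallyUniformlyOn
  | insert i s hi ih =>
    simp only [Finset.sum_insert hi]
    exact (h i (by simp)).add (ih fun j hj => h j (by simp [hj]))

theorem aux_phi (t S T : ℕ) (α : Fin t → ℂ) (A : (Fin t → ℕ) → ℕ → Polynomial ℂ)
    {F : ℕ → ℂ → ℂ} {f : ℂ → ℂ}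
    (h : TendstoLocallyUniformlyOn F f atTop Set.univ)
    (hF : ∀ n, Differentiable ℂ (F n)) :
    TendstoLocallyUniformlyOn (fun n => phi t S T α A (F n)) (phi t S T α A f)
      atTop Set.univ := by
  unfold phi
  refine h.sub (aux_sum _ (fun m n x => ∑ j ∈ Finset.range T,
    iteratedDeriv j (F n) (dotN α m) * (A m j).eval x) _ fun m _ =>
    aux_sum _ (fun j n x => iteratedDeriv j (F n) (dotN α m) * (A m j).eval x) _ fun j _ => ?_)
  have h1 := (aux_iter h hF j).2.tendsto_at (Set.mem_univ (dotN α m))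
  have h2 := (h1.tendstoUniformlyOn_const (Set.univ : Set ℂ)).tendstoLocallyUniformlyOn
  have h3 : TendstoLocallyUniformlyOn (fun (_ : ℕ) (x : ℂ) => (A m j).eval x)
      (fun x => (A m j).eval x) atTop Set.univ := by
    intro u hu x _
    exact ⟨Set.univ, by simp, Eventually.of_forall fun n y _ => refl_mem_uniformity hu⟩
  exact h2.mul₀ h3 continuousOn_const (A m j).continuous.continuousOn

theorem aux_unif (f : ℂ → ℂ) (c : ℕ → ℂ)
    (hf : ∀ x : ℂ, HasSum (fun k => c k * x ^ k) (f x)) :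
    TendstoLocallyUniformlyOn (fun n x => ∑ k ∈ Finset.range n, c k * x ^ k) f
      atTop Set.univ := by
  rw [tendstoLocallyUniformlyOn_iff_forall_isCompact isOpen_univ]
  intro K _ hK
  obtain ⟨R, hR⟩ := hK.isBounded.exists_norm_le
  have hs := (hf (R : ℂ)).summable.norm
  have := tendstoUniformlyOn_tsum_nat (f := fun k (x : ℂ) => c k * x ^ k) hs (s := K) (by
    intro n x hx
    have h1 := hR x hx
    have : ‖x‖ ≤ |R| := h1.trans (le_abs_self R)
    simp only [norm_mul, norm_pow, Complex.norm_real, Real.norm_eq_abs]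
    gcongr)
  simpa only [(hf _).tsum_eq] using this

theorem aux_phi_pow (t S T : ℕ) (α : Fin t → ℂ) (A : (Fin t → ℕ) → ℕ → Polynomial ℂ)
    (k : ℕ) (x : ℂ) :
      phi t S T α A (fun y => y ^ k) x
        = x ^ k - ∑ m ∈ Sig t S, ∑ j ∈ Finset.range T,
            (Nat.descFactorial k j : ℂ) * dotN α m ^ (k - j) * (A m j).eval x := by
  unfold phi
  simp only [iteratedDeriv_pow]

theorem aux_phi_sum (t S T : ℕ) (α : Fin t → ℂ) (A : (Fin t → ℕ) → ℕ → Polynomial ℂ)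
    (c : ℕ → ℂ) (s : Finset ℕ) (x : ℂ) :
    phi t S T α A (fun y => ∑ k ∈ s, c k * y ^ k) x
      = ∑ k ∈ s, c k * phi t S T α A (fun y => y ^ k) x := by
  unfold phi
  have : ∀ j (a : ℂ), iteratedDeriv j (fun y => ∑ k ∈ s, c k * y ^ k) a
      = ∑ k ∈ s, c k * iteratedDeriv j (fun y => y ^ k) a := by
    intro j a
    rw [iteratedDeriv_fun_sum]
    · refine Finset.sum_congr rfl fun k _ => ?_
      rw [iteratedDeriv_const_mul_field]
    · intro k _
      fun_prop
  simp only [this, mul_sub, Finset.sum_sub_distrib]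
  congr 1
  simp only [Finset.mul_sum, Finset.sum_mul]
  conv_rhs => rw [Finset.sum_comm]
  refine Finset.sum_congr rfl fun m _ => ?_
  conv_rhs => rw [Finset.sum_comm]
  exact Finset.sum_congr rfl fun j _ => Finset.sum_congr rfl fun k _ => by ring

/-- Let `α₁,…,α_t` be algebraic numbers linearly independent over `ℚ`, let
`S, T ≥ 1`, `N = |Σ(S)|`, and let `A_{m,j}` (`m ∈ Σ(S)`, `0 ≤ j < T`) be the
interpolation polynomials of degree `< NT` with
`A_{m,j}^{(ℓ)}(n·α) = δ_{(m,j),(n,ℓ)}`.  Then for every entire function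
`f(x) = ∑_k c_k x^k` one has
`φ(f) = ∑_{k ≥ NT} c_k φ(x^k)
      = ∑_{k ≥ NT} c_k (x^k − ∑_{m,j} k^{(j)} (m·α)^{k−j} A_{m,j}(x))`,
the series converging uniformly on every compact subset of `ℂ`. -/
theorem phi_eq_tsum_of_entire
    {t : ℕ} (ht : 1 ≤ t) (α : Fin t → ℂ)
    (halg : ∀ i, IsAlgebraic ℚ (α i))
    (hlin : LinearIndependent ℚ α)
    (S T : ℕ) (hS : 1 ≤ S) (hT : 1 ≤ T)
    (N : ℕ) (hN : N = (Sig t S).card)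
    (A : (Fin t → ℕ) → ℕ → Polynomial ℂ)
    (hAdeg : ∀ m ∈ Sig t S, ∀ j < T, (A m j).degree < (N * T : ℕ))
    (hA : ∀ m ∈ Sig t S, ∀ j < T, ∀ n ∈ Sig t S, ∀ ℓ < T,
      (Polynomial.derivative^[ℓ] (A m j)).eval (dotN α n)
        = if m = n ∧ j = ℓ then 1 else 0)
    (f : ℂ → ℂ) (c : ℕ → ℂ)
    (hf : ∀ x : ℂ, HasSum (fun k => c k * x ^ k) (f x)) :
    (∀ (k : ℕ) (x : ℂ),
      phi t S T α A (fun y => y ^ k) x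
        = x ^ k - ∑ m ∈ Sig t S, ∑ j ∈ Finset.range T,
            (Nat.descFactorial k j : ℂ) * dotN α m ^ (k - j) * (A m j).eval x) ∧
    (∀ Kc : Set ℂ, IsCompact Kc →
      TendstoUniformlyOn
        (fun n x => ∑ k ∈ Finset.Ico (N * T) n, c k * phi t S T α A (fun y => y ^ k) x)
        (phi t S T α A f) atTop Kc) := by
  refine ⟨aux_phi_pow t S T α A, fun Kc hKc => ?_⟩
  have hinj : Set.InjOn (dotN α) (Sig t S) := by
    intro m hm n hn hmn
    by_contra hne
    have h1 := hA m hm 0 hT m hm 0 hT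
    have h2 := hA m hm 0 hT n hn 0 hT
    rw [← hmn, h1] at h2
    simp [hne] at h2
  have hzero : ∀ k < N * T, ∀ x, phi t S T α A (fun y => y ^ k) x = 0 := by
    intro k hk x
    let P : Polynomial ℂ := Polynomial.X ^ k - ∑ m ∈ Sig t S, ∑ j ∈ Finset.range T,
      Polynomial.C ((Nat.descFactorial k j : ℂ) * dotN α m ^ (k - j)) * A m j
    have hP : P = 0 := by
      apply aux_poly_zero (Sig t S) (dotN α) hinj T
      · rw [← hN, ← Polynomial.mem_degreeLT]
        refine Submodule.sub_mem _ ?_ (Submodule.sum_mem _ fun m hm =>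
          Submodule.sum_mem _ fun j hj => ?_)
        · rw [Polynomial.mem_degreeLT, Polynomial.degree_X_pow]
          exact_mod_cast hk
        · rw [← Polynomial.smul_eq_C_mul]
          refine Submodule.smul_mem _ _ ?_
          rw [Polynomial.mem_degreeLT]
          exact hAdeg m hm j (Finset.mem_range.1 hj)
      · intro n hn l hl
        have : ∀ m ∈ Sig t S, ∀ j ∈ Finset.range T,
            (Nat.descFactorial k j : ℂ) * dotN α m ^ (k - j) *
              (Polynomial.derivative^[l] (A m j)).eval (dotN α n)
            = if m = n then (if j = l then
              (Nat.descFactorial k j : ℂ) * dotN α m ^ (k - j) else 0) else 0 := by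
          intro m hm j hj
          rw [hA m hm j (Finset.mem_range.1 hj) n hn l hl]
          split_ifs <;> simp_all
        simp only [P, Polynomial.iterate_derivative_sub, Polynomial.iterate_derivative_sum,
          Polynomial.iterate_derivative_C_mul, Polynomial.eval_sub, Polynomial.eval_finsetSum,
          Polynomial.eval_mul, Polynomial.eval_C]
        rw [Finset.sum_congr rfl fun m hm => Finset.sum_congr rfl (this m hm)]
        simp [hn, hl, Polynomial.iterate_derivative_X_pow_eq_natCast_mul]
    have := congrArg (Polynomial.eval x) hP
    rw [aux_phi_pow]
    simpa [P, Polynomial.eval_finsetSum] using this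
  have h1 := aux_phi t S T α A (aux_unif f c hf) (fun n => by fun_prop)
  have h2 := (tendstoLocallyUniformlyOn_iff_forall_isCompact isOpen_univ).1 h1 Kc
    (Set.subset_univ _) hKc
  refine h2.congr ?_
  filter_upwards [eventually_ge_atTop (N * T)] with n hn x _
  simp only [aux_phi_sum]
  rw [← Finset.sum_range_add_sum_Ico _ hn, Finset.sum_eq_zero, zero_add]
  intro k hk
  rw [hzero k (Finset.mem_range.1 hk), mul_zero]
end

section
/- Let K ⊂ ℂ be a number field of degree d. For i = 0,…,t, let U_i = (U_{i,1},…,U_{i,n_i}) be independent families of indeterminates, and let R ∈ ℤ[U_0,…,U_t] be a multihomogeneous polynomial of multidegree (N_0,…,N_t) in these families. Suppose that for i = 0,…,t there exist u_i ∈ K^{n_i} and ε_i ∈ ℂ^{n_i} such that R(u_0,…,u_t) ≠ 0 and R(u_0+ε_0,…,u_t+ε_t) = 0. Then 1 ≤ 2^{N_0+⋯+N_t} · L(R)^d · H(u_0)^{dN_0} ⋯ H(u_t)^{dN_t} · max( ‖ε_0‖/‖u_0‖, …, ‖ε_t‖/‖u_t‖ ). -/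
open scoped BigOperators

/-- The maximum norm `‖v‖ = max_j |v j|` of a finite family of complex numbers. -/
noncomputable def supNorm {n : ℕ} (v : Fin n → ℂ) : ℝ := ⨆ j, ‖v j‖

/-- The length `L(R)` of a polynomial: the sum of the absolute values of its
(integer) coefficients. -/
noncomputable def lengthMv {σ : Type*} (R : MvPolynomial σ ℤ) : ℝ :=
  ∑ m ∈ R.support, ((|R.coeff m| : ℤ) : ℝ)

/-- `H_∞(u) = (∏_σ max_i |σ (u i)|)^{1/d}`, where the product runs over the `d`
embeddings `σ : K → ℂ` of the number field `K`. -/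
noncomputable def HinfV (K : IntermediateField ℚ ℂ) [NumberField K]
    {n : ℕ} (u : Fin n → K) : ℝ :=
  (∏ σ : K →+* ℂ, ⨆ i, ‖σ (u i)‖) ^ ((Module.finrank ℚ K : ℝ))⁻¹

/-- `H_fin(u) = N_{K/ℚ}(𝔞)^{-1/d}`, where `𝔞` is the fractional ideal of `K`
generated by the coordinates of `u`. -/
noncomputable def HfinV (K : IntermediateField ℚ ℂ) [NumberField K]
    {n : ℕ} (u : Fin n → K) : ℝ :=
  ((FractionalIdeal.absNorm (FractionalIdeal.spanFinset (NumberField.RingOfIntegers K)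
      (Finset.univ : Finset (Fin n)) u) : ℚ) : ℝ) ^ (-(Module.finrank ℚ K : ℝ)⁻¹)

/-- The absolute Weil height `H(u) = H_∞(u) · H_fin(u)` of a point `u ∈ K^n`. -/
noncomputable def HV (K : IntermediateField ℚ ℂ) [NumberField K]
    {n : ℕ} (u : Fin n → K) : ℝ := HinfV K u * HfinV K u

open scoped nonZeroDivisors

lemma aux_mul {x y x' y' : ℂ} {A A' s s' : ℝ} (hs : 1 ≤ s)
    (hx : ‖x‖ ≤ A) (hy : ‖y - x‖ ≤ A * (s - 1))
    (hx' : ‖x'‖ ≤ A') (hy' : ‖y' - x'‖ ≤ A' * (s' - 1)) :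
    ‖x * x'‖ ≤ A * A' ∧ ‖y * y' - x * x'‖ ≤ A * A' * (s * s' - 1) := by
  have hA : 0 ≤ A := (norm_nonneg _).trans hx
  have hA' : 0 ≤ A' := (norm_nonneg _).trans hx'
  constructor
  · rw [norm_mul]; gcongr
  · have e : y * y' - x * x' = (y - x) * (y' - x') + (y - x) * x' + x * (y' - x') := by ring
    have hAs : 0 ≤ A * (s - 1) := mul_nonneg hA (by linarith)
    calc ‖y * y' - x * x'‖ ≤ ‖y - x‖ * ‖y' - x'‖ + ‖y - x‖ * ‖x'‖ + ‖x‖ * ‖y' - x'‖ := by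
          rw [e]
          refine (norm_add_le _ _).trans ?_
          rw [norm_mul x]
          gcongr
          refine (norm_add_le _ _).trans ?_
          rw [norm_mul, norm_mul]
      _ ≤ A * (s - 1) * (A' * (s' - 1)) + A * (s - 1) * A' + A * (A' * (s' - 1)) := by
          gcongr
      _ = _ := by ring

lemma aux_pow {x y : ℂ} {A δ : ℝ} (hδ : 0 ≤ δ) (k : ℕ)
    (h : k ≠ 0 → ‖x‖ ≤ A ∧ ‖y - x‖ ≤ δ * A) :
    ‖x ^ k‖ ≤ A ^ k ∧ ‖y ^ k - x ^ k‖ ≤ A ^ k * ((1 + δ) ^ k - 1) := by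
  induction k with
  | zero => simp
  | succ k ih =>
    obtain ⟨h1, h2⟩ := h (by simp)
    obtain ⟨i1, i2⟩ := ih (fun _ => ⟨h1, h2⟩)
    simp only [pow_succ]
    refine aux_mul (one_le_pow₀ (by linarith)) i1 i2 h1 ?_
    linarith [mul_comm δ A]

lemma aux_prod {ι : Type*} (s : Finset ι) (x y : ι → ℂ) (A : ι → ℝ) (p : ι → ℕ) {δ : ℝ}
    (hδ : 0 ≤ δ) (h : ∀ i, p i ≠ 0 → ‖x i‖ ≤ A i ∧ ‖y i - x i‖ ≤ δ * A i) :
    ‖∏ i ∈ s, x i ^ p i‖ ≤ ∏ i ∈ s, A i ^ p i ∧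
    ‖∏ i ∈ s, y i ^ p i - ∏ i ∈ s, x i ^ p i‖ ≤
      (∏ i ∈ s, A i ^ p i) * ((1 + δ) ^ (∑ i ∈ s, p i) - 1) := by
  classical
  induction s using Finset.induction_on with
  | empty => simp
  | insert a s ha ih =>
    simp only [Finset.prod_insert ha, Finset.sum_insert ha, pow_add]
    obtain ⟨h1, h2⟩ := aux_pow hδ (p a) (h a)
    exact aux_mul (one_le_pow₀ (by linarith)) h1 h2 ih.1 ih.2

lemma aux_two {δ : ℝ} (h0 : 0 ≤ δ) (h1 : δ ≤ 1) (k : ℕ) : (1 + δ) ^ k - 1 ≤ 2 ^ k * δ := by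
  induction k with
  | zero => simpa using h0
  | succ k ih =>
    have : (1 + δ) ^ k ≤ 2 ^ k := by gcongr; linarith
    rw [pow_succ, pow_succ]
    nlinarith

lemma aux_prod_sigma {M : Type*} [CommMonoid M] {t : ℕ} {n : Fin (t + 1) → ℕ}
    {N : Fin (t + 1) → ℕ} (p : (Σ i : Fin (t + 1), Fin (n i)) → ℕ)
    (hp : ∀ i, ∑ j, p ⟨i, j⟩ = N i) (A : Fin (t + 1) → M) :
    ∏ k, A k.1 ^ p k = ∏ i, A i ^ N i := by
  rw [Fintype.prod_sigma]
  refine Finset.prod_congr rfl fun i _ => ?_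
  simp only
  rw [Finset.prod_pow_eq_pow_sum, hp]

lemma aux_bound {t : ℕ} {n : Fin (t + 1) → ℕ} {N : Fin (t + 1) → ℕ}
    (R : MvPolynomial (Σ i : Fin (t + 1), Fin (n i)) ℤ)
    (hR : ∀ p ∈ R.support, ∀ i : Fin (t + 1), ∑ j, p ⟨i, j⟩ = N i)
    (x y : (Σ i : Fin (t + 1), Fin (n i)) → ℂ) (A : Fin (t + 1) → ℝ) {δ : ℝ} (hδ : 0 ≤ δ)
    (h : ∀ k, N k.1 ≠ 0 → ‖x k‖ ≤ A k.1 ∧ ‖y k - x k‖ ≤ δ * A k.1) :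
    ‖MvPolynomial.aeval x R‖ ≤ lengthMv R * ∏ i, A i ^ N i ∧
    ‖MvPolynomial.aeval y R - MvPolynomial.aeval x R‖ ≤
      lengthMv R * ((∏ i, A i ^ N i) * ((1 + δ) ^ (∑ i, N i) - 1)) := by
  have key : ∀ p ∈ R.support, ‖∏ k, x k ^ p k‖ ≤ ∏ i, A i ^ N i ∧
      ‖∏ k, y k ^ p k - ∏ k, x k ^ p k‖ ≤ (∏ i, A i ^ N i) * ((1 + δ) ^ (∑ i, N i) - 1) := by
    intro p hp
    have := aux_prod Finset.univ x y (fun k => A k.1) p hδ (by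
      intro k hk
      apply h
      rw [← hR p hp k.1]
      intro h0
      rw [Finset.sum_eq_zero_iff] at h0
      exact hk (h0 k.2 (Finset.mem_univ _)))
    rw [aux_prod_sigma p (hR p hp), Fintype.sum_sigma, Finset.sum_congr rfl (fun i _ => hR p hp i)] at this
    exact this
  simp only [MvPolynomial.aeval_def, MvPolynomial.eval₂_eq', lengthMv]
  rw [← Finset.sum_sub_distrib, Finset.sum_mul, Finset.sum_mul]
  constructor
  · refine (norm_sum_le _ _).trans (Finset.sum_le_sum fun p hp => ?_)
    rw [norm_mul]
    have : ‖(algebraMap ℤ ℂ) (R.coeff p)‖ = ((|R.coeff p| : ℤ) : ℝ) := by simp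
    rw [this]
    exact mul_le_mul_of_nonneg_left (key p hp).1 (by positivity)
  · refine (norm_sum_le _ _).trans (Finset.sum_le_sum fun p hp => ?_)
    rw [← mul_sub, norm_mul]
    have : ‖(algebraMap ℤ ℂ) (R.coeff p)‖ = ((|R.coeff p| : ℤ) : ℝ) := by simp
    rw [this]
    exact mul_le_mul_of_nonneg_left (key p hp).2 (by positivity)

lemma aux_mem_pow {A K : Type*} [CommRing A] [Field K] [Algebra A K]
    [IsFractionRing A K] {ι : Type*} (s : Finset ι) (I : ι → FractionalIdeal A⁰ K) (x : ι → K)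
    (p : ι → ℕ) (h : ∀ i, x i ∈ I i) : ∏ i ∈ s, x i ^ p i ∈ ∏ i ∈ s, I i ^ p i := by
  classical
  have hpow : ∀ i k, x i ^ k ∈ I i ^ k := by
    intro i k
    induction k with
    | zero => simp
    | succ k ih => rw [pow_succ, pow_succ]; exact FractionalIdeal.mul_mem_mul ih (h i)
  induction s using Finset.induction_on with
  | empty => simp
  | insert a s ha ih =>
    rw [Finset.prod_insert ha, Finset.prod_insert ha]
    exact FractionalIdeal.mul_mem_mul (hpow _ _) ih

lemma aux_mem {A K : Type*} [CommRing A] [Field K] [Algebra A K]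
    [IsFractionRing A K] {t : ℕ} {n : Fin (t + 1) → ℕ} {N : Fin (t + 1) → ℕ}
    (R : MvPolynomial (Σ i : Fin (t + 1), Fin (n i)) ℤ)
    (hR : ∀ p ∈ R.support, ∀ i : Fin (t + 1), ∑ j, p ⟨i, j⟩ = N i)
    (u : ∀ i : Fin (t + 1), Fin (n i) → K) (I : Fin (t + 1) → FractionalIdeal A⁰ K)
    (h : ∀ i j, u i j ∈ I i) :
    MvPolynomial.aeval (fun p : (Σ i : Fin (t + 1), Fin (n i)) => u p.1 p.2) R ∈
      ∏ i, I i ^ N i := by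
  simp only [MvPolynomial.aeval_def, MvPolynomial.eval₂_eq']
  rw [← FractionalIdeal.mem_coe]
  refine Submodule.sum_mem _ fun p hp => ?_
  have hm : ∏ k, u k.1 k.2 ^ p k ∈ ∏ i, I i ^ N i := by
    have e0 : ∏ k : (Σ i : Fin (t + 1), Fin (n i)), I k.1 ^ p k = ∏ i, I i ^ N i :=
      aux_prod_sigma p (hR p hp) I
    rw [← e0]
    have h2 := aux_mem_pow (A := A) (K := K) (ι := Σ i : Fin (t + 1), Fin (n i)) Finset.univ
      (fun k => I k.1) (fun k => u k.1 k.2) (fun k => p k) (fun k => h k.1 k.2)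
    exact h2
  have e : (algebraMap ℤ K) (R.coeff p) * ∏ k, u k.1 k.2 ^ p k =
      (((R.coeff p : ℤ) : A)) • ∏ k, u k.1 k.2 ^ p k := by
    rw [Algebra.smul_def]; simp
  rw [e]
  exact Submodule.smul_mem _ _ hm

lemma aux_norm {K : Type*} [Field K] [NumberField K]
    (J : FractionalIdeal (NumberField.RingOfIntegers K)⁰ K) (x : K) (hx : x ≠ 0) (h : x ∈ J) :
    FractionalIdeal.absNorm J ≤ |Algebra.norm ℚ x| := by
  have hle : FractionalIdeal.spanSingleton (NumberField.RingOfIntegers K)⁰ x ≤ J := by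
    rwa [FractionalIdeal.spanSingleton_le_iff_mem]
  have hJ : J ≠ 0 := by
    rintro rfl
    exact hx (by simpa using h)
  rw [← FractionalIdeal.absNorm_span_singleton (NumberField.RingOfIntegers K) x]
  set S := FractionalIdeal.spanSingleton (NumberField.RingOfIntegers K)⁰ x with hS
  have hS0 : S ≠ 0 := FractionalIdeal.spanSingleton_ne_zero_iff.mpr hx
  have h1 : J⁻¹ * S ≤ 1 := by
    calc J⁻¹ * S ≤ J⁻¹ * J := by gcongr
      _ = 1 := inv_mul_cancel₀ hJ
  obtain ⟨I, hI⟩ := FractionalIdeal.le_one_iff_exists_coeIdeal.mp h1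
  have h2 : S = J * I := by rw [hI, mul_inv_cancel_left₀ hJ]
  have hI0 : FractionalIdeal.absNorm (I : FractionalIdeal (NumberField.RingOfIntegers K)⁰ K) ≠ 0 := by
    rw [Ne, FractionalIdeal.absNorm_eq_zero_iff]
    intro h0
    rw [h0, mul_zero] at h2
    exact hS0 h2
  rw [h2, map_mul]
  refine le_mul_of_one_le_right (FractionalIdeal.absNorm_nonneg _) ?_
  rw [FractionalIdeal.coeIdeal_absNorm] at hI0 ⊢
  exact_mod_cast Nat.one_le_iff_ne_zero.mpr (by exact_mod_cast hI0)

lemma aux_norm_emb {K : Type*} [Field K] [NumberField K] (x : K) :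
    ((|Algebra.norm ℚ x| : ℚ) : ℝ) = ∏ σ : K →+* ℂ, ‖σ x‖ := by
  have h := congr_arg (‖·‖) (Algebra.norm_eq_prod_embeddings ℚ ℂ x)
  simp only [norm_prod] at h
  have e : ∏ σ : K →ₐ[ℚ] ℂ, ‖σ x‖ = ∏ σ : K →+* ℂ, ‖σ x‖ :=
    (Fintype.prod_equiv (RingHom.equivRatAlgHom K ℂ) _ _ (fun _ => rfl)).symm
  rw [← e, ← h]
  simp

lemma aux_HV (K : IntermediateField ℚ ℂ) [NumberField K] {n : ℕ} (u : Fin n → K) (N : ℕ) :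
    HV K u ^ (Module.finrank ℚ K * N) = (∏ σ : K →+* ℂ, ⨆ i, ‖σ (u i)‖) ^ N *
      (((FractionalIdeal.absNorm (FractionalIdeal.spanFinset (NumberField.RingOfIntegers K)
      (Finset.univ : Finset (Fin n)) u) : ℚ) : ℝ) ^ N)⁻¹ := by
  have hd : Module.finrank ℚ K ≠ 0 := Module.finrank_pos.ne'
  rw [pow_mul, HV, mul_pow, HinfV, HfinV, Real.rpow_neg, Real.rpow_inv_natCast_pow _ hd, inv_pow,
    Real.rpow_inv_natCast_pow _ hd, mul_pow, inv_pow]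
  · exact_mod_cast FractionalIdeal.absNorm_nonneg _
  · exact Finset.prod_nonneg fun σ _ => Real.iSup_nonneg fun i => norm_nonneg _
  · exact_mod_cast FractionalIdeal.absNorm_nonneg _

set_option maxHeartbeats 1000000 in
/-- Let `K ⊂ ℂ` be a number field of degree `d`, and let `R ∈ ℤ[U₀,…,U_t]` be
multihomogeneous of multidegree `(N₀,…,N_t)` in independent families of
indeterminates `U i = (U_{i,1},…,U_{i,n_i})`.  If `u i ∈ K^{n_i}` and
`ε i ∈ ℂ^{n_i}` satisfy `R(u₀,…,u_t) ≠ 0` and `R(u₀+ε₀,…,u_t+ε_t) = 0`, then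
`1 ≤ 2^{N₀+⋯+N_t} L(R)^d H(u₀)^{dN₀} ⋯ H(u_t)^{dN_t} max_i (‖ε i‖/‖u i‖)`. -/
theorem height_lower_bound_for_zero_of_multihomogeneous
    (K : IntermediateField ℚ ℂ) [NumberField K]
    (d : ℕ) (hd : d = Module.finrank ℚ K)
    (t : ℕ) (n : Fin (t + 1) → ℕ) (hn : ∀ i, 1 ≤ n i)
    (N : Fin (t + 1) → ℕ)
    (R : MvPolynomial (Σ i : Fin (t + 1), Fin (n i)) ℤ)
    (hR : ∀ p ∈ R.support, ∀ i : Fin (t + 1), ∑ j, p ⟨i, j⟩ = N i)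
    (u : ∀ i : Fin (t + 1), Fin (n i) → K)
    (ε : ∀ i : Fin (t + 1), Fin (n i) → ℂ)
    (hRu : MvPolynomial.aeval (fun p => (u p.1 p.2 : ℂ)) R ≠ 0)
    (hRuε : MvPolynomial.aeval (fun p => (u p.1 p.2 : ℂ) + ε p.1 p.2) R = 0) :
    1 ≤ 2 ^ (∑ i, N i) * lengthMv R ^ d * (∏ i, HV K (u i) ^ (d * N i))
        * ⨆ i, supNorm (ε i) / supNorm (fun j => (u i j : ℂ)) := by
  classical
  subst hd
  set δ := ⨆ i, supNorm (ε i) / supNorm (fun j => (u i j : ℂ)) with hδdef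
  have hsn : ∀ {m : ℕ} (v : Fin m → ℂ), 0 ≤ supNorm v := fun v =>
    Real.iSup_nonneg fun i => norm_nonneg _
  have hle : ∀ {m : ℕ} (v : Fin m → ℂ) j, ‖v j‖ ≤ supNorm v := fun v j =>
    le_ciSup (f := fun j => ‖v j‖) (Set.finite_range _).bddAbove j
  have hδ : 0 ≤ δ := Real.iSup_nonneg fun i => div_nonneg (hsn _) (hsn _)
  set r : K := MvPolynomial.aeval (fun p => u p.1 p.2) R with hr
  have hσ : ∀ σ : K →+* ℂ, σ r = MvPolynomial.aeval (fun p => σ (u p.1 p.2)) R := by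
    intro σ
    simp only [hr, MvPolynomial.aeval_def, MvPolynomial.eval₂_eq', map_sum, map_mul, map_prod,
      map_pow]
    simp
  have hval : ((r : K) : ℂ) = MvPolynomial.aeval (fun p => (u p.1 p.2 : ℂ)) R :=
    hσ (algebraMap K ℂ)
  have hr0 : r ≠ 0 := by
    intro h0
    apply hRu
    rw [← hval, h0]; simp
  -- nonvanishing of u i
  have hu0 : ∀ i, N i ≠ 0 → ∃ j, u i j ≠ 0 := by
    intro i hi
    by_contra! hcon
    apply hr0
    simp only [hr, MvPolynomial.aeval_def, MvPolynomial.eval₂_eq']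
    refine Finset.sum_eq_zero fun p hp => ?_
    have : ∃ j, p ⟨i, j⟩ ≠ 0 := by
      by_contra! hc
      apply hi
      rw [← hR p hp i]
      exact Finset.sum_eq_zero fun j _ => hc j
    obtain ⟨j, hj⟩ := this
    rw [Finset.prod_eq_zero (Finset.mem_univ (⟨i, j⟩ : Σ i : Fin (t + 1), Fin (n i))), mul_zero]
    simp [hcon j, hj]
  set S : (K →+* ℂ) → Fin (t + 1) → ℝ := fun σ i => ⨆ j, ‖σ (u i j)‖ with hS
  set B : (K →+* ℂ) → ℝ := fun σ => lengthMv R * ∏ i, S σ i ^ N i with hB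
  have hBσ : ∀ σ : K →+* ℂ, ‖σ r‖ ≤ B σ := by
    intro σ
    rw [hσ]
    refine (aux_bound R hR _ (fun p => σ (u p.1 p.2)) (S σ) le_rfl ?_).1
    intro k _
    exact ⟨hle (fun j => σ (u k.1 j)) k.2, by simp⟩
  have hB0 : ∀ σ, 0 ≤ B σ := fun σ => (norm_nonneg _).trans (hBσ σ)
  have hBid : ‖algebraMap K ℂ r‖ ≤ B (algebraMap K ℂ) * (2 ^ (∑ i, N i) * δ) := by
    rcases le_total 1 δ with h1 | h1
    · refine (hBσ _).trans (le_mul_of_one_le_right (hB0 _) ?_)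
      exact one_le_mul_of_one_le_of_one_le (one_le_pow₀ (by norm_num)) h1
    · have hb := (aux_bound R hR (fun p => (u p.1 p.2 : ℂ))
        (fun p => (u p.1 p.2 : ℂ) + ε p.1 p.2) (S (algebraMap K ℂ)) hδ ?_).2
      · rw [hRuε, zero_sub, norm_neg, ← hval, ← mul_assoc] at hb
        refine hb.trans ?_
        exact mul_le_mul_of_nonneg_left (aux_two hδ h1 _) (hB0 _)
      · rintro ⟨i, j⟩ hN
        refine ⟨hle (fun j => (u i j : ℂ)) j, ?_⟩
        simp only [add_sub_cancel_left]
        obtain ⟨j', hj'⟩ := hu0 i hN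
        have hpos : 0 < supNorm (fun j => (u i j : ℂ)) :=
          lt_of_lt_of_le (norm_pos_iff.mpr (by simpa using hj')) (hle (fun j => (u i j : ℂ)) j')
        refine (hle (ε i) j).trans ?_
        have : supNorm (ε i) / supNorm (fun j => (u i j : ℂ)) ≤ δ :=
          le_ciSup (f := fun i => supNorm (ε i) / supNorm (fun j => (u i j : ℂ)))
            (Set.finite_range _).bddAbove i
        exact (div_le_iff₀ hpos).mp this
  -- product over embeddings
  have hprod : ∏ σ : K →+* ℂ, ‖σ r‖ ≤ (∏ σ, B σ) * (2 ^ (∑ i, N i) * δ) := by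
    rw [← Finset.mul_prod_erase _ _ (Finset.mem_univ (algebraMap K ℂ)),
      ← Finset.mul_prod_erase _ B (Finset.mem_univ (algebraMap K ℂ)), mul_right_comm]
    refine mul_le_mul hBid (Finset.prod_le_prod (fun _ _ => norm_nonneg _) fun σ _ => hBσ σ)
      (Finset.prod_nonneg fun _ _ => norm_nonneg _) (mul_nonneg (hB0 _) (by positivity))
  set I : Fin (t + 1) → FractionalIdeal (NumberField.RingOfIntegers K)⁰ K := fun i =>
    FractionalIdeal.spanFinset (NumberField.RingOfIntegers K) Finset.univ (u i) with hI
  have hmem : r ∈ ∏ i, I i ^ N i := by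
    refine aux_mem R hR u I fun i j => ?_
    rw [← FractionalIdeal.mem_coe, hI, FractionalIdeal.spanFinset_coe]
    exact Submodule.subset_span ⟨j, by simp, rfl⟩
  have hnorm := aux_norm _ r hr0 hmem
  clear_value r
  have hnorm' : ∏ i, ((FractionalIdeal.absNorm (I i) : ℚ) : ℝ) ^ N i ≤
      (∏ σ, B σ) * (2 ^ (∑ i, N i) * δ) := by
    refine le_trans ?_ hprod
    rw [← aux_norm_emb]
    rw [map_prod] at hnorm
    simp only [map_pow] at hnorm
    exact_mod_cast hnorm
  have hpos : 0 < ∏ i, ((FractionalIdeal.absNorm (I i) : ℚ) : ℝ) ^ N i := by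
    refine Finset.prod_pos fun i _ => ?_
    rcases eq_or_ne (N i) 0 with h0 | h0
    · simp [h0]
    · refine pow_pos ?_ _
      have h1 : FractionalIdeal.absNorm (I i) ≠ 0 := by
        rw [Ne, FractionalIdeal.absNorm_eq_zero_iff]
        obtain ⟨j, hj⟩ := hu0 i h0
        exact FractionalIdeal.spanFinset_ne_zero.mpr ⟨j, Finset.mem_univ _, hj⟩
      exact_mod_cast lt_of_le_of_ne (FractionalIdeal.absNorm_nonneg _) h1.symm
  have hcard : (∏ σ, B σ) = lengthMv R ^ Module.finrank ℚ K * ∏ i, (∏ σ, S σ i) ^ N i := by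
    simp only [hB, Finset.prod_mul_distrib, Finset.prod_const, Finset.card_univ,
      NumberField.Embeddings.card]
    rw [Finset.prod_comm]
    simp only [Finset.prod_pow]
  simp only [aux_HV, Finset.prod_mul_distrib, Finset.prod_inv_distrib]
  change 1 ≤ 2 ^ (∑ i, N i) * lengthMv R ^ Module.finrank ℚ K *
    ((∏ i, (∏ σ, S σ i) ^ N i) * (∏ i, ((FractionalIdeal.absNorm (I i) : ℚ) : ℝ) ^ N i)⁻¹) * δ
  rw [hcard] at hnorm'
  calc (1 : ℝ) ≤ _ := (one_le_div hpos).mpr hnorm'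
    _ = _ := by ring
end

section
/- Let K ⊂ ℂ be a number field of degree d, let R ∈ ℤ[U_0,…,U_t] be a multihomogeneous polynomial of multidegree (N_0,…,N_t) in independent families of indeterminates U_i = (U_{i,1},…,U_{i,n_i}), and for i = 0,…,t let u_i ∈ K^{n_i} be nonzero points such that R(u_0,…,u_t) ≠ 0. Then |N_{K/ℚ}(R(u_0,…,u_t))| ≥ H_fin(u_0)^{−dN_0} ⋯ H_fin(u_t)^{−dN_t}. -/
open scoped BigOperators

open nonZeroDivisors in
theorem aux_prod_mem {A F : Type*} [CommRing A] [Field F] [Algebra A F] [IsFractionRing A F]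
    {ι : Type*} (s : Finset ι) (I : ι → FractionalIdeal A⁰ F) (x : ι → F)
    (h : ∀ i ∈ s, x i ∈ I i) : ∏ i ∈ s, x i ∈ ∏ i ∈ s, I i := by
  classical
  induction s using Finset.induction_on with
  | empty => simpa using FractionalIdeal.one_mem_one (S := A⁰) (P := F)
  | insert a s ha ih =>
    rw [Finset.prod_insert ha, Finset.prod_insert ha]
    exact FractionalIdeal.mul_mem_mul (h a (Finset.mem_insert_self a s))
      (ih fun i hi => h i (Finset.mem_insert_of_mem hi))

open nonZeroDivisors in
theorem aux_pow_mem {A F : Type*} [CommRing A] [Field F] [Algebra A F] [IsFractionRing A F]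
    (I : FractionalIdeal A⁰ F) (x : F) (h : x ∈ I) (k : ℕ) : x ^ k ∈ I ^ k := by
  simpa using aux_prod_mem (Finset.range k) (fun _ => I) (fun _ => x) (fun _ _ => h)

open nonZeroDivisors in
theorem aux_norm_le (K : Type*) [Field K] [NumberField K]
    (J : FractionalIdeal (NumberField.RingOfIntegers K)⁰ K) (x : K) (hx : x ≠ 0) (h : x ∈ J) :
    FractionalIdeal.absNorm J ≤ |Algebra.norm ℚ x| := by
  have hJ : J ≠ 0 := by
    rintro rfl
    exact hx ((FractionalIdeal.mem_zero_iff _).1 h)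
  rw [← FractionalIdeal.absNorm_span_singleton (R := NumberField.RingOfIntegers K)]
  have hle : FractionalIdeal.spanSingleton (NumberField.RingOfIntegers K)⁰ x ≤ J :=
    FractionalIdeal.spanSingleton_le_iff_mem.2 h
  set X := FractionalIdeal.spanSingleton (NumberField.RingOfIntegers K)⁰ x with hX
  have hX0 : X ≠ 0 := FractionalIdeal.spanSingleton_ne_zero_iff.2 hx
  have hC : X * J⁻¹ ≤ 1 := by
    calc X * J⁻¹ ≤ J * J⁻¹ := by gcongr
      _ = 1 := mul_inv_cancel₀ hJ
  obtain ⟨I, hI⟩ := FractionalIdeal.le_one_iff_exists_coeIdeal.1 hC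
  have hXe : X = J * (I : FractionalIdeal (NumberField.RingOfIntegers K)⁰ K) := by
    rw [hI, mul_comm X, mul_inv_cancel_left₀ hJ]
  have hI0 : I ≠ ⊥ := by
    rintro rfl
    apply hX0
    rw [hXe]; simp
  rw [hXe, map_mul, FractionalIdeal.coeIdeal_absNorm]
  have h1 : (1 : ℚ) ≤ (Ideal.absNorm I : ℚ) := by
    have : Ideal.absNorm I ≠ 0 := by rwa [Ne, Ideal.absNorm_eq_zero_iff]
    exact_mod_cast Nat.one_le_iff_ne_zero.2 this
  exact le_mul_of_one_le_right (FractionalIdeal.absNorm_nonneg J) h1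

open nonZeroDivisors in
theorem aux_eval_mem (K : Type*) [Field K] [NumberField K]
    (t : ℕ) (n : Fin (t + 1) → ℕ) (N : Fin (t + 1) → ℕ)
    (R : MvPolynomial (Σ i : Fin (t + 1), Fin (n i)) ℤ)
    (hR : ∀ p ∈ R.support, ∀ i : Fin (t + 1), ∑ j, p ⟨i, j⟩ = N i)
    (u : ∀ i : Fin (t + 1), Fin (n i) → K)
    (I : Fin (t + 1) → FractionalIdeal (NumberField.RingOfIntegers K)⁰ K)
    (hI : ∀ i j, u i j ∈ I i) :
    (MvPolynomial.aeval (fun p => u p.1 p.2) R : K) ∈ ∏ i, I i ^ N i := by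
  rw [MvPolynomial.aeval_def, MvPolynomial.eval₂_eq']
  refine Submodule.sum_mem (FractionalIdeal.coeToSubmodule (∏ i, I i ^ N i)) fun p hp => ?_
  have : (∏ i, u i.1 i.2 ^ p i) ∈ ∏ i, I i ^ N i := by
    rw [Fintype.prod_sigma]
    refine aux_prod_mem _ _ _ fun i _ => ?_
    rw [← hR p hp i, ← Finset.prod_pow_eq_pow_sum]
    exact aux_prod_mem _ _ _ fun j _ => aux_pow_mem _ _ (hI i j) _
  have h2 := Submodule.smul_mem (FractionalIdeal.coeToSubmodule (∏ i, I i ^ N i))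
    ((R.coeff p : ℤ) : NumberField.RingOfIntegers K) this
  simpa [Algebra.smul_def] using h2

/-- Let `K ⊂ ℂ` be a number field of degree `d`, let `R ∈ ℤ[U₀,…,U_t]` be
multihomogeneous of multidegree `(N₀,…,N_t)` in independent families
`U i = (U_{i,1},…,U_{i,n_i})` of indeterminates, and let `u i ∈ K^{n_i}` be
nonzero points with `R(u₀,…,u_t) ≠ 0`.  Then
`|N_{K/ℚ}(R(u₀,…,u_t))| ≥ H_fin(u₀)^{-dN₀} ⋯ H_fin(u_t)^{-dN_t}`. -/
theorem norm_lower_bound_multihomogeneous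
    (K : IntermediateField ℚ ℂ) [NumberField K]
    (d : ℕ) (hd : d = Module.finrank ℚ K)
    (t : ℕ) (n : Fin (t + 1) → ℕ) (hn : ∀ i, 1 ≤ n i)
    (N : Fin (t + 1) → ℕ)
    (R : MvPolynomial (Σ i : Fin (t + 1), Fin (n i)) ℤ)
    (hR : ∀ p ∈ R.support, ∀ i : Fin (t + 1), ∑ j, p ⟨i, j⟩ = N i)
    (u : ∀ i : Fin (t + 1), Fin (n i) → K)
    (hu : ∀ i, u i ≠ 0)
    (hRu : MvPolynomial.aeval (fun p => u p.1 p.2) R ≠ (0 : K)) :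
    ∏ i, HfinV K (u i) ^ (-(d * N i : ℝ))
      ≤ |((Algebra.norm ℚ (MvPolynomial.aeval (fun p => u p.1 p.2) R : K) : ℚ) : ℝ)| := by
  have hd0 : (Module.finrank ℚ K : ℝ) ≠ 0 := by
    exact_mod_cast (Module.finrank_pos (R := ℚ) (M := K)).ne'
  have hmem := aux_eval_mem K t n N R hR u
    (fun i => FractionalIdeal.spanFinset (NumberField.RingOfIntegers K) Finset.univ (u i))
    (fun i j => Submodule.subset_span ⟨j, by simp, rfl⟩)
  have hle := aux_norm_le K _ _ hRu hmem
  rw [map_prod] at hle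
  have hle' := (Rat.cast_le (K := ℝ)).2 hle
  rw [Rat.cast_abs, Rat.cast_prod] at hle'
  refine le_trans (le_of_eq (Finset.prod_congr rfl fun i _ => ?_)) hle'
  rw [map_pow, Rat.cast_pow, HfinV, ← Real.rpow_mul
    (by exact_mod_cast FractionalIdeal.absNorm_nonneg _), hd, ← Real.rpow_natCast]
  congr 1
  field_simp
end

section
/- Let t ≥ 0 and let (D_0,…,D_t) be a sequence of t+1 positive integers. There exists a map Res : ℂ[X_0,…,X_t]_{D_0} × ⋯ × ℂ[X_0,…,X_t]_{D_t} → ℂ, given by a polynomial with integer coefficients in the coefficients of its arguments (with respect to the monomial bases), with the following properties: (1) Res(Q_0,…,Q_t) = 0 if and only if Q_0,…,Q_t have a common zero in ℙ^t(ℂ), i.e., a common nonzero zero in ℂ^{t+1}; (2) for each i, Res is homogeneous of degree D_0⋯D_t/D_i in its i-th argument, i.e., Res(Q_0,…,λQ_i,…,Q_t) = λ^{D_0⋯D_t/D_i} Res(Q_0,…,Q_t) for all λ ∈ ℂ; (3) the underlying integer polynomial is irreducible over ℤ; and (4) the underlying integer polynomial has length at most (t+1)^{3(t+1)D_0⋯D_t}.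 -/
open scoped BigOperators

namespace MRes

/-- exponents of degree `d` -/
@[ext] structure Mon (t d : ℕ) : Type where
  val : Fin (t + 1) →₀ ℕ
  prop : ∑ j, val j = d

noncomputable instance (t d : ℕ) : DecidableEq (Mon t d) := Classical.decEq _

noncomputable instance (t d : ℕ) : Fintype (Mon t d) :=
  @Fintype.ofFinite _ (Finite.of_injective (β := ((Finset.finsuppAntidiag Finset.univ d :
    Finset (Fin (t+1) →₀ ℕ)) : Set (Fin (t+1) →₀ ℕ)).Elem) (fun α => ⟨α.1, by simp [α.2]⟩)
    (fun a b h => Mon.ext (by simpa using h)))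

/-- coefficient variables -/
abbrev Var {t : ℕ} (D : Fin (t + 1) → ℕ) : Type := (i : Fin (t + 1)) × Mon t (D i)

/-- tuple of coefficient vectors -/
abbrev Cf {t : ℕ} (D : Fin (t + 1) → ℕ) (K : Type*) : Type _ := (i : Fin (t + 1)) → Mon t (D i) → K

/-- monomial value -/
def mv {t : ℕ} {K : Type*} [CommRing K] (α : Fin (t+1) →₀ ℕ) (z : Fin (t+1) → K) : K :=
  ∏ j, z j ^ α j

/-- value of a form -/
noncomputable def F {t d : ℕ} {K : Type*} [CommRing K] (c : Mon t d → K) (z : Fin (t+1) → K) : K :=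
  ∑ α, c α * mv α.1 z

/-- value of a polynomial in the coefficients -/
noncomputable def E {t : ℕ} {D : Fin (t+1) → ℕ} {K : Type*} [CommRing K]
    (R : MvPolynomial (Var D) ℤ) (c : Cf D K) : K :=
  MvPolynomial.aeval (fun v : Var D => c v.1 v.2) R

/-- coefficient vector -/
def coef {t : ℕ} (d : ℕ) {K : Type*} [CommRing K] (P : MvPolynomial (Fin (t+1)) K) : Mon t d → K :=
  fun α => P.coeff α.1

/-- pure power -/
noncomputable def pure {t : ℕ} (d : ℕ) (j : Fin (t+1)) : Mon t d :=
  ⟨Finsupp.single j d, by simp [Finsupp.single_apply]⟩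

section
variable {t d : ℕ} {D : Fin (t+1) → ℕ} {K L : Type*} [CommRing K] [CommRing L]

theorem mv_map (φ : K →+* L) (α : Fin (t+1) →₀ ℕ) (z : Fin (t+1) → K) :
    φ (mv α z) = mv α (fun j => φ (z j)) := by simp [mv]

theorem F_map (φ : K →+* L) (c : Mon t d → K) (z : Fin (t+1) → K) :
    φ (F c z) = F (fun α => φ (c α)) (fun j => φ (z j)) := by simp [F, mv_map]

theorem E_map (φ : K →+* L) (R : MvPolynomial (Var D) ℤ) (c : Cf D K) :
    φ (E R c) = E R (fun i α => φ (c i α)) := by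
  unfold E
  have := MvPolynomial.map_aeval (fun v : Var D => c v.1 v.2) φ R
  rw [this, MvPolynomial.aeval_def]
  rw [MvPolynomial.coe_eval₂Hom]
  exact congrArg (fun f => MvPolynomial.eval₂ f (fun v : Var D => φ (c v.1 v.2)) R) (RingHom.ext_int (φ.comp (algebraMap ℤ K)) (algebraMap ℤ L))

theorem mv_add (α β : Fin (t+1) →₀ ℕ) (z : Fin (t+1) → K) : mv (α + β) z = mv α z * mv β z := by
  simp [mv, pow_add, Finset.prod_mul_distrib]

theorem mv_pure (j : Fin (t+1)) (z : Fin (t+1) → K) : mv (pure d j).1 z = z j ^ d := by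
  unfold mv pure
  rw [Finset.prod_eq_single j]
  · simp
  · intro b _ hb; simp [hb.symm]
  · simp

theorem mv_smul (α : Mon t d) (l : K) (z : Fin (t+1) → K) :
    mv α.1 (fun j => l * z j) = l ^ d * mv α.1 z := by
  unfold mv
  simp_rw [mul_pow]
  rw [Finset.prod_mul_distrib, Finset.prod_pow_eq_pow_sum, α.2]

theorem F_smul (c : Mon t d → K) (l : K) (z : Fin (t+1) → K) :
    F c (fun j => l * z j) = l ^ d * F c z := by
  unfold F
  simp_rw [mv_smul, Finset.mul_sum]
  exact Finset.sum_congr rfl fun _ _ => by ring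

theorem F_smul_left (c : Mon t d → K) (l : K) (z : Fin (t+1) → K) :
    F (fun α => l * c α) z = l * F c z := by
  simp [F, Finset.mul_sum, mul_assoc]

theorem F_add (c c' : Mon t d → K) (z : Fin (t+1) → K) :
    F (fun α => c α + c' α) z = F c z + F c' z := by
  simp [F, add_mul, Finset.sum_add_distrib]

theorem F_single (j : Fin (t+1)) (b : K) (z : Fin (t+1) → K) :
    F (d := d) (fun α => if α = pure d j then b else 0) z = b * z j ^ d := by
  simp [F, mv_pure]

theorem F_coef (P : MvPolynomial (Fin (t+1)) K) (hP : P.IsHomogeneous d) (z : Fin (t+1) → K) :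
    F (coef d P) z = MvPolynomial.eval z P := by
  rw [MvPolynomial.eval_eq']
  unfold F coef
  symm
  have : P.support ⊆ Finset.univ.image (fun α : Mon t d => α.1) := by
    intro m hm
    simp only [Finset.mem_image, Finset.mem_univ, true_and]
    refine ⟨⟨m, ?_⟩, rfl⟩
    have := hP (MvPolynomial.mem_support_iff.1 hm)
    rw [← this, Finsupp.weight_apply, Finsupp.sum_fintype] <;> simp
  rw [Finset.sum_subset this, Finset.sum_image]
  · rfl
  · intro a _ b _ h; exact Mon.ext h
  · intro m _ hm
    simp [MvPolynomial.notMem_support_iff.1 hm]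

theorem coef_map (φ : K →+* L) (P : MvPolynomial (Fin (t+1)) K) (α : Mon t d) :
    φ (coef d P α) = coef d (MvPolynomial.map φ P) α := by simp [coef, MvPolynomial.coeff_map]

theorem E_mul (a b : MvPolynomial (Var D) ℤ) (c : Cf D K) : E (a * b) c = E a c * E b c := by simp [E]
theorem E_add (a b : MvPolynomial (Var D) ℤ) (c : Cf D K) : E (a + b) c = E a c + E b c := by simp [E]

theorem E_of_dvd {a b : MvPolynomial (Var D) ℤ} (h : a ∣ b) (c : Cf D K) : E a c ∣ E b c := by
  obtain ⟨x, rfl⟩ := h; rw [E_mul]; exact dvd_mul_right _ _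

end

/-- common nontrivial zero -/
def HasZero {t : ℕ} {D : Fin (t+1) → ℕ} (c : Cf D ℂ) : Prop :=
  ∃ z : Fin (t+1) → ℂ, z ≠ 0 ∧ ∀ i, F (c i) z = 0

/-- vanishing on coefficients with a zero in the main chart -/
def Van {t : ℕ} {D : Fin (t+1) → ℕ} (a : MvPolynomial (Var D) ℤ) : Prop :=
  ∀ c : Cf D ℂ, (∃ z : Fin (t+1) → ℂ, z 0 = 1 ∧ ∀ i, F (c i) z = 0) → E a c = 0

section
variable {t : ℕ} {D : Fin (t+1) → ℕ}

/-- generic parametrization of the incidence variety -/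
noncomputable def par {K : Type*} [CommRing K] (c : Cf D K) (z : Fin (t+1) → K) : Cf D K :=
  fun i α => if α = pure (D i) 0 then - ∑ β ∈ Finset.univ.erase (pure (D i) 0), c i β * mv β.1 z
    else c i α

theorem F_par {K : Type*} [CommRing K] (c : Cf D K) (z : Fin (t+1) → K) (hz : z 0 = 1)
    (i : Fin (t+1)) : F (par c z i) z = 0 := by
  unfold F
  rw [← Finset.add_sum_erase _ _ (Finset.mem_univ (pure (D i) 0)), mv_pure, hz]
  have : ∑ x ∈ Finset.univ.erase (pure (D i) 0), par c z i x * mv x.1 z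
      = ∑ x ∈ Finset.univ.erase (pure (D i) 0), c i x * mv x.1 z := by
    apply Finset.sum_congr rfl
    intro x hx
    simp [par, Finset.ne_of_mem_erase hx]
  rw [this]; simp [par]

theorem par_eq {K : Type*} [CommRing K] (c : Cf D K) (z : Fin (t+1) → K) (hz : z 0 = 1)
    (h : ∀ i, F (c i) z = 0) : par c z = c := by
  funext i α
  unfold par
  split_ifs with hα
  · have := h i
    unfold F at this
    rw [← Finset.add_sum_erase _ _ (Finset.mem_univ (pure (D i) 0)), mv_pure, hz] at this
    subst hα
    linear_combination -this
  · rfl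

theorem par_map {K L : Type*} [CommRing K] [CommRing L] (φ : K →+* L) (c : Cf D K)
    (z : Fin (t+1) → K) (i) (α) :
    φ (par c z i α) = par (fun i α => φ (c i α)) (fun j => φ (z j)) i α := by
  unfold par
  split_ifs <;> simp [mv_map]

theorem Van.mul_or {a b : MvPolynomial (Var D) ℤ} (h : Van (a * b)) : Van a ∨ Van b := by
  let K := MvPolynomial (Var D ⊕ Fin (t+1)) ℂ
  let c0 : Cf D K := fun i α => MvPolynomial.X (Sum.inl ⟨i, α⟩)
  let z0 : Fin (t+1) → K := fun j => if j = 0 then 1 else MvPolynomial.X (Sum.inr j)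
  have key : ∀ a : MvPolynomial (Var D) ℤ, Van a ↔ E a (par c0 z0) = 0 := by
    intro a
    constructor
    · intro ha
      apply MvPolynomial.funext
      intro p
      rw [E_map, map_zero]
      simp_rw [par_map]
      apply ha
      refine ⟨fun j => MvPolynomial.eval p (z0 j), by simp [z0], fun i => F_par _ _ (by simp [z0]) _⟩
    · rintro ha c ⟨z, hz, h⟩
      have := congrArg (MvPolynomial.eval (Sum.elim (fun v : Var D => c v.1 v.2) z)) ha
      rw [E_map, map_zero] at this
      simp_rw [par_map] at this
      rw [← this]
      congr 1
      rw [← par_eq c z hz h]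
      have e1 : (fun j => MvPolynomial.eval (Sum.elim (fun v : Var D => par c z v.1 v.2) z) (z0 j)) = z := by
        funext j
        by_cases hj : j = 0 <;> simp [z0, hj, hz]
      rw [e1]
      have e2 : (fun i α => MvPolynomial.eval (Sum.elim (fun v : Var D => par c z v.1 v.2) z) (c0 i α)) = par c z := by
        funext i α; simp [c0]
      rw [e2, par_eq (par c z) z hz (fun i => F_par c z hz i)]
  rw [key] at h
  rw [key, key]
  rw [E_mul] at h
  exact mul_eq_zero.1 h

theorem Van.add {a b : MvPolynomial (Var D) ℤ} (ha : Van a) (hb : Van b) : Van (a + b) := by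
  intro c h; rw [E_add, ha c h, hb c h, add_zero]

theorem Van.mul_left {a : MvPolynomial (Var D) ℤ} (b) (ha : Van a) : Van (b * a) := by
  intro c h; rw [E_mul, ha c h, mul_zero]

open Polynomial in
theorem Van.zero {a : MvPolynomial (Var D) ℤ} (ha : Van a) (c : Cf D ℂ) (hc : HasZero c) :
    E a c = 0 := by
  have base : ∀ (c : Cf D ℂ) (z : Fin (t+1) → ℂ), z 0 ≠ 0 → (∀ i, F (c i) z = 0) → E a c = 0 := by
    intro c z h0 h
    refine ha c ⟨fun j => (z 0)⁻¹ * z j, by simp [h0], fun i => ?_⟩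
    rw [F_smul, h i, mul_zero]
  obtain ⟨z, hz, h⟩ := hc
  by_cases h0 : z 0 ≠ 0
  · exact base c z h0 h
  push Not at h0
  obtain ⟨j, hj⟩ : ∃ j, z j ≠ 0 := by
    by_contra hcon; push Not at hcon; exact hz (funext hcon)
  have hj0 : j ≠ 0 := by rintro rfl; exact hj h0
  let zε : Fin (t+1) → ℂ[X] := fun k => if k = 0 then X else C (z k)
  let cε : Cf D ℂ[X] := fun i α => C (c i α) +
    (if α = pure (D i) j then - F (fun α => C (c i α)) zε * C ((z j ^ D i)⁻¹) else 0)
  have hF : ∀ i, F (cε i) zε = 0 := by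
    intro i
    simp only [cε]
    rw [F_add, F_single]
    simp only [zε, hj0, if_false]
    rw [← C_pow, mul_assoc, ← C_mul, inv_mul_cancel₀ (pow_ne_zero _ hj)]
    simp
  have hzero : E a cε = 0 := by
    apply Polynomial.eq_zero_of_infinite_isRoot
    apply Set.Infinite.mono (s := {x : ℂ | x ≠ 0})
    · intro x hx
      change Polynomial.eval x _ = 0
      have := E_map (Polynomial.evalRingHom x) a cε
      simp only [coe_evalRingHom] at this
      rw [this]
      apply base _ (fun k => eval x (zε k))
      · simpa [zε] using hx
      · intro i
        have := F_map (Polynomial.evalRingHom x) (cε i) zε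
        simp only [coe_evalRingHom] at this
        rw [← this, hF]; simp
    · exact (Set.finite_singleton (0:ℂ)).infinite_compl
  have := E_map (Polynomial.evalRingHom 0) a cε
  rw [hzero, map_zero] at this
  rw [this]
  congr 1
  funext i α
  simp only [cε, coe_evalRingHom, eval_add, eval_C]
  have h2 := F_map (Polynomial.evalRingHom 0) (fun α => C (c i α)) zε
  simp only [coe_evalRingHom, eval_C] at h2
  have h3 : (fun k => eval 0 (zε k)) = z := by
    funext k; by_cases hk : k = 0 <;> simp [zε, hk, h0]
  rw [h3, h] at h2
  split_ifs <;> simp [h2]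
end

end MRes

namespace MRes
section
variable {t : ℕ} {D : Fin (t+1) → ℕ}

theorem pure_inj {d : ℕ} (hd : 1 ≤ d) {i j : Fin (t+1)} (h : pure d i = pure d j) : i = j := by
  have := congrArg Mon.val h
  simp only [pure] at this
  rcases (Finsupp.single_eq_single_iff _ _ _ _).1 this with h | h
  · exact h.1
  · omega

/-- the eliminated variable -/
noncomputable def v0 (D : Fin (t+1) → ℕ) : Var D := ⟨0, pure (D 0) 0⟩

abbrev TT (D : Fin (t+1) → ℕ) : Type := {v : Var D // v ≠ v0 D}
abbrev AA (D : Fin (t+1) → ℕ) : Type := MvPolynomial (TT D) ℂ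
abbrev SS (D : Fin (t+1) → ℕ) : Type := MvPolynomial (TT D) ℤ

open Polynomial in
theorem dominance (hD : ∀ i, 1 ≤ D i) (s : SS D)
    (hs : Van (MvPolynomial.rename Subtype.val s)) : s = 0 := by
  classical
  by_contra hne
  let e : Var D → ℂ := fun v => if v.2 = pure (D v.1) v.1 then 1 else 0
  let g : (TT D) → (AA D)[X] := fun v => if v.1.2 = pure (D v.1.1) 0 then C (MvPolynomial.X v)
    else C (MvPolynomial.C (e v.1)) + X * C (MvPolynomial.X v)
  let Th : (AA D)[X] := MvPolynomial.aeval g s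
  have hTh : Th ≠ 0 := by
    intro h0
    apply hne
    have inj : Function.Injective (MvPolynomial.map (σ := TT D) (Int.castRingHom ℂ)) :=
      MvPolynomial.map_injective _ Int.cast_injective
    apply inj
    rw [map_zero]
    apply MvPolynomial.funext
    intro p
    let φ : (AA D)[X] →+* ℂ := eval₂RingHom (MvPolynomial.eval (fun v : (TT D) => if v.1.2 = pure (D v.1.1) 0 then p v
      else p v - e v.1)) 1
    have h1 := congrArg φ h0
    rw [map_zero] at h1 ⊢
    rw [← h1, MvPolynomial.eval_map]
    simp only [Th]
    rw [MvPolynomial.map_aeval, MvPolynomial.coe_eval₂Hom]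
    have h2 : φ.comp (algebraMap ℤ (AA D)[X]) = Int.castRingHom ℂ := RingHom.ext_int _ _
    rw [h2]
    congr 1
    funext v
    by_cases hv : v.1.2 = pure (D v.1.1) 0 <;> simp [g, φ, hv]
  obtain ⟨b, hb, hb0⟩ := Polynomial.exists_eq_pow_rootMultiplicity_mul_and_not_dvd Th hTh 0
  rw [C_0, sub_zero] at hb hb0
  rw [X_dvd_iff] at hb0
  obtain ⟨u, hu⟩ : ∃ u : (TT D) → ℂ, MvPolynomial.eval u (b.coeff 0) ≠ 0 := by
    by_contra hcon
    push Not at hcon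
    exact hb0 (MvPolynomial.funext fun p => by rw [hcon p, map_zero])
  let u' : Var D → ℂ := fun v => if h : v ≠ v0 D then u ⟨v, h⟩ else 0
  have hu' : ∀ v : TT D, u' v.1 = u v := fun v => by simp only [u', dif_pos v.2]
  have hx : ∀ i : Fin (t+1), ∃ x : ℂ, (i ≠ 0 → x ^ D i = - u' ⟨i, pure (D i) 0⟩) ∧ (i = 0 → x = 1) := by
    intro i
    obtain ⟨x, hx⟩ := IsAlgClosed.exists_pow_nat_eq (- u' ⟨i, pure (D i) 0⟩) (hD i)
    by_cases hi : i = 0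
    · exact ⟨1, by simp [hi], by simp⟩
    · exact ⟨x, fun _ => hx, fun h => absurd h hi⟩
  choose x hx1 hx0 using hx
  let c' : Cf D ℂ[X] := fun i α => C (e ⟨i, α⟩) + X * C (u' ⟨i, α⟩)
  let z : Fin (t+1) → ℂ[X] := fun j => C (x j)
  have hz : z 0 = 1 := by simp [z, hx0 0 rfl]
  let cε := par c' z
  let w : (TT D) → ℂ[X] := fun v => if v.1.2 = pure (D v.1.1) 0 then cε v.1.1 v.1.2 else C (u v)
  let ev : (AA D)[X] →+* ℂ[X] := eval₂RingHom (MvPolynomial.eval₂Hom C w) X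
  have h1 : E (MvPolynomial.rename Subtype.val s) cε = 0 := by
    apply Polynomial.funext
    intro r
    have := E_map (Polynomial.evalRingHom r) (MvPolynomial.rename Subtype.val s) cε
    rw [coe_evalRingHom] at this
    rw [this, eval_zero]
    apply hs
    refine ⟨fun j => eval r (z j), by simp [hz], fun i => ?_⟩
    have := F_map (Polynomial.evalRingHom r) (cε i) z
    rw [coe_evalRingHom] at this
    rw [← this, F_par _ _ hz]; simp
  have h2 : ev Th = 0 := by
    rw [← h1]
    simp only [Th, E]
    rw [MvPolynomial.map_aeval, MvPolynomial.coe_eval₂Hom, MvPolynomial.aeval_rename,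
      MvPolynomial.aeval_def]
    have h2 : ev.comp (algebraMap ℤ (AA D)[X]) = algebraMap ℤ ℂ[X] := RingHom.ext_int _ _
    rw [h2]
    congr 1
    funext v
    by_cases hv : v.1.2 = pure (D v.1.1) 0
    · simp [g, ev, hv, w]
    · simp [g, ev, hv, w, cε, par, c', hu']
  rw [hb, map_mul, map_pow] at h2
  have h3 : ev b = 0 := by
    rcases mul_eq_zero.1 h2 with h | h
    · exact absurd h (pow_ne_zero _ (by simp [ev, X_ne_zero]))
    · exact h
  have h4 : (evalRingHom (0:ℂ)).comp ev = (MvPolynomial.eval u).comp Polynomial.constantCoeff := by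
    apply Polynomial.ringHom_ext'
    · apply MvPolynomial.ringHom_ext
      · intro r; simp [ev]
      · intro v
        simp only [ev, RingHom.comp_apply, coe_eval₂RingHom, eval₂_C, MvPolynomial.coe_eval₂Hom,
          MvPolynomial.eval₂_X, constantCoeff_apply, coeff_C_zero, MvPolynomial.eval_X,
          coe_evalRingHom]
        by_cases hv : v.1.2 = pure (D v.1.1) 0
        · have hi : v.1.1 ≠ 0 := by
            intro hi
            apply v.2
            obtain ⟨⟨i, α⟩, h⟩ := v
            simp only at hi hv
            subst hi; subst hv; rfl
          simp only [w, hv, if_true, cε, par]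
          rw [eval_neg, eval_finset_sum, Finset.sum_eq_single (pure (D v.1.1) v.1.1)]
          · rw [mv_pure]
            simp only [c', z, e, if_true]
            simp only [eval_mul, eval_add, eval_C, eval_X, eval_pow, zero_mul, add_zero, one_mul]
            rw [hx1 _ hi, neg_neg, ← hv, ← hu' v]
          · intro β _ hβ
            simp [c', e, hβ]
          · intro h
            exfalso; apply h
            rw [Finset.mem_erase]
            exact ⟨fun h => hi (pure_inj (hD _) h), Finset.mem_univ _⟩
        · simp [w, hv]
    · simp [ev]
  have h5 := RingHom.congr_fun h4 b
  rw [RingHom.comp_apply, h3, map_zero, RingHom.comp_apply, constantCoeff_apply] at h5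
  exact hu h5.symm

open Polynomial in
theorem principal (hD : ∀ i, 1 ≤ D i) {R a : MvPolynomial (Var D) ℤ} (hR : Irreducible R)
    (hRv : Van R) (ha : Van a) : R ∣ a := by
  classical
  let e : MvPolynomial (Var D) ℤ ≃ₐ[ℤ] ((SS D))[X] :=
    (MvPolynomial.renameEquiv ℤ (Equiv.optionSubtypeNe (v0 D)).symm).trans
      (MvPolynomial.optionEquivLeft ℤ (TT D))
  have heC : ∀ s : SS D, e.symm (C s) = MvPolynomial.rename Subtype.val s := by
    intro s
    rw [AlgEquiv.symm_apply_eq]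
    have : (e.toAlgHom.comp (MvPolynomial.rename (R := ℤ) (Subtype.val : TT D → Var D))) = 
        (Polynomial.CAlgHom (R := ℤ) (A := SS D)) := by
      apply MvPolynomial.algHom_ext
      intro v
      have : (Equiv.optionSubtypeNe (v0 D)).symm v.1 = some v := by
        simp [Equiv.optionSubtypeNe_symm_apply, v.2]
      simp [e, this, MvPolynomial.optionEquivLeft_X_some]
    exact (DFunLike.congr_fun this s).symm
  have key : ∀ s : SS D, Van (e.symm (C s)) → s = 0 := by
    intro s hs; rw [heC] at hs; exact dominance hD s hs
  let K := FractionRing (SS D)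
  let _ : NormalizedGCDMonoid ((SS D)) := Classical.choice inferInstance
  have hR' : Irreducible (e R) := (MulEquiv.irreducible_iff e).2 hR
  have hdeg : (e R).natDegree ≠ 0 := by
    intro h
    rw [natDegree_eq_zero] at h
    obtain ⟨s, hs⟩ := h
    have : s = 0 := key s (by rw [hs, e.symm_apply_apply]; exact hRv)
    rw [this, C_0] at hs
    exact hR'.ne_zero hs.symm
  have hprim : (e R).IsPrimitive := hR'.isPrimitive hdeg
  have hirrK : Irreducible ((e R).map (algebraMap ((SS D)) K)) :=
    (hprim.irreducible_iff_irreducible_map_fraction_map (K := K)).1 hR'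
  have hdvd : (e R).map (algebraMap ((SS D)) K) ∣ (e a).map (algebraMap ((SS D)) K) := by
    by_contra hnd
    obtain ⟨U, V, hUV⟩ := (hirrK.coprime_iff_not_dvd).2 hnd
    obtain ⟨bU, hbU, hU⟩ := IsLocalization.integerNormalization_spec (nonZeroDivisors (SS D)) U
    obtain ⟨bV, hbV, hV⟩ := IsLocalization.integerNormalization_spec (nonZeroDivisors (SS D)) V
    set U' := IsLocalization.integerNormalization (nonZeroDivisors (SS D)) U
    set V' := IsLocalization.integerNormalization (nonZeroDivisors (SS D)) V
    have inj : Function.Injective (Polynomial.map (algebraMap ((SS D)) K)) :=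
      Polynomial.map_injective _ (IsFractionRing.injective ((SS D)) K)
    have hcomb : C bV * U' * e R + C bU * V' * e a = C (bU * bV) := by
      apply inj
      simp only [Polynomial.map_add, Polynomial.map_mul, map_C, hU, hV]
      simp only [Submonoid.smul_def, Algebra.smul_def, Polynomial.algebraMap_apply, map_mul]
      linear_combination (C ((algebraMap ((SS D)) K) bU) * C ((algebraMap ((SS D)) K) bV)) * hUV
    have hv : Van (e.symm (C (bU * bV))) := by
      rw [← hcomb]
      simp only [map_add, map_mul e.symm, AlgEquiv.symm_apply_apply]
      exact (hRv.mul_left _).add (ha.mul_left _)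
    have := key _ hv
    exact (mem_nonZeroDivisors_iff_ne_zero.1 (mul_mem hbU hbV)) this
  have hd : e R ∣ e a := by
    exact hprim.dvd_of_fraction_map_dvd_fraction_map (K := K) hdvd
  exact (map_dvd_iff e).1 hd

end
end MRes

namespace MRes
section
variable {t d : ℕ} {D : Fin (t+1) → ℕ} {K L : Type*} [CommRing K] [CommRing L]

/-- coefficient row of a monomial multiple of a form -/
noncomputable def row (d : ℕ) (c : Cf D K) (r : Fin (t+1) × (Fin (t+1) →₀ ℕ)) : Mon t d → K :=
  fun β => ∑ α : Mon t (D r.1), if r.2 + α.1 = β.1 then c r.1 α else 0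

/-- Macaulay minors -/
noncomputable def mac (D : Fin (t+1) → ℕ) (d : ℕ) (f : Mon t d → Fin (t+1) × (Fin (t+1) →₀ ℕ)) :
    MvPolynomial (Var D) ℤ :=
  Matrix.det (Matrix.of fun b => row (D := D) d (fun i α => MvPolynomial.X ⟨i, α⟩) (f b))

/-- row degrees are right -/
def Valid (D : Fin (t+1) → ℕ) (d : ℕ) (r : Fin (t+1) × (Fin (t+1) →₀ ℕ)) : Prop :=
  ∑ j, r.2 j + D r.1 = d

theorem row_map (φ : K →+* L) (c : Cf D K) (r) (β : Mon t d) :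
    φ (row d c r β) = row d (fun i α => φ (c i α)) r β := by
  unfold row
  rw [map_sum]
  refine Finset.sum_congr rfl fun α _ => ?_
  split_ifs <;> simp

theorem E_X (v : Var D) (c : Cf D K) : E (MvPolynomial.X v) c = c v.1 v.2 := by simp [E]

theorem E_mac (f : Mon t d → Fin (t+1) × (Fin (t+1) →₀ ℕ)) (c : Cf D K) :
    E (mac D d f) c = Matrix.det (Matrix.of fun b => row d c (f b)) := by
  have := RingHom.map_det (MvPolynomial.aeval (R := ℤ) (fun v : Var D => c v.1 v.2)).toRingHom
    (Matrix.of fun b => row (D := D) d (fun i α => MvPolynomial.X ⟨i, α⟩) (f b))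
  unfold E mac
  refine this.trans ?_
  congr 1
  ext b β
  simp only [RingHom.mapMatrix_apply, Matrix.map_apply, Matrix.of_apply]
  rw [row_map]
  simp

theorem sum_row (c : Cf D K) (r) (hr : Valid D d r) (z : Fin (t+1) → K) :
    ∑ β, row d c r β * mv β.1 z = mv r.2 z * F (c r.1) z := by
  unfold row F
  simp_rw [Finset.sum_mul]
  rw [Finset.sum_comm, Finset.mul_sum]
  refine Finset.sum_congr rfl fun α _ => ?_
  have hs : ∑ j, (r.2 + α.1) j = d := by
    have h1 := α.2
    have h2 : _ = d := hr
    simp only [Finsupp.add_apply, Finset.sum_add_distrib]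
    omega
  rw [Finset.sum_eq_single ⟨r.2 + α.1, hs⟩]
  · simp only [if_true, mv_add]; ring
  · intro β _ hβ
    rw [if_neg, zero_mul]
    intro h; apply hβ; exact Mon.ext h.symm
  · simp

theorem Van_mac (f : Mon t d → Fin (t+1) × (Fin (t+1) →₀ ℕ)) (hf : ∀ b, Valid D d (f b)) :
    Van (mac D d f) := by
  rintro c ⟨z, hz, h⟩
  rw [E_mac, ← Matrix.exists_mulVec_eq_zero_iff]
  refine ⟨fun β => mv β.1 z, ?_, ?_⟩
  · intro h0
    have := congrFun h0 (pure d 0)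
    rw [mv_pure, hz] at this
    simp at this
  · funext b
    have := sum_row c (f b) (hf b) z
    rw [h, mul_zero] at this
    exact this

theorem exists_mac (c : Cf D ℂ) (hc : ¬ HasZero c) :
    ∃ (d : ℕ) (f : Mon t d → Fin (t+1) × (Fin (t+1) →₀ ℕ)), (∀ b, Valid D d (f b)) ∧
      E (mac D d f) c ≠ 0 := by
  classical
  let Q : Fin (t+1) → MvPolynomial (Fin (t+1)) ℂ := fun i => ∑ α, MvPolynomial.monomial α.1 (c i α)
  let I := Ideal.span (Set.range Q)
  have hrad : ∀ j, ∃ N, (MvPolynomial.X j : MvPolynomial (Fin (t+1)) ℂ) ^ N ∈ I := by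
    intro j
    have : (MvPolynomial.X j : MvPolynomial (Fin (t+1)) ℂ) ∈ I.radical := by
      rw [← MvPolynomial.vanishingIdeal_zeroLocus_eq_radical (K := ℂ) I]
      rw [MvPolynomial.mem_vanishingIdeal_iff]
      intro z hz
      rw [MvPolynomial.zeroLocus_span] at hz
      have h0 : z = 0 := by
        by_contra hne
        apply hc
        refine ⟨z, hne, fun i => ?_⟩
        have := hz (Q i) ⟨i, rfl⟩
        rw [← this]
        simp [Q, F, MvPolynomial.aeval_monomial, mv, Finsupp.prod_fintype]
      simp [h0]
    exact this
  choose N hN using hrad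
  let M := ∑ j, N j
  have hM : ∀ j, (MvPolynomial.X j : MvPolynomial (Fin (t+1)) ℂ) ^ M ∈ I := fun j =>
    I.pow_mem_of_pow_mem (hN j) (Finset.single_le_sum (fun _ _ => Nat.zero_le _) (Finset.mem_univ j))
  let d := (t+1) * M
  have hmon : ∀ β : Mon t d, MvPolynomial.monomial β.1 (1:ℂ) ∈ I := by
    intro β
    obtain ⟨j, hj⟩ : ∃ j, M ≤ β.1 j := by
      by_contra hcon
      push Not at hcon
      have h1 := Finset.sum_lt_sum_of_nonempty (s := Finset.univ) Finset.univ_nonempty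
        (fun j _ => hcon j)
      rw [β.2] at h1
      simp [d] at h1
    have : MvPolynomial.monomial β.1 (1:ℂ) = MvPolynomial.monomial (β.1 - Finsupp.single j M) 1 *
        MvPolynomial.X j ^ M := by
      rw [MvPolynomial.X_pow_eq_monomial, MvPolynomial.monomial_mul, one_mul, tsub_add_cancel_of_le]
      rwa [Finsupp.single_le_iff]
    rw [this]
    exact I.mul_mem_left _ (hM j)
  let rows : Set (Mon t d → ℂ) := (fun r => row d c r) '' {r | Valid D d r}
  have hspan : Submodule.span ℂ rows = ⊤ := by
    by_contra hlt
    obtain ⟨φ, hφ, hle⟩ := Submodule.exists_le_ker_of_lt_top _ (lt_top_iff_ne_top.2 hlt)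
    let Λ : MvPolynomial (Fin (t+1)) ℂ →ₗ[ℂ] ℂ := φ ∘ₗ
      { toFun := fun p => coef d p, map_add' := fun p q => by funext; simp [coef],
        map_smul' := fun a q => by funext; simp [coef] }
    have hΛ : ∀ p ∈ I, ∀ h, Λ (h * p) = 0 := by
      intro p hp
      refine Submodule.span_induction ?_ ?_ ?_ ?_ hp
      · rintro _ ⟨i, rfl⟩ h
        induction h using MvPolynomial.induction_on' with
        | monomial γ a =>
          have h1 : (coef d (MvPolynomial.monomial γ a * Q i) : Mon t d → ℂ) = a • row d c (i, γ) := by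
            funext β
            simp only [coef, Q, row, Finset.mul_sum, MvPolynomial.monomial_mul,
              MvPolynomial.coeff_sum, MvPolynomial.coeff_monomial, Pi.smul_apply, smul_eq_mul]
            simp
          change φ (coef d (MvPolynomial.monomial γ a * Q i)) = 0
          rw [h1, map_smul]
          by_cases hv : Valid D d (i, γ)
          · have : φ (row d c (i, γ)) = 0 := hle (Submodule.subset_span ⟨_, hv, rfl⟩)
            rw [this, smul_zero]
          · have : row d c (i, γ) = 0 := by
              funext β
              refine Finset.sum_eq_zero fun α _ => ?_
              rw [if_neg]
              intro h
              apply hv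
              unfold Valid
              rw [← β.2, ← h]
              simp [Finset.sum_add_distrib, α.2]
            rw [this, map_zero, smul_zero]
        | add p q hp hq => rw [add_mul, map_add, hp, hq, add_zero]
      · intro h; simp
      · intro x y _ _ hx hy h; rw [mul_add, map_add, hx, hy, add_zero]
      · intro a x _ hx h; rw [smul_eq_mul, ← mul_assoc]; exact hx _
    apply hφ
    apply LinearMap.pi_ext'
    intro β
    apply LinearMap.ext_ring
    have := hΛ _ (hmon β) 1
    rw [one_mul] at this
    change φ (coef d (MvPolynomial.monomial β.1 (1:ℂ))) = 0 at this
    have h2 : (coef d (MvPolynomial.monomial β.1 (1:ℂ)) : Mon t d → ℂ) = Pi.single β 1 := by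
      funext β'
      simp only [coef, MvPolynomial.coeff_monomial, Pi.single_apply]
      by_cases h : β' = β
      · simp [h]
      · rw [if_neg (fun h' => h (Mon.ext h'.symm)), if_neg h]
    rw [h2] at this
    simpa using this
  obtain ⟨B, hB, hBs, hBl⟩ := exists_linearIndependent ℂ rows
  rw [hspan] at hBs
  let bas := Module.Basis.mk (v := fun x : B => x.1) hBl (by rw [Subtype.range_coe, hBs])
  let e : Mon t d ≃ B := (Pi.basisFun ℂ (Mon t d)).indexEquiv bas
  have hsel : ∀ b : Mon t d, ∃ r, Valid D d r ∧ row d c r = (e b).1 := fun b => hB (e b).2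
  choose f hf1 hf2 using hsel
  refine ⟨d, f, hf1, ?_⟩
  rw [E_mac]
  have hli : LinearIndependent ℂ (fun b => row d c (f b)) := by
    simp_rw [hf2]
    exact hBl.comp e e.injective
  have := (Matrix.linearIndependent_rows_iff_isUnit (A := Matrix.of fun b => row d c (f b))).1 hli
  exact ((Matrix.isUnit_iff_isUnit_det _).1 this).ne_zero

/-- pure powers -/
noncomputable def cE (D : Fin (t+1) → ℕ) (K : Type*) [CommRing K] : Cf D K :=
  fun i α => if α = pure (D i) i then 1 else 0

theorem exists_macaulay (hD : ∀ i, 1 ≤ D i) (i : Fin (t+1)) :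
    ∃ (d : ℕ) (f : Mon t d → Fin (t+1) × (Fin (t+1) →₀ ℕ)), (∀ b, Valid D d (f b)) ∧
      E (mac D d f) (cE D ℤ) = 1 ∧
      (Finset.univ.filter (fun b => (f b).1 = i)).card ≤ ∏ j ∈ Finset.univ.erase i, D j := by
  classical
  let d := ∑ j, (D j - 1) + 1
  have hex : ∀ b : Mon t d, ∃ j, D j ≤ b.1 j ∧ (j = i → ∀ k, k ≠ i → b.1 k < D k) := by
    intro b
    by_cases h : ∃ j, j ≠ i ∧ D j ≤ b.1 j
    · obtain ⟨j, hj, h⟩ := h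
      exact ⟨j, h, fun h => absurd h hj⟩
    · push Not at h
      refine ⟨i, ?_, fun _ => h⟩
      by_contra hi
      push Not at hi
      have : ∑ j, b.1 j ≤ ∑ j, (D j - 1) := by
        apply Finset.sum_le_sum
        intro j _
        by_cases hj : j = i
        · subst hj; omega
        · have := h j hj; omega
      rw [b.2] at this
      simp [d] at this
  choose g hg1 hg2 using hex
  let f : Mon t d → Fin (t+1) × (Fin (t+1) →₀ ℕ) := fun b => (g b, b.1 - Finsupp.single (g b) (D (g b)))
  have hf : ∀ b, (f b).2 + Finsupp.single (g b) (D (g b)) = b.1 := fun b => by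
    apply tsub_add_cancel_of_le
    rw [Finsupp.single_le_iff]; exact hg1 b
  refine ⟨d, f, ?_, ?_, ?_⟩
  · intro b
    unfold Valid
    rw [← b.2, ← hf b]
    simp only [Finsupp.add_apply, Finset.sum_add_distrib]
    congr 1
    simp [f, Finsupp.single_apply]
  · rw [E_mac]
    have : (Matrix.of fun b => row d (cE D ℤ) (f b)) = (1 : Matrix (Mon t d) (Mon t d) ℤ) := by
      ext b β
      simp only [Matrix.of_apply, row, Matrix.one_apply, cE]
      rw [Finset.sum_eq_single (pure (D (g b)) (g b))]
      · have : (f b).2 + (pure (D (g b)) (g b)).1 = b.1 := hf b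
        rw [this]
        simp only [f, if_true]
        congr 1
        exact propext ⟨fun h => Mon.ext h, fun h => by rw [h]⟩
      · intro α _ hα
        simp [f, hα]
      · simp
    rw [this, Matrix.det_one]
  · have : ∏ j ∈ Finset.univ.erase i, D j = ((Finset.univ.erase i).pi (fun j => Finset.range (D j))).card := by
      rw [Finset.card_pi]; simp
    rw [this]
    apply Finset.card_le_card_of_injOn (fun b j _ => b.1 j)
    · intro b hb
      simp only [Finset.coe_filter, Finset.mem_univ, true_and, Set.mem_ofPred_eq] at hb
      simp only [Finset.mem_coe, Finset.mem_pi, Finset.mem_range]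
      intro j hj
      exact hg2 b hb j (Finset.ne_of_mem_erase hj)
    · intro a _ b _ h
      have hne : ∀ j, j ≠ i → a.1 j = b.1 j := fun j hj =>
        congrFun (congrFun h j) (Finset.mem_erase.2 ⟨hj, Finset.mem_univ _⟩)
      apply Mon.ext
      ext j
      by_cases hj : j = i
      · subst hj
        have h1 := a.2
        have h2 := b.2
        rw [← Finset.add_sum_erase _ _ (Finset.mem_univ j)] at h1 h2
        have : ∑ x ∈ Finset.univ.erase j, a.1 x = ∑ x ∈ Finset.univ.erase j, b.1 x :=
          Finset.sum_congr rfl fun x hx => hne x (Finset.ne_of_mem_erase hx)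
        omega
      · exact hne j hj

/-- group degree of a monomial -/
noncomputable def wt (i : Fin (t+1)) (m : Var D →₀ ℕ) : ℕ := ∑ v, if v.1 = i then m v else 0

theorem E_eq (R : MvPolynomial (Var D) ℤ) (c : Cf D K) :
    E R c = ∑ m ∈ R.support, ((MvPolynomial.coeff m R : ℤ) : K) * ∏ v, c v.1 v.2 ^ m v := by
  unfold E
  rw [MvPolynomial.aeval_def, MvPolynomial.eval₂_eq']
  simp

open Polynomial in
theorem hom_of_dvd (i : Fin (t+1)) (f : Mon t d → Fin (t+1) × (Fin (t+1) →₀ ℕ))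
    (R : MvPolynomial (Var D) ℤ) (hR : R ∣ mac D d f) (h0 : mac D d f ≠ 0) :
    ∃ k ≤ (Finset.univ.filter (fun b => (f b).1 = i)).card, ∀ m ∈ R.support, wt i m = k := by
  classical
  let cθ : Cf D (MvPolynomial (Var D) ℤ)[X] := fun j α =>
    (if j = i then X else 1) * C (MvPolynomial.X ⟨j, α⟩)
  have hθ : ∀ P : MvPolynomial (Var D) ℤ, E P cθ =
      ∑ m ∈ P.support, C (MvPolynomial.monomial m (P.coeff m)) * X ^ wt i m := by
    intro P
    rw [E_eq]
    refine Finset.sum_congr rfl fun m _ => ?_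
    simp only [cθ, mul_pow, Finset.prod_mul_distrib]
    have h1 : ∏ v : Var D, (if v.1 = i then (X : (MvPolynomial (Var D) ℤ)[X]) else 1) ^ m v = X ^ wt i m := by
      unfold wt
      rw [← Finset.prod_pow_eq_pow_sum]
      refine Finset.prod_congr rfl fun v _ => ?_
      split_ifs <;> simp
    rw [h1, MvPolynomial.monomial_eq, Finsupp.prod_fintype _ _ (by simp)]
    simp only [map_mul, map_prod, map_pow]
    have : (C (MvPolynomial.C (P.coeff m)) : (MvPolynomial (Var D) ℤ)[X]) = ((MvPolynomial.coeff m P : ℤ) : (MvPolynomial (Var D) ℤ)[X]) := by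
      simp
    rw [this]; ring
  have hne : ∀ P : MvPolynomial (Var D) ℤ, ∀ m ∈ P.support, (E P cθ).coeff (wt i m) ≠ 0 := by
    intro P m hm h
    have := congrArg (MvPolynomial.coeff m) h
    rw [hθ] at this
    simp only [Polynomial.finsetSum_coeff, Polynomial.coeff_C_mul, Polynomial.coeff_X_pow,
      MvPolynomial.coeff_sum, MvPolynomial.coeff_zero] at this
    rw [Finset.sum_eq_single m] at this
    · simp at this
      exact (MvPolynomial.mem_support_iff.1 hm) this
    · intro m' _ hm'
      split_ifs <;> simp [MvPolynomial.coeff_monomial, hm']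
    · intro h; exact absurd hm h
  set N := (Finset.univ.filter (fun b => (f b).1 = i)).card
  have hmac : E (mac D d f) cθ = X ^ N * C (mac D d f) := by
    rw [E_mac]
    have h1 : (Matrix.of fun b => row d cθ (f b)) = Matrix.of fun b β =>
        (if (f b).1 = i then (X : (MvPolynomial (Var D) ℤ)[X]) else 1) *
          (Matrix.of fun b => row d (fun j α => C (MvPolynomial.X (⟨j, α⟩ : Var D) : MvPolynomial (Var D) ℤ)) (f b)) b β := by
      ext1 b β
      simp only [Matrix.of_apply, row, Finset.mul_sum, cθ]
      refine Finset.sum_congr rfl fun α _ => ?_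
      split_ifs <;> simp
    rw [h1, Matrix.det_mul_column]
    congr 1
    · rw [Finset.prod_ite]; simp [N]
    · rw [← E_mac]
      have := E_map (C : MvPolynomial (Var D) ℤ →+* _) (mac D d f) (fun j α => MvPolynomial.X ⟨j, α⟩)
      rw [← this]
      congr 1
      exact MvPolynomial.aeval_X_left_apply _
  obtain ⟨b, hb⟩ := hR
  have hprod : E R cθ * E b cθ = X ^ N * C (mac D d f) := by rw [← E_mul, ← hb, hmac]
  have hnz : E R cθ * E b cθ ≠ 0 := by
    rw [hprod]; exact mul_ne_zero (pow_ne_zero _ X_ne_zero) (by simpa using h0)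
  have hR0 := left_ne_zero_of_mul hnz
  have hb0 := right_ne_zero_of_mul hnz
  have e1 := natDegree_mul hR0 hb0
  have e2 := natTrailingDegree_mul hR0 hb0
  have hX : (X ^ N * C (mac D d f) : (MvPolynomial (Var D) ℤ)[X]) = monomial N (mac D d f) := by
    rw [mul_comm, C_mul_X_pow_eq_monomial]
  rw [hprod, hX, natDegree_monomial_eq _ h0] at e1
  rw [hprod, hX, natTrailingDegree_monomial h0] at e2
  have e3 := natTrailingDegree_le_natDegree (E R cθ)
  have e4 := natTrailingDegree_le_natDegree (E b cθ)
  refine ⟨(E R cθ).natDegree, by omega, fun m hm => ?_⟩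
  have h1 := le_natDegree_of_ne_zero (hne R m hm)
  have h2 := natTrailingDegree_le_of_ne_zero (hne R m hm)
  omega
end
end MRes

namespace MRes
section
variable {t d : ℕ} {D : Fin (t+1) → ℕ} {K L : Type*} [CommRing K] [CommRing L]

theorem not_Van_unit {u : MvPolynomial (Var D) ℤ} (hu : IsUnit u) : ¬ Van u := by
  intro h
  have h0 := h (fun _ _ => 0) ⟨fun _ => 1, rfl, fun i => by simp [F]⟩
  obtain ⟨v, hv⟩ := hu.dvd (a := 1)
  have := congrArg (fun p => E p (fun _ _ => (0:ℂ))) hv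
  simp only [E_mul, h0, zero_mul] at this
  simp [E] at this

theorem exists_irr (a : MvPolynomial (Var D) ℤ) (h0 : a ≠ 0) (ha : Van a) :
    ∃ R : MvPolynomial (Var D) ℤ, Irreducible R ∧ Van R := by
  induction a using WfDvdMonoid.induction_on_irreducible with
  | zero => exact absurd rfl h0
  | unit u hu => exact absurd ha (not_Van_unit hu)
  | mul a p ha0 hp ih =>
    rcases Van.mul_or ha with h | h
    · exact ⟨p, hp, h⟩
    · exact ih ha0 h

/-- The data of a resultant up to degrees -/
structure IsRes (D : Fin (t+1) → ℕ) (k : Fin (t+1) → ℕ) (R : MvPolynomial (Var D) ℤ) : Prop where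
  irr : Irreducible R
  van : ∀ c : Cf D ℂ, E R c = 0 ↔ HasZero c
  pur : IsUnit (E R (cE D ℤ))
  hom : ∀ i, ∀ m ∈ R.support, wt i m = k i

theorem exists_R (hD : ∀ i, 1 ≤ D i) : ∃ (k : Fin (t+1) → ℕ) (R : MvPolynomial (Var D) ℤ),
    IsRes D k R ∧ ∀ i, k i ≤ ∏ j ∈ Finset.univ.erase i, D j := by
  have hne : ∀ (d : ℕ) (f : Mon t d → Fin (t+1) × (Fin (t+1) →₀ ℕ)),
    E (mac D d f) (cE D ℤ) = 1 → mac D d f ≠ 0 := by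
    intro d f h h0
    rw [h0] at h
    simp [E] at h
  obtain ⟨R, hR, hRv⟩ : ∃ R : MvPolynomial (Var D) ℤ, Irreducible R ∧ Van R := by
    obtain ⟨d, f, h1, h2, _⟩ := exists_macaulay hD 0
    exact exists_irr _ (hne d f h2) (Van_mac f h1)
  have hk : ∀ i, ∃ k ≤ ∏ j ∈ Finset.univ.erase i, D j, ∀ m ∈ R.support, wt i m = k := by
    intro i
    obtain ⟨d, f, h1, h2, h3⟩ := exists_macaulay hD i
    obtain ⟨k, hk, h⟩ := hom_of_dvd i f R (principal hD hR hRv (Van_mac f h1)) (hne d f h2)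
    exact ⟨k, hk.trans h3, h⟩
  choose k hk1 hk2 using hk
  refine ⟨k, R, ⟨hR, fun c => ⟨fun h => ?_, hRv.zero c⟩, ?_, hk2⟩, hk1⟩
  · by_contra hc
    obtain ⟨d, f, h1, h2⟩ := exists_mac c hc
    have := E_of_dvd (principal hD hR hRv (Van_mac f h1)) c
    rw [h, zero_dvd_iff] at this
    exact h2 this
  · obtain ⟨d, f, h1, h2, _⟩ := exists_macaulay hD 0
    have := E_of_dvd (principal hD hR hRv (Van_mac f h1)) (cE D ℤ)
    rw [h2] at this
    exact isUnit_of_dvd_one this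

variable {k : Fin (t+1) → ℕ} {R : MvPolynomial (Var D) ℤ}

theorem IsRes.scale (hR : IsRes D k R) (c : Cf D K) (i : Fin (t+1)) (l : K) :
    E R (Function.update c i (fun α => l * c i α)) = l ^ k i * E R c := by
  classical
  rw [E_eq, E_eq, Finset.mul_sum]
  refine Finset.sum_congr rfl fun m hm => ?_
  rw [← hR.hom i m hm]
  have : ∏ v : Var D, (Function.update c i (fun α => l * c i α)) v.1 v.2 ^ m v =
      l ^ wt i m * ∏ v : Var D, c v.1 v.2 ^ m v := by
    unfold wt
    rw [← Finset.prod_pow_eq_pow_sum, ← Finset.prod_mul_distrib]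
    refine Finset.prod_congr rfl fun v _ => ?_
    obtain ⟨j, α⟩ := v
    by_cases h : j = i
    · subst h; simp [mul_pow]
    · simp [h]
  rw [this]; ring

open Polynomial in
theorem IsRes.natDegree (hR : IsRes D k R) (c : Cf D ℂ[X]) (i : Fin (t+1))
    (h1 : ∀ α, (c i α).natDegree ≤ 1) (h2 : ∀ j, j ≠ i → ∀ α, (c j α).natDegree = 0) :
    (E R c).natDegree ≤ k i := by
  rw [E_eq]
  refine Polynomial.natDegree_sum_le_of_forall_le _ _ fun m hm => ?_
  rw [← hR.hom i m hm]
  refine natDegree_mul_le.trans ?_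
  rw [natDegree_intCast, zero_add]
  refine (natDegree_prod_le _ _).trans ?_
  unfold wt
  refine Finset.sum_le_sum fun v _ => ?_
  refine natDegree_pow_le.trans ?_
  obtain ⟨j, α⟩ := v
  split_ifs with h
  · dsimp only at h; subst h
    simpa using Nat.mul_le_mul_left (m ⟨j, α⟩) (h1 α)
  · simp [h2 j h α]

open Polynomial in
theorem IsRes.lower (hR : IsRes D k R) (hD : ∀ i, 1 ≤ D i) (i : Fin (t+1)) :
    ∏ j ∈ Finset.univ.erase i, D j ≤ k i := by
  classical
  let B := ∑ j, D j + 1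
  have hB : ∀ j, D j ≤ B := fun j =>
    (Finset.single_le_sum (fun _ _ => Nat.zero_le _) (Finset.mem_univ j)).trans (Nat.le_succ _)
  let D' := Function.update D i 1
  have hB' : ∀ j, D' j ≤ B := by
    intro j
    by_cases h : j = i
    · subst h; simp [D', B]
    · simpa [D', h] using hB j
  let val : ((j : Fin (t+1)) → Fin (D' j)) → ℕ := fun h => ∑ j, (h j : ℕ) * B ^ (j : ℕ)
  have hval : Function.Injective val := by
    intro h h' hh
    have e : ∀ h, val h = (finFunctionFinEquiv (fun j => Fin.castLE (hB' j) (h j)) : ℕ) := by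
      intro h; rw [finFunctionFinEquiv_apply]; rfl
    rw [e, e] at hh
    have := finFunctionFinEquiv.injective (Fin.ext hh)
    funext j
    have := congrFun this j
    exact Fin.castLE_injective _ this
  let a : Fin (t+1) → ℕ → ℂ := fun j m => ((m * B ^ (j:ℕ) : ℕ) : ℂ)
  let P : Fin (t+1) → MvPolynomial (Fin (t+1)) ℂ := fun j =>
    if j = i then (∑ l ∈ Finset.univ.erase i, MvPolynomial.X l) * MvPolynomial.X i ^ (D i - 1)
    else ∏ m ∈ Finset.range (D j), (MvPolynomial.X j - MvPolynomial.C (a j m) * MvPolynomial.X i)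
  have hP : ∀ j, (P j).IsHomogeneous (D j) := by
    intro j
    by_cases h : j = i
    · subst h
      simp only [P, if_true]
      have := (MvPolynomial.IsHomogeneous.sum (Finset.univ.erase j) (fun l => (MvPolynomial.X l : MvPolynomial (Fin (t+1)) ℂ)) 1
        (fun l _ => MvPolynomial.isHomogeneous_X ℂ l)).mul ((MvPolynomial.isHomogeneous_X ℂ j).pow (D j - 1))
      convert this using 1
      have := hD j
      omega
    · simp only [P, h, if_false]
      have := MvPolynomial.IsHomogeneous.prod (Finset.range (D j))
        (fun m => (MvPolynomial.X j - MvPolynomial.C (a j m) * MvPolynomial.X i : MvPolynomial (Fin (t+1)) ℂ))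
        (fun _ => 1) (fun m _ => (MvPolynomial.isHomogeneous_X ℂ j).sub (by
          simpa using (MvPolynomial.isHomogeneous_C _ (a j m)).mul (MvPolynomial.isHomogeneous_X ℂ i)))
      simpa using this
  let c : Cf D ℂ[X] := fun j α => C (coef (D j) (P j) α) -
    (if j = i then (if α = pure (D j) i then X else 0) else 0)
  have hdeg : (E R c).natDegree ≤ k i := by
    apply hR.natDegree
    · intro α
      simp only [c, if_true]
      refine (natDegree_sub_le _ _).trans ?_
      split_ifs <;> simp
    · intro j hj α
      simp [c, hj]
  let cs : ℂ → Cf D ℂ := fun s j α => coef (D j) (P j) α - (if j = i then (if α = pure (D j) i then s else 0) else 0)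
  have hev : ∀ s, (E R c).eval s = E R (cs s) := by
    intro s
    have := E_map (Polynomial.evalRingHom s) R c
    simp only [coe_evalRingHom] at this
    rw [this]
    congr 1
    funext j α
    simp only [c, cs, eval_sub, eval_C]
    split_ifs <;> simp
  have hF : ∀ s j z, F (cs s j) z = MvPolynomial.eval z (P j) - (if j = i then s * z i ^ D j else 0) := by
    intro s j z
    rw [← F_coef (P j) (hP j)]
    by_cases h : j = i
    · have h2 := F_single (d := D j) i s z
      have h3 := F_add (cs s j) (fun α => if α = pure (D j) i then s else 0) z
      simp only [cs, h, if_true, sub_add_cancel] at h3 ⊢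
      have e : D j = D i := by rw [h]
      rw [h2] at h3
      rw [← e]
      change F (coef (D j) (P i)) z = _ at h3
      linear_combination -h3
    · simp [cs, h]
  have hPi : ∀ z, MvPolynomial.eval z (P i) = (∑ l ∈ Finset.univ.erase i, z l) * z i ^ (D i - 1) := by
    intro z; simp [P]
  have hPj : ∀ j, j ≠ i → ∀ z, MvPolynomial.eval z (P j) = ∏ m ∈ Finset.range (D j), (z j - a j m * z i) := by
    intro j hj z; simp [P, hj, MvPolynomial.eval_prod]
  have hzi : ∀ h : ((j : Fin (t+1)) → Fin (D' j)), (h i : ℕ) = 0 := by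
    intro h
    have := (h i).2
    simp only [D', Function.update_self] at this
    omega
  have hsum : ∀ h : ((j : Fin (t+1)) → Fin (D' j)), ∑ l ∈ Finset.univ.erase i, a l (h l) = (val h : ℂ) := by
    intro h
    simp only [val, a]
    rw [← Finset.add_sum_erase _ _ (Finset.mem_univ i), hzi h]
    push_cast; simp
  -- vanishing at the values
  have hroot : ∀ h, E R (cs (val h)) = 0 := by
    intro h
    rw [hR.van]
    let z : Fin (t+1) → ℂ := fun j => if j = i then 1 else a j (h j)
    refine ⟨z, fun hz => ?_, fun j => ?_⟩
    · have := congrFun hz i; simp [z] at this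
    · rw [hF]
      by_cases hj : j = i
      · subst hj
        rw [hPi]
        have : ∑ l ∈ Finset.univ.erase j, z l = ∑ l ∈ Finset.univ.erase j, a l (h l) :=
          Finset.sum_congr rfl fun l hl => by simp [z, Finset.ne_of_mem_erase hl]
        rw [this, hsum]
        simp [z]
      · rw [hPj j hj, if_neg hj, sub_zero]
        have hlt : (h j : ℕ) < D j := by
          have := (h j).2
          have e : D' j = D j := by simp [D', hj]
          exact lt_of_lt_of_eq this e
        refine Finset.prod_eq_zero (Finset.mem_range.2 hlt) ?_
        simp [z, hj]
  have hnz : E R c ≠ 0 := by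
    intro h0
    obtain ⟨s, hs⟩ := (Set.finite_range (fun h => (val h : ℂ))).infinite_compl.nonempty
    have h1 := hev s
    rw [h0, eval_zero] at h1
    obtain ⟨z, hz, hzz⟩ := (hR.van _).1 h1.symm
    have hm : ∀ j, ∃ m : Fin (D' j), j ≠ i → z j = a j m * z i := by
      intro j
      by_cases hj : j = i
      · refine ⟨⟨0, ?_⟩, fun h => absurd hj h⟩
        simp [D', hj]
      · have := hzz j
        rw [hF, hPj j hj, if_neg hj, sub_zero, Finset.prod_eq_zero_iff] at this
        obtain ⟨m, hm, h⟩ := this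
        refine ⟨⟨m, ?_⟩, fun _ => by linear_combination h⟩
        have e : D' j = D j := by simp [D', hj]
        rw [e]; exact Finset.mem_range.1 hm
    choose h hh using hm
    have hzi0 : z i ≠ 0 := by
      intro h0
      apply hz
      funext j
      by_cases hj : j = i
      · subst hj; exact h0
      · rw [hh j hj, h0, mul_zero]; rfl
    apply hs
    refine ⟨h, ?_⟩
    have h2 := hzz i
    rw [hF, hPi, if_pos rfl] at h2
    have h3 : ∑ l ∈ Finset.univ.erase i, z l = val h * z i := by
      rw [← hsum, Finset.sum_mul]
      exact Finset.sum_congr rfl fun l hl => hh l (Finset.ne_of_mem_erase hl)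
    rw [h3] at h2
    obtain ⟨e, he⟩ : ∃ e, D i = e + 1 := ⟨D i - 1, by have := hD i; omega⟩
    rw [he, Nat.add_sub_cancel] at h2
    have h4 : ((val h : ℂ) - s) * z i ^ (e+1) = 0 := by linear_combination h2
    have := (mul_eq_zero.1 h4).resolve_right (pow_ne_zero _ hzi0)
    exact sub_eq_zero.1 this
  let Z : Finset ℂ := Finset.univ.image (fun h => (val h : ℂ))
  have hcard : Z.card = ∏ j ∈ Finset.univ.erase i, D j := by
    rw [Finset.card_image_of_injective _ (fun x y hxy => hval (Nat.cast_injective hxy)), Finset.card_univ,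
      Fintype.card_pi]
    simp only [Fintype.card_fin, D']
    rw [Finset.prod_update_of_mem (Finset.mem_univ i), one_mul, Finset.sdiff_singleton_eq_erase]
  rw [← hcard]
  refine (Polynomial.card_le_degree_of_subset_roots (p := E R c) ?_).trans hdeg
  intro x hx
  obtain ⟨h, _, rfl⟩ := Finset.mem_image.1 hx
  rw [mem_roots hnz, IsRoot, hev, hroot]

theorem exists_R' (hD : ∀ i, 1 ≤ D i) : ∃ R : MvPolynomial (Var D) ℤ,
    IsRes D (fun i => ∏ j ∈ Finset.univ.erase i, D j) R := by
  obtain ⟨k, R, hR, h⟩ := exists_R hD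
  have : k = fun i => ∏ j ∈ Finset.univ.erase i, D j :=
    funext fun i => le_antisymm (h i) (hR.lower hD i)
  exact ⟨R, this ▸ hR⟩
end
end MRes

namespace MRes
section
variable {t d : ℕ} {D : Fin (t+1) → ℕ} {K L : Type*} [CommRing K] [CommRing L]

/-- coefficients of a power of a linear form -/
noncomputable def lp (d : ℕ) (g : Fin (t+1) → K) : Mon t d → K :=
  coef d ((∑ j, MvPolynomial.C (g j) * MvPolynomial.X j) ^ d)

theorem lin_hom (g : Fin (t+1) → K) :
    (∑ j, MvPolynomial.C (g j) * MvPolynomial.X j : MvPolynomial (Fin (t+1)) K).IsHomogeneous 1 :=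
  MvPolynomial.IsHomogeneous.sum _ _ _ fun j _ => by
    simpa using (MvPolynomial.isHomogeneous_C _ (g j)).mul (MvPolynomial.isHomogeneous_X K j)

theorem F_lp (g z : Fin (t+1) → K) : F (lp d g) z = (∑ j, g j * z j) ^ d := by
  have : ((∑ j, MvPolynomial.C (g j) * MvPolynomial.X j : MvPolynomial (Fin (t+1)) K) ^ d).IsHomogeneous d := by
    simpa using (lin_hom g).pow d
  unfold lp
  rw [F_coef _ this]
  simp

theorem lp_map (φ : K →+* L) (g : Fin (t+1) → K) (α : Mon t d) :
    φ (lp d g α) = lp d (fun j => φ (g j)) α := by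
  unfold lp
  rw [coef_map]
  simp

theorem lp_smul (l : K) (g : Fin (t+1) → K) (α : Mon t d) :
    lp d (fun j => l * g j) α = l ^ d * lp d g α := by
  unfold lp coef
  have : (∑ j, MvPolynomial.C (l * g j) * MvPolynomial.X j : MvPolynomial (Fin (t+1)) K) =
    MvPolynomial.C l * ∑ j, MvPolynomial.C (g j) * MvPolynomial.X j := by
    rw [Finset.mul_sum]
    exact Finset.sum_congr rfl fun j _ => by rw [map_mul, mul_assoc]
  rw [this, mul_pow, ← map_pow, MvPolynomial.coeff_C_mul]

theorem lp_single (i : Fin (t+1)) (α : Mon t d) :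
    lp d (fun j => if i = j then (1:K) else 0) α = if α = pure d i then 1 else 0 := by
  unfold lp coef
  have : (∑ j, MvPolynomial.C (if i = j then (1:K) else 0) * MvPolynomial.X j : MvPolynomial (Fin (t+1)) K) =
    MvPolynomial.X i := by
    rw [Finset.sum_eq_single i]
    · simp
    · intro j _ hj; simp [hj.symm]
    · simp
  rw [this, MvPolynomial.coeff_X_pow]
  congr 1
  exact propext ⟨fun h => Mon.ext h.symm, fun h => by rw [h]; rfl⟩

/-- expected degree -/
def ee (D : Fin (t+1) → ℕ) (i : Fin (t+1)) : ℕ := ∏ j ∈ Finset.univ.erase i, D j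

theorem ee_mul (i : Fin (t+1)) : D i * ee D i = ∏ j, D j :=
  Finset.mul_prod_erase _ _ (Finset.mem_univ i)

variable {k : Fin (t+1) → ℕ} {R : MvPolynomial (Var D) ℤ}

theorem IsRes.scale_all (hR : IsRes D k R) (c : Cf D K) (l : Fin (t+1) → K) :
    E R (fun i α => l i * c i α) = (∏ i, l i ^ k i) * E R c := by
  classical
  rw [E_eq, E_eq, Finset.mul_sum]
  refine Finset.sum_congr rfl fun m hm => ?_
  have : ∏ v : Var D, (l v.1 * c v.1 v.2) ^ m v =
      (∏ i, l i ^ k i) * ∏ v : Var D, c v.1 v.2 ^ m v := by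
    simp_rw [mul_pow]
    rw [Finset.prod_mul_distrib]
    congr 1
    simp_rw [← fun i => hR.hom i m hm]
    unfold wt
    simp_rw [← Finset.prod_pow_eq_pow_sum]
    rw [Finset.prod_comm]
    refine Finset.prod_congr rfl fun v _ => ?_
    rw [Finset.prod_eq_single v.1]
    · simp
    · intro b _ hb; simp [hb.symm]
    · simp
  rw [this]; ring

/-- value on powers of linear forms -/
noncomputable def rho (R : MvPolynomial (Var D) ℤ) (g : Matrix (Fin (t+1)) (Fin (t+1)) ℂ) : ℂ :=
  E R (fun i => lp (D i) (g i))

theorem IsRes.rho_eq_zero (hR : IsRes D k R) (hD : ∀ i, 1 ≤ D i) (g : Matrix (Fin (t+1)) (Fin (t+1)) ℂ) :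
    rho R g = 0 ↔ g.det = 0 := by
  unfold rho
  rw [hR.van, ← Matrix.exists_mulVec_eq_zero_iff]
  constructor
  · rintro ⟨z, hz, h⟩
    refine ⟨z, hz, funext fun i => ?_⟩
    have := h i
    rw [F_lp] at this
    exact pow_eq_zero_iff (by have := hD i; omega) |>.1 this
  · rintro ⟨z, hz, h⟩
    refine ⟨z, hz, fun i => ?_⟩
    rw [F_lp]
    have := congrFun h i
    have h2 : ∑ j, g i j * z j = 0 := this
    rw [h2, zero_pow]
    have := hD i; omega

open Polynomial in
theorem IsRes.rho_transvection (hR : IsRes D k R) (hD : ∀ i, 1 ≤ D i) (B : Matrix (Fin (t+1)) (Fin (t+1)) ℂ)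
    (i j : Fin (t+1)) (hij : i ≠ j) (s : ℂ) : rho R (Matrix.transvection i j s * B) = rho R B := by
  by_cases hB : B.det = 0
  · rw [(hR.rho_eq_zero hD _).2 hB, hR.rho_eq_zero hD, Matrix.det_mul, hB, mul_zero]
  let h : ℂ[X] := E R (fun a => lp (D a) (fun b => C (B a b) + if a = i then X * C (B j b) else 0))
  have hev : ∀ s, h.eval s = rho R (Matrix.transvection i j s * B) := by
    intro s
    have := E_map (Polynomial.evalRingHom s) R
      (fun a => lp (D a) (fun b => C (B a b) + if a = i then X * C (B j b) else 0))
    simp only [coe_evalRingHom] at this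
    unfold rho
    refine this.trans ?_
    congr 1
    funext a α
    have := lp_map (Polynomial.evalRingHom s) (fun b => C (B a b) + if a = i then X * C (B j b) else 0) α
    refine this.trans ?_
    congr 1
    funext b
    by_cases ha : a = i
    · subst ha; simp; ring
    · simp [ha]
  have hc : h.degree = 0 := by
    by_contra hd
    obtain ⟨x, hx⟩ := IsAlgClosed.exists_root h hd
    rw [IsRoot, hev, hR.rho_eq_zero hD, Matrix.det_mul, Matrix.det_transvection_of_ne _ _ hij, one_mul] at hx
    exact hB hx
  have h0 := hev 0
  have hs := hev s
  rw [eq_C_of_degree_eq_zero hc, eval_C] at h0 hs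
  rw [← hs, h0]
  simp

theorem IsRes.rho_norm (hR : IsRes D (ee D) R) (hD : ∀ i, 1 ≤ D i) (g : Matrix (Fin (t+1)) (Fin (t+1)) ℂ) :
    ‖rho R g‖ = ‖g.det‖ ^ (∏ j, D j) := by
  by_cases hg : g.det = 0
  · rw [(hR.rho_eq_zero hD g).2 hg, hg, norm_zero, zero_pow]
    exact Finset.prod_ne_zero_iff.2 fun j _ => by have := hD j; omega
  have key : ∀ B, ‖rho R (g * B)‖ = ‖g.det‖ ^ (∏ j, D j) * ‖rho R B‖ := by
    refine Matrix.diagonal_transvection_induction_of_det_ne_zero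
      (fun g => ∀ B, ‖rho R (g * B)‖ = ‖g.det‖ ^ (∏ j, D j) * ‖rho R B‖) g hg ?_ ?_ ?_
    · intro l _ B
      have : rho R (Matrix.diagonal l * B) = (∏ i, (l i ^ D i) ^ ee D i) * rho R B := by
        unfold rho
        rw [← hR.scale_all]
        congr 1
        funext i α
        rw [← lp_smul]
        congr 1
        funext j
        rw [Matrix.diagonal_mul]
      rw [this, norm_mul, Matrix.det_diagonal]
      congr 1
      rw [← norm_pow, ← Finset.prod_pow]
      congr 1
      refine Finset.prod_congr rfl fun i _ => ?_
      rw [← pow_mul, ee_mul]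
    · intro T B
      have := hR.rho_transvection hD B T.i T.j T.hij T.c
      rw [Matrix.TransvectionStruct.det]
      change ‖rho R (Matrix.transvection T.i T.j T.c * B)‖ = _
      rw [this]; simp
    · intro A B _ _ hA hB C
      rw [Matrix.mul_assoc, hA, hB, Matrix.det_mul, norm_mul, mul_pow]; ring
  have h1 : ‖rho R (1 : Matrix (Fin (t+1)) (Fin (t+1)) ℂ)‖ = 1 := by
    have : rho R (1 : Matrix (Fin (t+1)) (Fin (t+1)) ℂ) = (E R (cE D ℤ) : ℤ) := by
      have := E_map (Int.castRingHom ℂ) R (cE D ℤ)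
      refine Eq.trans ?_ this.symm
      unfold rho
      congr 1
      funext i α
      have h := lp_single (K := ℂ) i α
      refine Eq.trans ?_ (h.trans ?_)
      · congr 1
      · unfold cE; split_ifs <;> simp
    rw [this]
    rcases Int.isUnit_iff.1 hR.pur with h | h <;> simp [h]
  have := key 1
  rwa [mul_one, h1, mul_one] at this

theorem IsRes.rho_le (hR : IsRes D (ee D) R) (hD : ∀ i, 1 ≤ D i) (g : Matrix (Fin (t+1)) (Fin (t+1)) ℂ)
    (hg : ∀ i j, ‖g i j‖ ≤ 1) : ‖rho R g‖ ≤ ((t:ℝ)+1) ^ ((t+1) * ∏ j, D j) := by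
  rw [hR.rho_norm hD, pow_mul]
  refine pow_le_pow_left₀ (norm_nonneg _) ?_ _
  have := Matrix.det_le (A := g) (abv := IsAbsoluteValue.toAbsoluteValue (norm : ℂ → ℝ)) (x := 1) hg
  refine this.trans ?_
  simp only [Fintype.card_fin, one_pow, nsmul_eq_mul, mul_one]
  have h := (t+1).descFactorial_le_pow (t+1)
  rw [Nat.descFactorial_self] at h
  exact_mod_cast h
end
end MRes

namespace MRes

theorem two_var {κ : Type*} (s : Finset κ) (a b : κ → ℂ) :
    ∃ ζ : ℂ, ‖ζ‖ = 1 ∧ ∏ k ∈ s, max ‖a k‖ ‖b k‖ ≤ ∏ k ∈ s, ‖a k + ζ * b k‖ := by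
  classical
  let g : ℂ → ℂ := fun x => ∏ k ∈ s, if ‖b k‖ ≤ ‖a k‖ then a k + x * b k else
    (starRingEnd ℂ) (b k) + x * (starRingEnd ℂ) (a k)
  have hd : Differentiable ℂ g := by
    apply Differentiable.fun_finsetProd
    intro k _
    split_ifs <;> fun_prop
  obtain ⟨ζ, hζ, hmax⟩ := Complex.exists_mem_frontier_isMaxOn_norm (f := g) (U := Metric.ball 0 1)
    Metric.isBounded_ball ⟨0, by simp⟩ hd.diffContOnCl
  rw [frontier_ball (0:ℂ) one_ne_zero, mem_sphere_zero_iff_norm] at hζ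
  refine ⟨ζ, hζ, ?_⟩
  have h0 : ‖g 0‖ ≤ ‖g ζ‖ := hmax (subset_closure (by simp))
  have e0 : ‖g 0‖ = ∏ k ∈ s, max ‖a k‖ ‖b k‖ := by
    simp only [g, norm_prod]
    refine Finset.prod_congr rfl fun k _ => ?_
    split_ifs with h
    · simp [max_eq_left h]
    · rw [max_eq_right (le_of_not_ge h)]; simp
  have e1 : ‖g ζ‖ = ∏ k ∈ s, ‖a k + ζ * b k‖ := by
    simp only [g, norm_prod]
    refine Finset.prod_congr rfl fun k _ => ?_
    split_ifs with h
    · rfl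
    · have h1 : ζ * (starRingEnd ℂ) ζ = 1 := by
        rw [Complex.mul_conj, Complex.normSq_eq_norm_sq, hζ]; simp
      have h2 : (starRingEnd ℂ) (b k) + ζ * (starRingEnd ℂ) (a k) =
          ζ * (starRingEnd ℂ) (a k + ζ * b k) := by
        rw [map_add, map_mul]
        linear_combination -(starRingEnd ℂ) (b k) * h1
      rw [h2, norm_mul, hζ, one_mul, RCLike.norm_conj]
  rw [← e0, ← e1]; exact h0

theorem torus {κ ι : Type*} [DecidableEq ι] (z : κ → ι → ℂ) (m : κ → ι) (A : Finset ι) :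
    ∀ s : Finset κ, (∀ k ∈ s, m k ∈ A) → ∃ ξ : ι → ℂ, (∀ j, ‖ξ j‖ = 1) ∧
      ∏ k ∈ s, ‖z k (m k)‖ ≤ ∏ k ∈ s, ‖∑ j ∈ A, ξ j * z k j‖ := by
  classical
  induction A using Finset.induction_on with
  | empty =>
    intro s hs
    refine ⟨fun _ => 1, by simp, ?_⟩
    have : s = ∅ := Finset.eq_empty_of_forall_notMem fun k hk => by simpa using hs k hk
    subst this; simp
  | insert a A ha ih =>
    intro s hs
    obtain ⟨ξ, hξ, h1⟩ := ih (s.filter (fun k => m k ≠ a)) (by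
      intro k hk
      rw [Finset.mem_filter] at hk
      exact (Finset.mem_insert.1 (hs k hk.1)).resolve_left hk.2)
    obtain ⟨ζ, hζ, h2⟩ := two_var s (fun k => ∑ j ∈ A, ξ j * z k j) (fun k => z k a)
    refine ⟨Function.update ξ a ζ, ?_, ?_⟩
    · intro j
      by_cases h : j = a
      · subst h; simpa using hζ
      · simpa [h] using hξ j
    · have e : ∀ k, ∑ j ∈ insert a A, Function.update ξ a ζ j * z k j =
          ∑ j ∈ A, ξ j * z k j + ζ * z k a := by
        intro k
        rw [Finset.sum_insert ha, add_comm]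
        congr 1
        · refine Finset.sum_congr rfl fun j hj => ?_
          rw [Function.update_of_ne]
          rintro rfl; exact ha hj
        · simp
      simp_rw [e]
      refine le_trans ?_ h2
      rw [← Finset.prod_filter_mul_prod_filter_not s (fun k => m k ≠ a),
        ← Finset.prod_filter_mul_prod_filter_not s (fun k => m k ≠ a) (fun k => max _ _)]
      refine mul_le_mul (h1.trans ?_) ?_ (Finset.prod_nonneg fun _ _ => norm_nonneg _)
        (Finset.prod_nonneg fun _ _ => le_max_of_le_left (norm_nonneg _))
      · exact Finset.prod_le_prod (fun _ _ => norm_nonneg _) fun k _ => le_max_left _ _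
      · refine Finset.prod_le_prod (fun _ _ => norm_nonneg _) fun k hk => ?_
        have : m k = a := by simpa using (Finset.mem_filter.1 hk).2
        rw [this]
        exact le_max_right _ _

section
variable {σ : Type*} [Fintype σ]

/-- linear form -/
noncomputable def Lin (u : σ → ℂ) : MvPolynomial σ ℂ := ∑ a, MvPolynomial.C (u a) * MvPolynomial.X a

theorem eval_Lin (u w : σ → ℂ) : MvPolynomial.eval w (Lin u) = ∑ a, u a * w a := by simp [Lin]

theorem Lin_irr (u : σ → ℂ) (hu : u ≠ 0) : Irreducible (Lin u) := by
  classical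
  have hco : ∀ a, (Lin u).coeff (Finsupp.single a 1) = u a := by
    intro a
    simp only [Lin, MvPolynomial.coeff_sum, MvPolynomial.coeff_C_mul, MvPolynomial.coeff_X]
    rw [Finset.sum_eq_single a]
    · simp
    · intro b _ hb
      rw [if_neg, mul_zero]
      intro h
      exact hb (Finsupp.single_left_injective one_ne_zero h)
    · simp
  obtain ⟨a, ha⟩ : ∃ a, u a ≠ 0 := by
    by_contra h; push Not at h; exact hu (funext h)
  have hh : (Lin u).IsHomogeneous 1 := MvPolynomial.IsHomogeneous.sum _ _ _ fun j _ => by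
    simpa using (MvPolynomial.isHomogeneous_C _ (u j)).mul (MvPolynomial.isHomogeneous_X ℂ j)
  have hne : Lin u ≠ 0 := by
    intro h
    apply ha
    rw [← hco, h, MvPolynomial.coeff_zero]
  apply MvPolynomial.irreducible_of_totalDegree_eq_one (hh.totalDegree hne)
  intro x hx
  have := hx (Finsupp.single a 1)
  rw [hco] at this
  exact isUnit_of_dvd_unit this (isUnit_iff_ne_zero.2 ha)

/-- consequence of the Nullstellensatz -/
theorem prime_dvd {g p : MvPolynomial σ ℂ} (hg : Prime g)
    (h : ∀ w, MvPolynomial.eval w g = 0 → MvPolynomial.eval w p = 0) : g ∣ p := by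
  have : p ∈ (Ideal.span {g}).radical := by
    rw [← MvPolynomial.vanishingIdeal_zeroLocus_eq_radical (K := ℂ), MvPolynomial.mem_vanishingIdeal_iff]
    intro w hw
    rw [MvPolynomial.zeroLocus_span] at hw
    have := hw g rfl
    exact h w this
  obtain ⟨n, hn⟩ := this
  exact hg.dvd_of_dvd_pow (Ideal.mem_span_singleton.1 hn)

theorem fact {ζ : Type*} (u : ζ → σ → ℂ) (hu : ∀ z, u z ≠ 0) (f : MvPolynomial σ ℂ) (hf : f ≠ 0)
    (h : ∀ w, MvPolynomial.eval w f = 0 ↔ ∃ z, MvPolynomial.eval w (Lin (u z)) = 0) :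
    ∃ (n : ℕ) (a : ℂ) (p : Fin n → ζ), f = MvPolynomial.C a * ∏ k, Lin (u (p k)) := by
  classical
  have hirr : ∀ g, Irreducible g → g ∣ f → ∃ z, Associated g (Lin (u z)) := by
    intro g hg hgf
    let T := (UniqueFactorizationMonoid.factors f).filter (fun q => ∃ z, Associated q (Lin (u z)))
    have hgT : g ∣ T.prod := by
      apply prime_dvd hg.prime
      intro w hw
      have hfw : MvPolynomial.eval w f = 0 := by
        obtain ⟨x, rfl⟩ := hgf
        rw [map_mul, hw, zero_mul]
      obtain ⟨z, hz⟩ := (h w).1 hfw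
      have hdvd : Lin (u z) ∣ f := prime_dvd (Lin_irr _ (hu z)).prime fun w' hw' => (h w').2 ⟨z, hw'⟩
      obtain ⟨q, hq, hqa⟩ := UniqueFactorizationMonoid.exists_mem_factors_of_dvd hf (Lin_irr _ (hu z)) hdvd
      have hqT : q ∈ T := Multiset.mem_filter.2 ⟨hq, z, hqa.symm⟩
      obtain ⟨x, hx⟩ := hqa.dvd.trans (Multiset.dvd_prod hqT)
      rw [hx, map_mul, hz, zero_mul]
    obtain ⟨q, hq, hgq⟩ := Prime.exists_mem_multiset_dvd hg.prime hgT
    obtain ⟨_, z, hz⟩ := Multiset.mem_filter.1 hq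
    refine ⟨z, (hg.associated_of_dvd (Lin_irr _ (hu z)) (hgq.trans hz.dvd))⟩
  have main : ∀ g : MvPolynomial σ ℂ, g ≠ 0 → g ∣ f → ∃ (n : ℕ) (a : ℂ) (p : Fin n → ζ), g = MvPolynomial.C a * ∏ k, Lin (u (p k)) := by
    intro g
    induction g using WfDvdMonoid.induction_on_irreducible with
    | zero => intro h; exact absurd rfl h
    | unit v hv =>
      intro _ _
      obtain ⟨r, _, hr⟩ := MvPolynomial.isUnit_iff_eq_C_of_isReduced.1 hv
      exact ⟨0, r, fun k => k.elim0, by simp [hr]⟩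
    | mul b q hb hq ih =>
      intro _ hd
      obtain ⟨n, a, p, hp⟩ := ih hb ((dvd_mul_left _ _).trans hd)
      obtain ⟨z, hz⟩ := hirr q hq ((dvd_mul_right _ _).trans hd)
      obtain ⟨v, hv⟩ := hz.symm
      obtain ⟨r, _, hr⟩ := MvPolynomial.isUnit_iff_eq_C_of_isReduced.1 v.isUnit
      refine ⟨n+1, r * a, Fin.cons z p, ?_⟩
      rw [Fin.prod_univ_succ]
      simp only [Fin.cons_zero, Fin.cons_succ]
      rw [hp, ← hv, hr, map_mul]; ring
  exact main f hf dvd_rfl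
end

section
variable {t d : ℕ} {D : Fin (t+1) → ℕ} {R : MvPolynomial (Var D) ℤ}

theorem F_norm_le (w : Mon t d → ℂ) (z : Fin (t+1) → ℂ) (m : Fin (t+1)) (hm : ∀ j, ‖z j‖ ≤ ‖z m‖) :
    ‖F w z‖ ≤ (∑ α, ‖w α‖) * ‖z m‖ ^ d := by
  unfold F
  rw [Finset.sum_mul]
  refine (norm_sum_le _ _).trans (Finset.sum_le_sum fun α _ => ?_)
  rw [norm_mul]
  refine mul_le_mul_of_nonneg_left ?_ (norm_nonneg _)
  unfold mv
  have e : ‖z m‖ ^ d = ∏ j, ‖z m‖ ^ (α.1 j) := by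
    rw [Finset.prod_pow_eq_pow_sum]; exact congrArg _ α.2.symm
  rw [norm_prod, e]
  refine Finset.prod_le_prod (fun _ _ => norm_nonneg _) fun j _ => ?_
  rw [norm_pow]
  exact pow_le_pow_left₀ (norm_nonneg _) (hm j) _

theorem IsRes.step {k : Fin (t+1) → ℕ} (hR : IsRes D k R) (i : Fin (t+1)) (c : Cf D ℂ) :
    ∃ ξ : Fin (t+1) → ℂ, (∀ j, ‖ξ j‖ = 1) ∧
      ‖E R c‖ ≤ (∑ α, ‖c i α‖) ^ k i * ‖E R (Function.update c i (lp (D i) ξ))‖ := by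
  classical
  by_cases h0 : E R c = 0
  · refine ⟨fun _ => 1, by simp, ?_⟩
    rw [h0, norm_zero]
    exact mul_nonneg (pow_nonneg (Finset.sum_nonneg fun _ _ => norm_nonneg _) _) (norm_nonneg _)
  let cf : Cf D (MvPolynomial (Mon t (D i)) ℂ) :=
    Function.update (fun j α => MvPolynomial.C (c j α)) i (fun α => MvPolynomial.X α)
  let f := E R cf
  have hev : ∀ w, MvPolynomial.eval w f = E R (Function.update c i w) := by
    intro w
    have := E_map (MvPolynomial.eval w) R cf
    refine this.trans ?_
    congr 1
    funext j α
    by_cases hj : j = i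
    · subst hj; simp [cf]
    · simp [cf, hj]
  let Z := {z : Fin (t+1) → ℂ // z ≠ 0 ∧ ∀ j, j ≠ i → F (c j) z = 0}
  let u : Z → Mon t (D i) → ℂ := fun z α => mv α.1 z.1
  have hLin : ∀ z w, MvPolynomial.eval w (Lin (u z)) = F w z.1 := by
    intro z w
    rw [eval_Lin]
    exact Finset.sum_congr rfl fun α _ => mul_comm _ _
  have hu : ∀ z, u z ≠ 0 := by
    intro z hz
    apply z.2.1
    funext j
    have := congrFun hz (pure (D i) j)
    simp only [u, mv_pure] at this
    by_contra hne
    exact pow_ne_zero _ hne this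
  have hz : ∀ w, MvPolynomial.eval w f = 0 ↔ ∃ z, MvPolynomial.eval w (Lin (u z)) = 0 := by
    intro w
    rw [hev, hR.van]
    constructor
    · rintro ⟨z, hz, hF⟩
      refine ⟨⟨z, hz, fun j hj => ?_⟩, ?_⟩
      · have := hF j
        rwa [Function.update_of_ne hj] at this
      · rw [hLin]
        have := hF i
        rwa [Function.update_self] at this
    · rintro ⟨z, hz⟩
      rw [hLin] at hz
      refine ⟨z.1, z.2.1, fun j => ?_⟩
      by_cases hj : j = i
      · subst hj; rwa [Function.update_self]
      · rw [Function.update_of_ne hj]; exact z.2.2 j hj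
  have hfc : MvPolynomial.eval (c i) f = E R c := by
    rw [hev, Function.update_eq_self]
  have hf0 : f ≠ 0 := by
    intro h; rw [h, map_zero] at hfc; exact h0 hfc.symm
  obtain ⟨n, a, p, hp⟩ := fact u hu f hf0 hz
  have hval : ∀ w, E R (Function.update c i w) = a * ∏ k, F w (p k).1 := by
    intro w
    rw [← hev, hp]
    simp only [map_mul, MvPolynomial.eval_C, map_prod, hLin]
  have hcv : E R c = a * ∏ k, F (c i) (p k).1 := by
    rw [← hval, Function.update_eq_self]
  have hn : n = k i := by
    have h1 := hR.scale c i 2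
    rw [hval] at h1
    simp_rw [F_smul_left] at h1
    rw [Finset.prod_mul_distrib, Finset.prod_const, Finset.card_univ, Fintype.card_fin, hcv] at h1
    have h2 : a * ∏ k, F (c i) (p k).1 ≠ 0 := hcv ▸ h0
    have h3 : (2:ℂ) ^ n = 2 ^ k i := by
      apply mul_right_cancel₀ h2
      rw [← h1]; ring
    have h4 : (2:ℕ) ^ n = 2 ^ k i := by exact_mod_cast h3
    exact Nat.pow_right_injective le_rfl h4
  have hmax : ∀ k, ∃ m, ∀ j, ‖(p k).1 j‖ ≤ ‖(p k).1 m‖ := fun k =>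
    Finite.exists_max (fun j => ‖(p k).1 j‖)
  choose m hm using hmax
  obtain ⟨ξ, hξ, hle⟩ := torus (fun k => (p k).1) m Finset.univ Finset.univ (by simp)
  refine ⟨ξ, hξ, ?_⟩
  rw [hcv, hval, norm_mul, norm_mul, norm_prod, norm_prod, ← hn]
  simp_rw [F_lp, norm_pow]
  calc ‖a‖ * ∏ k, ‖F (c i) (p k).1‖
      ≤ ‖a‖ * ∏ k, ((∑ α, ‖c i α‖) * ‖(p k).1 (m k)‖ ^ D i) := by
        refine mul_le_mul_of_nonneg_left ?_ (norm_nonneg _)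
        exact Finset.prod_le_prod (fun _ _ => norm_nonneg _) fun k _ => F_norm_le _ _ _ (hm k)
    _ = (∑ α, ‖c i α‖) ^ n * (‖a‖ * (∏ k, ‖(p k).1 (m k)‖) ^ D i) := by
        rw [Finset.prod_mul_distrib, Finset.prod_const, Finset.card_univ, Fintype.card_fin,
          Finset.prod_pow]; ring
    _ ≤ (∑ α, ‖c i α‖) ^ n * (‖a‖ * (∏ k, ‖∑ j, ξ j * (p k).1 j‖) ^ D i) := by
        refine mul_le_mul_of_nonneg_left ?_ (pow_nonneg (Finset.sum_nonneg fun _ _ => norm_nonneg _) _)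
        refine mul_le_mul_of_nonneg_left ?_ (norm_nonneg _)
        exact pow_le_pow_left₀ (Finset.prod_nonneg fun _ _ => norm_nonneg _) hle _
    _ = _ := by rw [Finset.prod_pow]

theorem IsRes.steps {k : Fin (t+1) → ℕ} (hR : IsRes D k R) (c : Cf D ℂ) (A : Finset (Fin (t+1))) :
    ∃ ξ : Fin (t+1) → Fin (t+1) → ℂ, (∀ i j, ‖ξ i j‖ = 1) ∧
      ‖E R c‖ ≤ (∏ i ∈ A, (∑ α, ‖c i α‖) ^ k i) *
        ‖E R (fun i => if i ∈ A then lp (D i) (ξ i) else c i)‖ := by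
  classical
  induction A using Finset.induction_on with
  | empty => exact ⟨fun _ _ => 1, by simp, by simp⟩
  | insert a A ha ih =>
    obtain ⟨ξ, hξ, h⟩ := ih
    obtain ⟨η, hη, h'⟩ := hR.step a (fun i => if i ∈ A then lp (D i) (ξ i) else c i)
    refine ⟨Function.update ξ a η, ?_, ?_⟩
    · intro i j
      by_cases hi : i = a
      · subst hi; simpa using hη j
      · simpa [hi] using hξ i j
    · have e : Function.update (fun i => if i ∈ A then lp (D i) (ξ i) else c i) a (lp (D a) η) =
          fun i => if i ∈ insert a A then lp (D i) (Function.update ξ a η i) else c i := by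
        funext i
        by_cases hi : i = a
        · subst hi; simp
        · simp [hi]
      rw [e] at h'
      simp only [ha, if_false] at h'
      rw [Finset.prod_insert ha, mul_comm (_ ^ k a), mul_assoc]
      refine h.trans (mul_le_mul_of_nonneg_left h' ?_)
      exact Finset.prod_nonneg fun _ _ => pow_nonneg (Finset.sum_nonneg fun _ _ => norm_nonneg _) _

theorem IsRes.bound (hR : IsRes D (ee D) R) (hD : ∀ i, 1 ≤ D i) (c : Cf D ℂ) :
    ‖E R c‖ ≤ (∏ i, (∑ α, ‖c i α‖) ^ ee D i) * ((t:ℝ)+1) ^ ((t+1) * ∏ j, D j) := by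
  obtain ⟨ξ, hξ, h⟩ := hR.steps c Finset.univ
  refine h.trans (mul_le_mul_of_nonneg_left ?_
    (Finset.prod_nonneg fun _ _ => pow_nonneg (Finset.sum_nonneg fun _ _ => norm_nonneg _) _))
  simp only [Finset.mem_univ, if_true]
  exact hR.rho_le hD ξ fun i j => (hξ i j).le

end
end MRes

namespace MRes

theorem cauchy {σ : Type*} [Fintype σ] (p : MvPolynomial σ ℂ) (B : ℝ)
    (h : ∀ x : σ → ℂ, (∀ v, ‖x v‖ = 1) → ‖MvPolynomial.eval x p‖ ≤ B) (m0 : σ →₀ ℕ)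
    (hm0 : m0 ∈ p.support) : ‖p.coeff m0‖ ≤ B := by
  classical
  let N := p.totalDegree + 1
  have hlt : ∀ m ∈ p.support, ∀ v, m v < N := by
    intro m hm v
    refine Nat.lt_succ_of_le (le_trans ?_ (MvPolynomial.le_totalDegree hm))
    by_cases hv : v ∈ m.support
    · exact Finset.single_le_sum (f := fun v => m v) (fun _ _ => Nat.zero_le _) hv
    · simp [Finsupp.notMem_support_iff.1 hv]
  have hN : N ≠ 0 := Nat.succ_ne_zero _
  have hω := Complex.isPrimitiveRoot_exp N hN
  set ω := Complex.exp (2 * Real.pi * Complex.I / N) with hωd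
  have hωn : ‖ω‖ = 1 := hω.norm'_eq_one hN
  have hω0 : ω ≠ 0 := by intro h0; rw [h0, norm_zero] at hωn; exact zero_ne_one hωn
  have hgeom : ∀ a b : ℕ, a < N → b < N →
      ∑ x : Fin N, (ω ^ a * (ω⁻¹) ^ b) ^ (x:ℕ) = if a = b then (N:ℂ) else 0 := by
    intro a b ha hb
    rw [Fin.sum_univ_eq_sum_range (fun x => (ω ^ a * (ω⁻¹) ^ b) ^ x)]
    have hinv : ω ^ b * (ω⁻¹) ^ b = 1 := by rw [← mul_pow, mul_inv_cancel₀ hω0, one_pow]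
    split_ifs with hab
    · subst hab
      rw [hinv]; simp
    · have hne : ω ^ a * (ω⁻¹) ^ b ≠ 1 := by
        intro h1
        apply hab
        apply hω.pow_inj ha hb
        calc ω ^ a = ω ^ a * (ω ^ b * (ω⁻¹) ^ b) := by rw [hinv, mul_one]
          _ = (ω ^ a * (ω⁻¹) ^ b) * ω ^ b := by ring
          _ = ω ^ b := by rw [h1, one_mul]
      have hg := mul_geom_sum (ω ^ a * (ω⁻¹) ^ b) N
      have h1 : (ω ^ a * (ω⁻¹) ^ b) ^ N = 1 := by
        rw [mul_pow, ← pow_mul, ← pow_mul, mul_comm a, mul_comm b, pow_mul, pow_mul, inv_pow,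
          hω.pow_eq_one]
        simp
      rw [h1, sub_self] at hg
      exact (mul_eq_zero.1 hg).resolve_left (sub_ne_zero.2 hne)
  have key : ∑ g : σ → Fin N, (∏ v, (ω⁻¹) ^ (m0 v * (g v : ℕ))) *
      MvPolynomial.eval (fun v => ω ^ (g v : ℕ)) p = (N:ℂ) ^ (Fintype.card σ) * p.coeff m0 := by
    simp_rw [MvPolynomial.eval_eq', Finset.mul_sum]
    rw [Finset.sum_comm]
    have : ∀ m ∈ p.support, ∑ g : σ → Fin N, (∏ v, (ω⁻¹) ^ (m0 v * (g v : ℕ))) *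
        (p.coeff m * ∏ v, (ω ^ (g v : ℕ)) ^ m v) =
        p.coeff m * (if m = m0 then (N:ℂ) ^ (Fintype.card σ) else 0) := by
      intro m hm
      have e1 : ∀ g : σ → Fin N, (∏ v, (ω⁻¹) ^ (m0 v * (g v : ℕ))) *
          (p.coeff m * ∏ v, (ω ^ (g v : ℕ)) ^ m v) =
          p.coeff m * ∏ v, (ω ^ m v * (ω⁻¹) ^ m0 v) ^ (g v : ℕ) := by
        intro g
        rw [mul_left_comm, ← Finset.prod_mul_distrib]
        congr 1
        refine Finset.prod_congr rfl fun v _ => ?_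
        rw [mul_pow, ← pow_mul, ← pow_mul, ← pow_mul, mul_comm (m v)]; ring
      simp_rw [e1]
      rw [← Finset.mul_sum]
      congr 1
      have e2 := Finset.prod_univ_sum (fun _ : σ => (Finset.univ : Finset (Fin N)))
        (fun v x => (ω ^ m v * (ω⁻¹) ^ m0 v) ^ (x : ℕ))
      rw [Fintype.piFinset_univ] at e2
      rw [← e2]
      rw [Finset.prod_congr rfl fun v _ => hgeom (m v) (m0 v) (hlt m hm v) (hlt m0 hm0 v)]
      split_ifs with hmm
      · subst hmm; simp
      · obtain ⟨v, hv⟩ : ∃ v, m v ≠ m0 v := by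
          by_contra hcon; push Not at hcon; exact hmm (Finsupp.ext hcon)
        exact Finset.prod_eq_zero (Finset.mem_univ v) (if_neg hv)
    rw [Finset.sum_congr rfl this]
    simp only [mul_ite, mul_zero]
    rw [Finset.sum_ite_eq' , if_pos hm0, mul_comm]
  have hpos : (0:ℝ) < (N:ℝ) ^ (Fintype.card σ) := pow_pos (by exact_mod_cast Nat.pos_of_ne_zero hN) _
  have hle : (N:ℝ) ^ (Fintype.card σ) * ‖p.coeff m0‖ ≤ (N:ℝ) ^ (Fintype.card σ) * B := by
    have e : (N:ℝ) ^ (Fintype.card σ) * ‖p.coeff m0‖ = ‖(N:ℂ) ^ (Fintype.card σ) * p.coeff m0‖ := by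
      rw [norm_mul, norm_pow, Complex.norm_natCast]
    rw [e, ← key]
    refine (norm_sum_le _ _).trans ?_
    have : ∀ g ∈ (Finset.univ : Finset (σ → Fin N)), ‖(∏ v, (ω⁻¹) ^ (m0 v * (g v : ℕ))) *
      MvPolynomial.eval (fun v => ω ^ (g v : ℕ)) p‖ ≤ B := by
      intro g _
      rw [norm_mul, norm_prod]
      simp only [norm_pow, norm_inv, hωn, inv_one, one_pow, Finset.prod_const_one, one_mul]
      exact h _ fun v => by rw [norm_pow, hωn, one_pow]
    refine (Finset.sum_le_card_nsmul _ _ _ this).trans ?_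
    simp
  exact le_of_mul_le_mul_left hle hpos

theorem exists_fiber {A : Type*} [Fintype A] [DecidableEq A] (m : A → ℕ) (e : ℕ) (he : ∑ a, m a = e) :
    ∃ h : Fin e → A, ∀ a, (Finset.univ.filter (fun x => h x = a)).card = m a := by
  have hc : Fintype.card ((a : A) × Fin (m a)) = Fintype.card (Fin e) := by simp [he]
  let eq := Fintype.equivOfCardEq hc
  refine ⟨fun x => (eq.symm x).1, fun a => ?_⟩
  have : (Finset.univ.filter (fun x => (eq.symm x).1 = a)) =
      (Finset.univ : Finset (Fin (m a))).image (fun y => eq ⟨a, y⟩) := by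
    ext x
    simp only [Finset.mem_filter, Finset.mem_univ, true_and, Finset.mem_image]
    constructor
    · intro h
      subst h
      exact ⟨(eq.symm x).2, by simp⟩
    · rintro ⟨y, rfl⟩; simp
  rw [this, Finset.card_image_of_injective]
  · simp
  · intro y y' h
    have := eq.injective h
    simpa using this

theorem card_Mon (t d : ℕ) : Fintype.card (Mon t d) ≤ (t+1) ^ d := by
  classical
  have hex : ∀ α : Mon t d, ∃ h : Fin d → Fin (t+1),
    ∀ a, (Finset.univ.filter (fun x => h x = a)).card = α.1 a := fun α => exists_fiber _ _ α.2
  choose h hh using hex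
  have : Function.Injective h := by
    intro α β hab
    apply Mon.ext
    ext a
    rw [← hh, ← hh, hab]
  have := Fintype.card_le_of_injective h this
  simpa using this

section
variable {t : ℕ} {D : Fin (t+1) → ℕ} {R : MvPolynomial (Var D) ℤ}

theorem wt_eq (i : Fin (t+1)) (m : Var D →₀ ℕ) : wt i m = ∑ α, m ⟨i, α⟩ := by
  classical
  unfold wt
  rw [Fintype.sum_sigma, Finset.sum_eq_single i]
  · simp
  · intro b _ hb; simp [hb]
  · simp

theorem IsRes.card_support {k : Fin (t+1) → ℕ} (hR : IsRes D k R) :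
    R.support.card ≤ ∏ i, Fintype.card (Mon t (D i)) ^ k i := by
  classical
  have hex : ∀ (m : R.support) i, ∃ h : Fin (k i) → Mon t (D i),
      ∀ a, (Finset.univ.filter (fun x => h x = a)).card = m.1 ⟨i, a⟩ := fun m i =>
    exists_fiber _ _ (by rw [← wt_eq]; exact hR.hom i m.1 m.2)
  choose h hh using hex
  have : Function.Injective h := by
    intro α β hab
    apply Subtype.ext
    ext ⟨i, a⟩
    rw [← hh, ← hh, hab]
  have := Fintype.card_le_of_injective h this
  simpa using this

theorem prod_card_le : ∏ i, Fintype.card (Mon t (D i)) ^ ee D i ≤ (t+1) ^ ((t+1) * ∏ j, D j) := by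
  calc ∏ i, Fintype.card (Mon t (D i)) ^ ee D i ≤ ∏ _i : Fin (t+1), (t+1) ^ ∏ j, D j := by
        refine Finset.prod_le_prod' fun i _ => ?_
        rw [← ee_mul i, pow_mul]
        exact Nat.pow_le_pow_left (card_Mon _ _) _
    _ = _ := by rw [Finset.prod_const, Finset.card_univ, Fintype.card_fin, ← pow_mul, mul_comm]

theorem IsRes.coeff_le (hR : IsRes D (ee D) R) (hD : ∀ i, 1 ≤ D i) (m) (hm : m ∈ R.support) :
    |R.coeff m| ≤ ((t:ℤ)+1) ^ (2 * ((t+1) * ∏ j, D j)) := by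
  have hinj : Function.Injective (Int.castRingHom ℂ) := Int.cast_injective
  have h := cauchy (MvPolynomial.map (Int.castRingHom ℂ) R) (((t:ℝ)+1) ^ (2 * ((t+1) * ∏ j, D j))) ?_ m ?_
  · rw [MvPolynomial.coeff_map] at h
    have h2 : ‖((MvPolynomial.coeff m R : ℤ) : ℂ)‖ = |((MvPolynomial.coeff m R : ℤ) : ℝ)| := by
      rw [Complex.norm_intCast]
    simp only [eq_intCast] at h
    rw [h2] at h
    exact_mod_cast h
  · intro x hx
    have e : MvPolynomial.eval x (MvPolynomial.map (Int.castRingHom ℂ) R) = E R (fun i α => x ⟨i, α⟩) := by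
      rw [MvPolynomial.eval_map]
      unfold E
      rw [MvPolynomial.aeval_def]
      rfl
    rw [e]
    refine (hR.bound hD _).trans ?_
    rw [two_mul, pow_add]
    refine mul_le_mul_of_nonneg_right ?_ (by positivity)
    simp only [hx, Finset.sum_const, Finset.card_univ, nsmul_eq_mul, mul_one]
    exact_mod_cast prod_card_le
  · rw [MvPolynomial.support_map_of_injective _ hinj]; exact hm

theorem IsRes.length_le (hR : IsRes D (ee D) R) (hD : ∀ i, 1 ≤ D i) :
    ∑ m ∈ R.support, |R.coeff m| ≤ ((t:ℤ)+1) ^ (3 * (t+1) * ∏ j, D j) := by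
  refine (Finset.sum_le_card_nsmul _ _ _ (hR.coeff_le hD)).trans ?_
  rw [nsmul_eq_mul]
  have h1 : (R.support.card : ℤ) ≤ ((t:ℤ)+1) ^ ((t+1) * ∏ j, D j) := by
    exact_mod_cast hR.card_support.trans prod_card_le
  calc _ ≤ ((t:ℤ)+1) ^ ((t+1) * ∏ j, D j) * ((t:ℤ)+1) ^ (2 * ((t+1) * ∏ j, D j)) :=
        mul_le_mul_of_nonneg_right h1 (by positivity)
    _ = _ := by rw [← pow_add]; congr 1; ring
end

theorem irr_rename {σ τ : Type*} (f : σ → τ) (hf : Function.Injective f) {p : MvPolynomial σ ℤ}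
    (hp : Irreducible p) : Irreducible (MvPolynomial.rename f p) := by
  have h1 : Prime (MvPolynomial.renameEquiv ℤ (Equiv.ofInjective f hf) p) :=
    (MulEquiv.prime_iff (MvPolynomial.renameEquiv ℤ (Equiv.ofInjective f hf)).toMulEquiv).2 hp.prime
  have h2 := (MvPolynomial.prime_rename_iff (Set.range f)).2 h1
  have : MvPolynomial.rename f p = MvPolynomial.rename ((↑) : Set.range f → τ)
      (MvPolynomial.renameEquiv ℤ (Equiv.ofInjective f hf) p) := by
    rw [MvPolynomial.renameEquiv_apply, MvPolynomial.rename_rename]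
    rfl
  rw [this]
  exact h2.irreducible

end MRes


/-- **Existence of the multivariate resultant.**
For positive integers `D₀,…,D_t` there is a polynomial `R` with integer
coefficients, in variables indexed by pairs `(i, m)` where `m` ranges over the
monomials of degree `D i` in `X₀,…,X_t`, such that the induced map
`Res (Q₀,…,Q_t) = R((coeffs of Q₀),…,(coeffs of Q_t))` on tuples of homogeneous
polynomials `Q i` of degree `D i` satisfies:
(1) `Res (Q₀,…,Q_t) = 0` iff the `Q i` have a common nonzero zero in `ℂ^{t+1}`;
(2) `Res` is homogeneous of degree `D₀⋯D_t / D i = ∏_{j ≠ i} D j` in its `i`-th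
argument;
(3) `R` is irreducible over `ℤ`;
(4) `R` has length at most `(t+1)^{3(t+1)D₀⋯D_t}`. -/
theorem exists_resultant
    (t : ℕ) (D : Fin (t + 1) → ℕ) (hD : ∀ i, 1 ≤ D i) :
    ∃ R : MvPolynomial (Fin (t + 1) × ((Fin (t + 1)) →₀ ℕ)) ℤ,
      -- the variables of `R` are (indices of) coefficients of a homogeneous
      -- polynomial of degree `D i` in the `i`-th argument
      (∀ v ∈ R.vars, ∑ j, v.2 j = D v.1) ∧
      -- (1) vanishing iff common projective zero
      (∀ Q : Fin (t + 1) → MvPolynomial (Fin (t + 1)) ℂ,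
        (∀ i, (Q i).IsHomogeneous (D i)) →
          (MvPolynomial.aeval (fun v : Fin (t + 1) × ((Fin (t + 1)) →₀ ℕ) =>
              (Q v.1).coeff v.2) R = 0
            ↔ ∃ z : Fin (t + 1) → ℂ, z ≠ 0 ∧ ∀ i, MvPolynomial.eval z (Q i) = 0)) ∧
      -- (2) homogeneity of degree `∏_{j ≠ i} D j` in the `i`-th argument
      (∀ Q : Fin (t + 1) → MvPolynomial (Fin (t + 1)) ℂ,
        (∀ i, (Q i).IsHomogeneous (D i)) → ∀ (lam : ℂ) (i : Fin (t + 1)),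
          MvPolynomial.aeval (fun v : Fin (t + 1) × ((Fin (t + 1)) →₀ ℕ) =>
              ((Function.update Q i (lam • Q i)) v.1).coeff v.2) R
            = lam ^ (∏ j ∈ Finset.univ.erase i, D j)
              * MvPolynomial.aeval (fun v : Fin (t + 1) × ((Fin (t + 1)) →₀ ℕ) =>
                  (Q v.1).coeff v.2) R) ∧
      -- (3) irreducibility over ℤ
      Irreducible R ∧
      -- (4) bound on the length of `R`
      (∑ m ∈ R.support, |R.coeff m|)
        ≤ ((t : ℤ) + 1) ^ (3 * (t + 1) * ∏ i, D i) := by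
  classical
  obtain ⟨R, hR⟩ := MRes.exists_R' hD
  replace hR : MRes.IsRes D (MRes.ee D) R := hR
  let f : MRes.Var D → Fin (t + 1) × ((Fin (t + 1)) →₀ ℕ) := fun v => (v.1, v.2.1)
  have hf : Function.Injective f := by
    rintro ⟨i, α⟩ ⟨j, β⟩ h
    simp only [f, Prod.mk.injEq] at h
    obtain ⟨h1, h2⟩ := h
    subst h1
    rw [MRes.Mon.ext h2]
  have hE : ∀ Q : Fin (t + 1) → MvPolynomial (Fin (t + 1)) ℂ,
      MvPolynomial.aeval (fun v : Fin (t + 1) × ((Fin (t + 1)) →₀ ℕ) => (Q v.1).coeff v.2)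
        (MvPolynomial.rename f R) = MRes.E R (fun i => MRes.coef (D i) (Q i)) := by
    intro Q
    rw [MvPolynomial.aeval_rename]
    rfl
  refine ⟨MvPolynomial.rename f R, ?_, ?_, ?_, MRes.irr_rename f hf hR.irr, ?_⟩
  · intro v hv
    obtain ⟨w, _, rfl⟩ := Finset.mem_image.1 (MvPolynomial.vars_rename f R hv)
    exact w.2.2
  · intro Q hQ
    rw [hE, hR.van]
    unfold MRes.HasZero
    simp_rw [fun i => fun z => MRes.F_coef (Q i) (hQ i) z]
  · intro Q _ lam i
    rw [hE, hE]
    have := hR.scale (fun i => MRes.coef (D i) (Q i)) i lam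
    refine Eq.trans ?_ this
    congr 1
    funext j α
    by_cases hj : j = i
    · subst hj; simp [MRes.coef]
    · simp [hj]
  · rw [MvPolynomial.support_rename_of_injective hf,
      Finset.sum_image fun a _ b _ h => Finsupp.mapDomain_injective hf h]
    simp_rw [MvPolynomial.coeff_rename_mapDomain f hf]
    exact hR.length_le hD
end

section
/- Let t ≥ 1 and let α_1, …, α_t ∈ ℂ be algebraic numbers that are linearly independent over ℚ; for m = (m_1,…,m_t) ∈ ℤ^t write m·α = m_1α_1 + ⋯ + m_tα_t and |m| = |m_1| + ⋯ + |m_t|. Fix integers S ≥ 1 and T ≥ 2, set Σ(S) = {m ∈ ℕ^t : |m| < S} and N = |Σ(S)|. Then the homogeneous polynomials Q_{n,ℓ} with n ∈ Σ(S+1) and 0 ≤ ℓ < T have no common zero in ℙ^t(ℂ); that is, there is no nonzero (z_0,…,z_t) ∈ ℂ^{t+1} at which all these polynomials vanish. -/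
open scoped BigOperators



/-- The monomial `X₀^{S−|m|} X₁^{m₁} ⋯ X_t^{m_t}` (as an exponent vector). -/
noncomputable def expVec (t S : ℕ) (m : Fin t → ℕ) : Fin (t + 1) →₀ ℕ :=
  Finsupp.equivFunOnFinite.symm (Fin.cons (S - ∑ i, m i) m)

/-- The homogeneous polynomial of degree `S`
`Q_{n,ℓ} = X₀^{S−|n|} Xⁿ − ∑_{m ∈ Σ(S), 0 ≤ j < T} A_{m,j}^{(ℓ)}(n·α) X₀^{S−|m|} Xᵐ`. -/
noncomputable def Qpoly (t S T : ℕ) (α : Fin t → ℂ)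
    (A : (Fin t → ℕ) → ℕ → Polynomial ℂ) (n : Fin t → ℕ) (ℓ : ℕ) :
    MvPolynomial (Fin (t + 1)) ℂ :=
  MvPolynomial.monomial (expVec t S n) 1
    - ∑ m ∈ Sig t S, ∑ j ∈ Finset.range T,
        MvPolynomial.monomial (expVec t S m)
          ((Polynomial.derivative^[ℓ] (A m j)).eval (dotN α n))


lemma mem_Sig_iff {t S : ℕ} {m : Fin t → ℕ} : m ∈ Sig t S ↔ ∑ i, m i < S := by
  simp only [Sig, Finset.mem_filter, Fintype.mem_piFinset, Finset.mem_range, and_iff_right_iff_imp]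
  intro h i
  exact lt_of_le_of_lt (Finset.single_le_sum (f := m) (fun _ _ => Nat.zero_le _) (Finset.mem_univ i)) h

lemma dotN_injective {t : ℕ} (α : Fin t → ℂ) (hlin : LinearIndependent ℚ α) :
    Function.Injective (dotN α) := by
  intro m n h
  have h2 : ∑ i, ((m i : ℚ) - (n i : ℚ)) • α i = 0 := by
    have : ∑ i, ((m i : ℚ) - (n i : ℚ)) • α i = dotN α m - dotN α n := by
      simp only [dotN, ← Finset.sum_sub_distrib]
      refine Finset.sum_congr rfl fun i _ => ?_
      rw [Algebra.smul_def]
      simp [sub_mul]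
    rw [this, h, sub_self]
  funext i
  have h3 := Fintype.linearIndependent_iff.1 hlin _ h2 i
  have h4 : (m i : ℚ) = n i := by linarith
  exact_mod_cast h4

lemma poly_eq_zero_of_many {ι : Type*} (s : Finset ι) (f : ι → ℂ)
    (hf : Function.Injective f) (T : ℕ) (R : Polynomial ℂ)
    (hdeg : R.degree < (s.card * T : ℕ))
    (hR : ∀ n ∈ s, ∀ ℓ < T, (Polynomial.derivative^[ℓ] R).eval (f n) = 0) : R = 0 := by
  classical
  by_contra hne
  have h1 : ∀ n ∈ s, T ≤ R.roots.count (f n) := by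
    intro n hn
    rw [Polynomial.count_roots]
    rcases Nat.eq_zero_or_pos T with h0 | h0
    · omega
    · have := (Polynomial.lt_rootMultiplicity_iff_isRoot_iterate_derivative
        (n := T - 1) (t := f n) hne).2 (fun k hk => hR n hn k (by omega))
      omega
  have h2 : s.card * T ≤ R.roots.card := by
    calc s.card * T = ∑ n ∈ s, T := by simp
      _ ≤ ∑ n ∈ s, R.roots.count (f n) := Finset.sum_le_sum h1
      _ = ∑ x ∈ s.image f, R.roots.count x := by
        rw [Finset.sum_image (fun a _ b _ h => hf h)]
      _ ≤ ∑ x ∈ s.image f ∪ R.roots.toFinset, R.roots.count x :=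
        Finset.sum_le_sum_of_subset Finset.subset_union_left
      _ = R.roots.card := Multiset.sum_count_eq_card (fun a ha => by simp_all)
  have h3 := Polynomial.card_roots' R
  rw [Polynomial.degree_eq_natDegree hne] at hdeg
  have h4 : R.natDegree < s.card * T := by exact_mod_cast hdeg
  omega

lemma eval_mono {t S : ℕ} (z : Fin (t + 1) → ℂ) (n : Fin t → ℕ) (c : ℂ) :
    MvPolynomial.eval z (MvPolynomial.monomial (expVec t S n) c)
      = c * (z 0 ^ (S - ∑ i, n i) * ∏ i, z (Fin.succ i) ^ n i) := by
  rw [MvPolynomial.eval_monomial, Finsupp.prod_fintype _ _ (by simp), Fin.prod_univ_succ]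
  simp [expVec]

lemma eval_mono' {t S : ℕ} (z : Fin (t + 1) → ℂ) (hz : z 0 ≠ 0) (n : Fin t → ℕ) (c : ℂ)
    (hn : ∑ i, n i ≤ S) :
    MvPolynomial.eval z (MvPolynomial.monomial (expVec t S n) c)
      = z 0 ^ S * (c * ∏ i, (z (Fin.succ i) / z 0) ^ n i) := by
  rw [eval_mono]
  simp only [div_pow, Finset.prod_div_distrib, Finset.prod_pow_eq_pow_sum]
  have : z 0 ^ S = z 0 ^ (S - ∑ i, n i) * z 0 ^ (∑ i, n i) := by
    rw [← pow_add]; congr 1; omega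
  rw [this]
  field_simp

lemma iter_comp (P : Polynomial ℂ) (a : ℂ) (ℓ : ℕ) :
    Polynomial.derivative^[ℓ] (P.comp (Polynomial.X + Polynomial.C a))
      = (Polynomial.derivative^[ℓ] P).comp (Polynomial.X + Polynomial.C a) := by
  induction ℓ generalizing P with
  | zero => rfl
  | succ k ih => simp [Function.iterate_succ_apply, Polynomial.derivative_comp, ih]

/-- **Zero lemma.**  Let `α₁,…,α_t` be algebraic numbers linearly independent
over `ℚ`, `S ≥ 1`, `T ≥ 2`, `N = |Σ(S)|`, and let `A_{m,j}` be the
interpolation polynomials of degree `< NT` with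
`A_{m,j}^{(ℓ)}(n·α) = δ_{(m,j),(n,ℓ)}`.  Then the homogeneous polynomials
`Q_{n,ℓ}` with `n ∈ Σ(S+1)` and `0 ≤ ℓ < T` have no common zero in `ℙ^t(ℂ)`,
i.e. no common nonzero zero in `ℂ^{t+1}`. -/
theorem Qpoly_no_common_zero
    {t : ℕ} (ht : 1 ≤ t) (α : Fin t → ℂ)
    (halg : ∀ i, IsAlgebraic ℚ (α i))
    (hlin : LinearIndependent ℚ α)
    (S T : ℕ) (hS : 1 ≤ S) (hT : 2 ≤ T)
    (N : ℕ) (hN : N = (Sig t S).card)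
    (A : (Fin t → ℕ) → ℕ → Polynomial ℂ)
    (hAdeg : ∀ m ∈ Sig t S, ∀ j < T, (A m j).degree < (N * T : ℕ))
    (hA : ∀ m ∈ Sig t S, ∀ j < T, ∀ n ∈ Sig t S, ∀ ℓ < T,
      (Polynomial.derivative^[ℓ] (A m j)).eval (dotN α n)
        = if m = n ∧ j = ℓ then 1 else 0) :
    ¬∃ z : Fin (t + 1) → ℂ, z ≠ 0 ∧
      ∀ n ∈ Sig t (S + 1), ∀ ℓ < T,
        MvPolynomial.eval z (Qpoly t S T α A n ℓ) = 0 := by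
  classical
  rintro ⟨z, hz, hQ⟩
  by_cases hz0 : z 0 = 0
  · apply hz
    funext k
    refine Fin.cases hz0 (fun i => ?_) k
    have h := hQ (Pi.single i S) (mem_Sig_iff.2 (by simp)) 0 (by omega)
    rw [Qpoly, map_sub, eval_mono, map_sum] at h
    have hs : ∑ m ∈ Sig t S, (MvPolynomial.eval z) (∑ j ∈ Finset.range T,
        MvPolynomial.monomial (expVec t S m)
          ((Polynomial.derivative^[0] (A m j)).eval (dotN α (Pi.single i S)))) = 0 := by
      refine Finset.sum_eq_zero fun m hm => ?_
      rw [map_sum]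
      refine Finset.sum_eq_zero fun j _ => ?_
      have := mem_Sig_iff.1 hm
      rw [eval_mono, hz0, zero_pow (by omega)]
      simp
    rw [hs] at h
    have hp : ∏ x, z (Fin.succ x) ^ (Pi.single i S : Fin t → ℕ) x = z (Fin.succ i) ^ S := by
      rw [Finset.prod_eq_single i]
      · simp
      · intro b _ hb; simp [hb]
      · simp
    rw [hp] at h
    simp at h
    exact h.1
  set y : Fin t → ℂ := fun i => z (Fin.succ i) / z 0 with hy
  set M : (Fin t → ℕ) → ℂ := fun n => ∏ i, y i ^ n i with hM
  set P : Polynomial ℂ := ∑ m ∈ Sig t S, ∑ j ∈ Finset.range T, Polynomial.C (M m) * A m j with hP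
  have hPd : ∀ ℓ x, (Polynomial.derivative^[ℓ] P).eval x =
      ∑ m ∈ Sig t S, ∑ j ∈ Finset.range T, (Polynomial.derivative^[ℓ] (A m j)).eval x * M m := by
    intro ℓ x
    simp only [hP, Polynomial.iterate_derivative_sum, Polynomial.eval_finsetSum,
      Polynomial.iterate_derivative_C_mul, Polynomial.eval_mul, Polynomial.eval_C]
    simp only [mul_comm]
  have key : ∀ n ∈ Sig t (S + 1), ∀ ℓ < T,
      (Polynomial.derivative^[ℓ] P).eval (dotN α n) = M n := by
    intro n hn ℓ hℓ
    have h := hQ n hn ℓ hℓ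
    rw [Qpoly, map_sub, map_sum, eval_mono' z hz0 n 1 (by have := mem_Sig_iff.1 hn; omega)] at h
    have hs : ∑ m ∈ Sig t S, (MvPolynomial.eval z) (∑ j ∈ Finset.range T,
        MvPolynomial.monomial (expVec t S m)
          ((Polynomial.derivative^[ℓ] (A m j)).eval (dotN α n)))
        = z 0 ^ S * (Polynomial.derivative^[ℓ] P).eval (dotN α n) := by
      rw [hPd, Finset.mul_sum]
      refine Finset.sum_congr rfl fun m hm => ?_
      rw [map_sum, Finset.mul_sum]
      refine Finset.sum_congr rfl fun j _ => ?_
      rw [eval_mono' z hz0 m _ (by have := mem_Sig_iff.1 hm; omega)]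
    rw [hs, ← mul_sub, one_mul] at h
    have h2 := (mul_eq_zero.1 h).resolve_left (pow_ne_zero _ hz0)
    exact (sub_eq_zero.1 h2).symm
  have hPdeg : P.degree < (N * T : ℕ) := by
    rw [← Polynomial.mem_degreeLT]
    refine Submodule.sum_mem _ fun m hm => Submodule.sum_mem _ fun j hj => ?_
    rw [← Polynomial.smul_eq_C_mul]
    exact Submodule.smul_mem _ _ (Polynomial.mem_degreeLT.2 (hAdeg m hm j (Finset.mem_range.1 hj)))
  have hzero : (0 : Fin t → ℕ) ∈ Sig t (S + 1) := mem_Sig_iff.2 (by simp)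
  have hd0 : dotN α 0 = 0 := by simp [dotN]
  have hM0 : M 0 = 1 := by simp [hM]
  have hP0 := key 0 hzero 0 (by omega)
  have hP1 := key 0 hzero 1 (by omega)
  rw [hd0, hM0] at hP0 hP1
  simp only [Function.iterate_zero, id, Function.iterate_one] at hP0 hP1
  have hPne : P ≠ 0 := by
    intro h; rw [h] at hP0; simp at hP0
  let i : Fin t := ⟨0, ht⟩
  have hαi : α i ≠ 0 := hlin.ne_zero i
  have hcd : (P.comp (Polynomial.X + Polynomial.C (α i))).degree = P.degree := by
    rw [← Polynomial.taylor_apply, Polynomial.degree_taylor]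
  have hR : P.comp (Polynomial.X + Polynomial.C (α i)) - Polynomial.C (y i) * P = 0 := by
    refine poly_eq_zero_of_many (Sig t S) (dotN α) (dotN_injective α hlin) T _ ?_ ?_
    · rw [← hN, ← Polynomial.mem_degreeLT]
      refine Submodule.sub_mem _ (Polynomial.mem_degreeLT.2 (hcd ▸ hPdeg)) ?_
      rw [← Polynomial.smul_eq_C_mul]
      exact Submodule.smul_mem _ _ (Polynomial.mem_degreeLT.2 hPdeg)
    · intro n hn ℓ hℓ
      have hn' := mem_Sig_iff.1 hn
      rw [Polynomial.iterate_derivative_sub, Polynomial.iterate_derivative_C_mul, iter_comp]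
      simp only [Polynomial.eval_sub, Polynomial.eval_mul, Polynomial.eval_C, Polynomial.eval_comp,
        Polynomial.eval_add, Polynomial.eval_X]
      have e1 : dotN α n + α i = dotN α (n + Pi.single i 1) := by
        simp [dotN, add_mul, Finset.sum_add_distrib, Pi.single_apply]
      have e2 : M (n + Pi.single i 1) = y i * M n := by
        simp only [hM, Pi.add_apply, pow_add, Finset.prod_mul_distrib]
        rw [mul_comm]
        congr 1
        rw [Finset.prod_eq_single i]
        · simp
        · intro b _ hb; simp [hb]
        · simp
      rw [e1, key _ (mem_Sig_iff.2 (by simp [Finset.sum_add_distrib]; omega)) ℓ hℓ, e2,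
        key _ (mem_Sig_iff.2 (by omega)) ℓ hℓ, sub_self]
  have hE := sub_eq_zero.1 hR
  have hy1 : y i = 1 := by
    have := congrArg Polynomial.leadingCoeff hE
    rw [← Polynomial.taylor_apply, Polynomial.leadingCoeff_taylor, Polynomial.leadingCoeff_mul,
      Polynomial.leadingCoeff_C] at this
    have hl : P.leadingCoeff ≠ 0 := Polynomial.leadingCoeff_ne_zero.2 hPne
    exact (mul_right_cancel₀ hl (by rw [one_mul]; exact this)).symm
  rw [hy1, Polynomial.C_1, one_mul] at hE
  have hk : ∀ k : ℕ, P.eval ((k : ℂ) * α i) = 1 := by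
    intro k
    induction k with
    | zero => simpa using hP0
    | succ k ih =>
      have := congrArg (Polynomial.eval ((k : ℂ) * α i)) hE
      rw [Polynomial.eval_comp, ih] at this
      rw [← this]
      simp [add_mul]
  have hconst : P = Polynomial.C 1 := by
    refine Polynomial.eq_of_infinite_eval_eq _ _ (Set.Infinite.mono ?_
      (Set.infinite_range_of_injective (f := fun k : ℕ => (k : ℂ) * α i) ?_))
    · rintro _ ⟨k, rfl⟩
      simpa using hk k
    · intro a b h
      exact_mod_cast mul_right_cancel₀ hαi h
  rw [hconst] at hP1
  simp at hP1
end
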